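/- Let R = ℤ[δ] with δ an indeterminate, and for i ≥ 0 let A_{2i} = 𝒜_i(R; δ) and A_{2i+1} = 𝒜_{i+1/2}(R; δ) be the partition algebras, with e_{2i−1} = p_i and e_{2i} = p_{i+1/2}. Then for each i ≥ 1 the set 𝒜_i = {d_s* c_{(λ,l)} d_t : (λ,l) ∈ Â_i, s,t ∈ Â_i^{(λ,l)}, 0 ≤ l ≤ ⌊i/2⌋} is an R-basis of A_i, and (A_i, *, Â_i, ⊵, 𝒜_i) is a cell datum for A_i. -/

import Mathlib

noncomputable section

/-! ### Combinatorics: permutations, row stabilisers, dominance, reflected branching -/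

/-- `Equiv.Perm (Fin n)` viewed as permuting `{1, …, n} ⊆ ℕ`. -/
def applyPerm (n : ℕ) (v : Equiv.Perm (Fin n)) (k : ℕ) : ℕ :=
  if h : 1 ≤ k ∧ k ≤ n then (v ⟨k - 1, by omega⟩).val + 1 else k

/-- The number of inversions of a permutation (its Coxeter length `ℓ(v)`). -/
def invCount {n : ℕ} (v : Equiv.Perm (Fin n)) : ℕ :=
  (Finset.univ.filter fun p : Fin n × Fin n => p.1 < p.2 ∧ v p.2 < v p.1).card

/-- The adjacent transposition `s_i = (i, i+1)` of `{1, …, n}` (`1 ≤ i ≤ n-1`). -/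
def swN (n i : ℕ) : Equiv.Perm (Fin n) :=
  if h : 1 ≤ i ∧ i < n then Equiv.swap ⟨i - 1, by omega⟩ ⟨i, by omega⟩ else 1

/-- The (0-indexed) row of the entry `k` of the superstandard tableau of shape `μ`. -/
def rowOfNum (μ : YoungDiagram) (k : ℕ) : ℕ :=
  ((Finset.range k).filter (fun r => (∑ i ∈ Finset.range (r+1), μ.rowLen i) < k)).card

/-- The row stabiliser `S_μ ⊆ S_n` of the superstandard tableau `t^μ`. -/
def RowStab (n : ℕ) (μ : YoungDiagram) : Finset (Equiv.Perm (Fin n)) :=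
  Finset.univ.filter
    (fun v => ∀ k : Fin n, rowOfNum μ (applyPerm n v (k.val + 1)) = rowOfNum μ (k.val + 1))

/-- The dominance order: `l` dominates `μ`. -/
def Dominates (l μ : YoungDiagram) : Prop :=
  ∀ k : ℕ, (∑ i ∈ Finset.range k, μ.rowLen i) ≤ ∑ i ∈ Finset.range k, l.rowLen i

/-- For `m = l ∪ {one node}`, the (0-indexed) row of the added node. -/
def addedRow (l m : YoungDiagram) : ℕ :=
  ∑ j ∈ Finset.range (m.card + 1), if m.rowLen j ≠ l.rowLen j then j else 0

/-- For `m = l ∪ {(j, m_j)}`, the value `a = m_1 + ⋯ + m_j` (sum of the row lengths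
of `m` up to and including the row of the added node). -/
def aVal (l m : YoungDiagram) : ℕ :=
  ∑ r ∈ Finset.range (addedRow l m + 1), m.rowLen r

/-- The edge relation of the branching diagram obtained by reflections from Young's
lattice: `(λ,l) → (μ,l)` iff `μ` is obtained from `λ` by adding a node, and
`(λ,l) → (μ,l+1)` iff `μ` is obtained from `λ` by removing a node. -/
def WEdge (a b : YoungDiagram × ℕ) : Prop :=
  (b.2 = a.2 ∧ a.1 ≤ b.1 ∧ b.1.card = a.1.card + 1) ∨
  (b.2 = a.2 + 1 ∧ b.1 ≤ a.1 ∧ a.1.card = b.1.card + 1)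

/-- Vertices `(λ, l)` at level `i` of the reflected branching diagram:
`0 ≤ l ≤ ⌊i/2⌋` and `λ ⊢ i - 2l`. -/
abbrev WLam (i : ℕ) : Type := {x : YoungDiagram × ℕ // 2 * x.2 ≤ i ∧ x.1.card = i - 2 * x.2}

/-- Paths on the reflected branching diagram from `(∅,0)` to `x` at level `i`. -/
def WPath (i : ℕ) (x : YoungDiagram × ℕ) : Type :=
  {pp : Fin (i + 1) → YoungDiagram × ℕ //
    pp 0 = (⊥, 0) ∧ pp (Fin.last i) = x ∧
    ∀ k : Fin i, WEdge (pp k.castSucc) (pp k.succ)}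

/-- The strict order `m ▷ l` on the labels `(λ, l)`: larger second component, or
equal second components and strict dominance of the diagrams. -/
def wGT (m l : YoungDiagram × ℕ) : Prop :=
  l.2 < m.2 ∨ (m.2 = l.2 ∧ Dominates m.1 l.1 ∧ m.1 ≠ l.1)

/-! ### The partition algebra, by generators and relations (Halverson–Ram, East) -/

/-- Generators `t_{s_i}` (`1 ≤ i ≤ m-1`), `p_i` (`1 ≤ i ≤ m`), `p_{i+1/2}`
(`1 ≤ i ≤ m-1`) of the partition algebra `𝒜_m`. -/
inductive PGen (m : ℕ) : Type
  | ts (i : {i : ℕ // 1 ≤ i ∧ i < m}) : PGen m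
  | p (i : {i : ℕ // 1 ≤ i ∧ i ≤ m}) : PGen m
  | ph (i : {i : ℕ // 1 ≤ i ∧ i < m}) : PGen m

open FreeAlgebra in
/-- The defining relations of the partition algebra `𝒜_m(R; δ)`. -/
inductive PARel (R : Type) [CommRing R] (δ : R) (m : ℕ) :
    FreeAlgebra R (PGen m) → FreeAlgebra R (PGen m) → Prop
  -- Coxeter relations
  | coxInv (i) : PARel R δ m (ι R (PGen.ts i) * ι R (PGen.ts i)) 1
  | coxComm (i j) (h : i.1 + 1 < j.1 ∨ j.1 + 1 < i.1) :
      PARel R δ m (ι R (PGen.ts i) * ι R (PGen.ts j))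
        (ι R (PGen.ts j) * ι R (PGen.ts i))
  | coxBraid (i j) (h : j.1 = i.1 + 1) :
      PARel R δ m (ι R (PGen.ts i) * ι R (PGen.ts j) * ι R (PGen.ts i))
        (ι R (PGen.ts j) * ι R (PGen.ts i) * ι R (PGen.ts j))
  -- Idempotent relations
  | pIdem (i) : PARel R δ m (ι R (PGen.p i) * ι R (PGen.p i))
      (algebraMap R _ δ * ι R (PGen.p i))
  | phIdem (i) : PARel R δ m (ι R (PGen.ph i) * ι R (PGen.ph i)) (ι R (PGen.ph i))
  | tsPhL (i j) (h : i.1 = j.1) :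
      PARel R δ m (ι R (PGen.ts i) * ι R (PGen.ph j)) (ι R (PGen.ph j))
  | tsPhR (i j) (h : i.1 = j.1) :
      PARel R δ m (ι R (PGen.ph j) * ι R (PGen.ts i)) (ι R (PGen.ph j))
  | tsPPL (i j k) (h : j.1 = i.1 ∧ k.1 = i.1 + 1) :
      PARel R δ m (ι R (PGen.ts i) * (ι R (PGen.p j) * ι R (PGen.p k)))
        (ι R (PGen.p j) * ι R (PGen.p k))
  | tsPPR (i j k) (h : j.1 = i.1 ∧ k.1 = i.1 + 1) :
      PARel R δ m ((ι R (PGen.p j) * ι R (PGen.p k)) * ι R (PGen.ts i))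
        (ι R (PGen.p j) * ι R (PGen.p k))
  -- Commutation relations
  | ppComm (i j) :
      PARel R δ m (ι R (PGen.p i) * ι R (PGen.p j)) (ι R (PGen.p j) * ι R (PGen.p i))
  | phphComm (i j) :
      PARel R δ m (ι R (PGen.ph i) * ι R (PGen.ph j))
        (ι R (PGen.ph j) * ι R (PGen.ph i))
  | pPhComm (i j) (h : i.1 ≠ j.1 ∧ i.1 ≠ j.1 + 1) :
      PARel R δ m (ι R (PGen.p i) * ι R (PGen.ph j)) (ι R (PGen.ph j) * ι R (PGen.p i))
  | tsPComm (i j) (h : j.1 ≠ i.1 ∧ j.1 ≠ i.1 + 1) :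
      PARel R δ m (ι R (PGen.ts i) * ι R (PGen.p j)) (ι R (PGen.p j) * ι R (PGen.ts i))
  | tsPhComm (i j) (h : j.1 + 1 ≠ i.1 ∧ j.1 ≠ i.1 + 1) :
      PARel R δ m (ι R (PGen.ts i) * ι R (PGen.ph j))
        (ι R (PGen.ph j) * ι R (PGen.ts i))
  | tsPTs (i j k) (h : j.1 = i.1 ∧ k.1 = i.1 + 1) :
      PARel R δ m (ι R (PGen.ts i) * ι R (PGen.p j) * ι R (PGen.ts i))
        (ι R (PGen.p k))
  | tsPhTs (i i' j j') (h : i.1 = i'.1 + 1 ∧ j.1 + 1 = i.1 ∧ j'.1 = i.1) :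
      PARel R δ m (ι R (PGen.ts i) * ι R (PGen.ph j) * ι R (PGen.ts i))
        (ι R (PGen.ts i') * ι R (PGen.ph j') * ι R (PGen.ts i'))
  -- Contraction relations
  | phPPh (i j) (h : j.1 = i.1 ∨ j.1 = i.1 + 1) :
      PARel R δ m (ι R (PGen.ph i) * ι R (PGen.p j) * ι R (PGen.ph i))
        (ι R (PGen.ph i))
  | pPhP (i j) (h : j.1 = i.1 ∨ j.1 + 1 = i.1) :
      PARel R δ m (ι R (PGen.p i) * ι R (PGen.ph j) * ι R (PGen.p i))
        (ι R (PGen.p i))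

/-- The partition algebra `𝒜_m(R; δ)`. -/
abbrev PA (R : Type) [CommRing R] (δ : R) (m : ℕ) : Type := RingQuot (PARel R δ m)

variable (R : Type) [CommRing R] (δ : R) (m : ℕ)

/-- The generator `t_{s_i}` (equal to `1` out of range). -/
def paT (i : ℕ) : PA R δ m :=
  if h : 1 ≤ i ∧ i < m then
    RingQuot.mkAlgHom R (PARel R δ m) (FreeAlgebra.ι R (PGen.ts ⟨i, h⟩))
  else 1

/-- The generator `p_i` (equal to `1` out of range). -/
def paP (i : ℕ) : PA R δ m :=
  if h : 1 ≤ i ∧ i ≤ m then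
    RingQuot.mkAlgHom R (PARel R δ m) (FreeAlgebra.ι R (PGen.p ⟨i, h⟩))
  else 1

/-- The generator `p_{i+1/2}` (equal to `1` out of range). -/
def paPh (i : ℕ) : PA R δ m :=
  if h : 1 ≤ i ∧ i < m then
    RingQuot.mkAlgHom R (PARel R δ m) (FreeAlgebra.ι R (PGen.ph ⟨i, h⟩))
  else 1

/-- The contraction `e_k` of the tower: `e_{2j-1} = p_j` and `e_{2j} = p_{j+1/2}`. -/
def paE (k : ℕ) : PA R δ m :=
  if k % 2 = 1 then paP R δ m ((k + 1) / 2) else paPh R δ m (k / 2)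

/-- The element `e^{(l)}_{i-1} = e_{i-2l+1} e_{i-2l+3} ⋯ e_{i-1}` (`l` factors). -/
def eStairP (i l : ℕ) : PA R δ m :=
  ((List.range l).map (fun t => paE R δ m (i - 2 * l + 1 + 2 * t))).prod

/-- The element `c_{(μ,m')} = (Σ_{v ∈ S_μ} t_v) e^{(m')}_{i-1}` of `A_i ⊆ 𝒜_m`. -/
def cPA (tw : Equiv.Perm (Fin m) → PA R δ m) (i : ℕ) (μ : YoungDiagram) (m' : ℕ) :
    PA R δ m :=
  (∑ v ∈ RowStab m μ, tw v) * eStairP R δ m i m'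

/-- The ascending product `t_{a,b} = t_{s_a} t_{s_{a+1}} ⋯ t_{s_{b-1}}` (`a ≤ b`). -/
def tAsc (a b : ℕ) : PA R δ m :=
  ((List.range (b - a)).map (fun k => paT R δ m (a + k))).prod

/-- The descending product `t_{b,a} = t_{s_{b-1}} ⋯ t_{s_a}` (`b ≥ a`). -/
def tDesc (b a : ℕ) : PA R δ m :=
  ((List.range (b - a)).map (fun k => paT R δ m (b - 1 - k))).prod

/-- The lifted branching coefficient `\bar d^{(2i)}_{λ→μ} = t_{a,i}`
(for `μ = λ ∪ {(j, μ_j)} ⊢ i`, `a = μ_1 + ⋯ + μ_j`). -/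
def dBarPA (i : ℕ) (lam mu : YoungDiagram) : PA R δ m :=
  tAsc R δ m (aVal lam mu) i

/-- The lifted branching coefficient `\bar u^{(2i)}_{λ→μ} = t_{i,a} Σ_{r=0}^{λ_j} t_{a,a-r}`. -/
def uBarPA (i : ℕ) (lam mu : YoungDiagram) : PA R δ m :=
  tDesc R δ m i (aVal lam mu) *
    ∑ r ∈ Finset.range (lam.rowLen (addedRow lam mu) + 1),
      tDesc R δ m (aVal lam mu) (aVal lam mu - r)

/-- The branching coefficient for one step of a path, from level `k` to level `k+1`
(four cases, according to the parity of `k` and whether the second label stays or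
increases). -/
def dStepPA (k : ℕ) (a b : YoungDiagram × ℕ) : PA R δ m :=
  if k % 2 = 1 then
    -- step `𝒜_{i-1/2} ⊆ 𝒜_i` (into even level `k+1 = 2i`)
    (if b.2 = a.2 then
      dBarPA R δ m ((k + 1 - 2 * a.2) / 2) a.1 b.1 * eStairP R δ m k a.2
    else eStairP R δ m k a.2)
  else
    -- step `𝒜_i ⊆ 𝒜_{i+1/2}` (into odd level `k+1 = 2i+1`)
    (if b.2 = a.2 then eStairP R δ m k a.2
    else uBarPA R δ m ((k - 2 * a.2) / 2) b.1 a.1 * eStairP R δ m k a.2)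

/-- The edge relation of the branching diagram `Â` of the tower of partition
algebras, from level `k` to level `k+1`. -/
def PEdge (k : ℕ) (a b : YoungDiagram × ℕ) : Prop :=
  if k % 2 = 1 then
    (b.2 = a.2 ∧ a.1 ≤ b.1 ∧ b.1.card = a.1.card + 1) ∨ (b.2 = a.2 + 1 ∧ b.1 = a.1)
  else
    (b.2 = a.2 ∧ b.1 = a.1) ∨ (b.2 = a.2 + 1 ∧ b.1 ≤ a.1 ∧ a.1.card = b.1.card + 1)

/-- Vertices `(λ, l)` at level `i` of `Â`: `0 ≤ l ≤ ⌊i/2⌋`, `λ ⊢ ⌊(i-2l)/2⌋`. -/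
abbrev PLam (i : ℕ) : Type :=
  {x : YoungDiagram × ℕ // 2 * x.2 ≤ i ∧ x.1.card = (i - 2 * x.2) / 2}

/-- Paths on `Â` from `(∅,0)` to `x` at level `i`. -/
def PPath (i : ℕ) (x : YoungDiagram × ℕ) : Type :=
  {pp : Fin (i + 1) → YoungDiagram × ℕ //
    pp 0 = (⊥, 0) ∧ pp (Fin.last i) = x ∧
    ∀ k : Fin i, PEdge k.val (pp k.castSucc) (pp k.succ)}

/-- The path element `d_t`. -/
def dPathPA (i : ℕ) {x : YoungDiagram × ℕ} (t : PPath i x) : PA R δ m :=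
  ((List.ofFn (fun k : Fin i =>
      dStepPA R δ m k.val (t.1 k.castSucc) (t.1 k.succ))).reverse).prod

/-- The algebra `A_i` of the tower: `A_{2k} = 𝒜_k` and `A_{2k+1} = 𝒜_{k+1/2}`, the
latter realized as the subalgebra of the ambient partition algebra `𝒜_{(i+1)/2}`
generated by `t_{s_1}, …, t_{s_{m-2}}, p_1, p_{3/2}, …, p_{m-1}, p_{m-1/2}`. -/
def ASub (i : ℕ) : Subalgebra R (PA R δ ((i + 1) / 2)) :=
  if i % 2 = 0 then ⊤
  else Algebra.adjoin R
    ({x | ∃ j : ℕ, 1 ≤ j ∧ j + 1 < (i + 1) / 2 ∧ x = paT R δ ((i + 1) / 2) j} ∪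
     {x | ∃ j : ℕ, 1 ≤ j ∧ j < (i + 1) / 2 ∧ x = paP R δ ((i + 1) / 2) j} ∪
     {x | ∃ j : ℕ, 1 ≤ j ∧ j < (i + 1) / 2 ∧ x = paPh R δ ((i + 1) / 2) j})

/-- Permutations, point idempotents and block idempotents of a partition-type algebra, together
with the relations between them. -/
structure PData (S : Type) [CommRing S] (d : S) (A : Type) [Ring A] [Algebra S A]
    (ι : Type) [DecidableEq ι] where
  /-- the permutation `σ` as an element of the algebra -/
  T : Equiv.Perm ι →* A
  /-- the diagram isolating the point `a` -/
  P : ι → A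
  /-- the diagram merging the points `a` and `b` -/
  M : ι → ι → A
  T_P : ∀ σ a, T σ * P a = P (σ a) * T σ
  T_M : ∀ σ a b, T σ * M a b = M (σ a) (σ b) * T σ
  P_comm : ∀ a b, Commute (P a) (P b)
  P_sq : ∀ a, P a * P a = d • P a
  M_symm : ∀ a b, M a b = M b a
  M_self : ∀ a, M a a = 1
  M_idem : ∀ a b, M a b * M a b = M a b
  M_comm : ∀ a b x y, Commute (M a b) (M x y)
  M_trans : ∀ a b x, M a b * M b x = M a b * M a x
  P_M_comm : ∀ a b x, a ≠ b → a ≠ x → Commute (P a) (M b x)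
  T_swap_M : ∀ a b, T (Equiv.swap a b) * M a b = M a b
  T_swap_P : ∀ a b, a ≠ b → T (Equiv.swap a b) * (P a * P b) = P a * P b
  PMP : ∀ a b, a ≠ b → P a * M a b * P a = P a
  MPM : ∀ a b, a ≠ b → M a b * P a * M a b = M a b
  PMP_swap : ∀ a b, a ≠ b → P b * M a b * P a = P b * T (Equiv.swap a b)

namespace PData

variable {S : Type} [CommRing S] {d : S} {A : Type} [Ring A] [Algebra S A]
  {ι : Type} [DecidableEq ι] (D : PData S d A ι)

/-- Isolate all points of `U`. -/
def PS (U : Finset ι) : A := U.noncommProd D.P (fun a _ b _ _ => D.P_comm a b)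

/-- Merge all points of `U` with `z`. -/
def Dst (z : ι) (U : Finset ι) : A :=
  U.noncommProd (fun b => D.M b z) (fun a _ b _ _ => D.M_comm a z b z)

@[simp] lemma PS_empty : D.PS ∅ = 1 := Finset.noncommProd_empty _ _

@[simp] lemma Dst_empty (z : ι) : D.Dst z ∅ = 1 := Finset.noncommProd_empty _ _

lemma PS_insert {a : ι} {U : Finset ι} (h : a ∉ U) : D.PS (insert a U) = D.P a * D.PS U :=
  Finset.noncommProd_insert_of_notMem _ _ _ _ h

lemma Dst_insert {a z : ι} {U : Finset ι} (h : a ∉ U) :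
    D.Dst z (insert a U) = D.M a z * D.Dst z U :=
  Finset.noncommProd_insert_of_notMem _ _ _ _ h

lemma commute_PS {x : A} {U : Finset ι} (h : ∀ a ∈ U, Commute x (D.P a)) : Commute x (D.PS U) :=
  Finset.noncommProd_commute _ _ _ _ h

lemma commute_Dst {x : A} {z : ι} {U : Finset ι} (h : ∀ a ∈ U, Commute x (D.M a z)) :
    Commute x (D.Dst z U) :=
  Finset.noncommProd_commute _ _ _ _ h

lemma P_PS (a : ι) (U : Finset ι) : Commute (D.P a) (D.PS U) :=
  D.commute_PS fun b _ => D.P_comm a b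

lemma M_Dst (a b z : ι) (U : Finset ι) : Commute (D.M a b) (D.Dst z U) :=
  D.commute_Dst fun x _ => D.M_comm a b x z

lemma P_Dst {a z : ι} {U : Finset ι} (hz : a ≠ z) (h : a ∉ U) : Commute (D.P a) (D.Dst z U) :=
  D.commute_Dst fun x hx => D.P_M_comm a x z (fun e => h (e ▸ hx)) hz

lemma M_PS {a b : ι} {U : Finset ι} (ha : a ∉ U) (hb : b ∉ U) : Commute (D.M a b) (D.PS U) :=
  D.commute_PS fun x hx =>
    (D.P_M_comm x a b (fun e => ha (e ▸ hx)) (fun e => hb (e ▸ hx))).symm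

lemma PS_insert' {a : ι} {U : Finset ι} (h : a ∉ U) : D.PS (insert a U) = D.PS U * D.P a := by
  rw [D.PS_insert h, (D.P_PS a U).eq]

lemma Dst_insert' {a z : ι} {U : Finset ι} (h : a ∉ U) :
    D.Dst z (insert a U) = D.Dst z U * D.M a z := by
  rw [D.Dst_insert h, (D.M_Dst a z z U).eq]

lemma T_PS (σ : Equiv.Perm ι) (U : Finset ι) :
    D.T σ * D.PS U = D.PS (U.map σ.toEmbedding) * D.T σ := by
  induction U using Finset.induction_on with
  | empty => simp
  | insert a U h ih =>
    rw [D.PS_insert h, Finset.map_insert, D.PS_insert (by simpa using h), ← mul_assoc, D.T_P,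
      mul_assoc, ih, mul_assoc]
    rfl

lemma M_swap_T (a b : ι) : D.M a b * D.T (Equiv.swap a b) = D.M a b := by
  have h := D.T_M (Equiv.swap a b) a b
  rw [D.T_swap_M, Equiv.swap_apply_left, Equiv.swap_apply_right, D.M_symm b a] at h
  exact h.symm

lemma PS_Dst_PS {z : ι} {U : Finset ι} (h : z ∉ U) :
    D.PS U * D.Dst z U * D.PS U = D.PS U := by
  induction U using Finset.induction_on with
  | empty => simp
  | insert a U ha ih =>
    have hz : z ∉ U := fun e => h (Finset.mem_insert_of_mem e)
    have haz : a ≠ z := fun e => h (e ▸ Finset.mem_insert_self a U)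
    have h1 := (D.M_PS ha hz).eq
    have h2 := (D.P_Dst haz ha).eq
    have h3 := (D.P_PS a U).eq
    calc _ = D.P a * D.PS U * (D.M a z * D.Dst z U) * (D.P a * D.PS U) := by
          rw [D.PS_insert ha, D.Dst_insert ha]
      _ = D.P a * (D.PS U * D.M a z) * (D.Dst z U * D.P a) * D.PS U := by noncomm_ring
      _ = D.P a * D.M a z * (D.PS U * D.P a) * D.Dst z U * D.PS U := by
          rw [← h1, ← h2]; noncomm_ring
      _ = (D.P a * D.M a z * D.P a) * (D.PS U * D.Dst z U * D.PS U) := by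
          rw [← h3]; noncomm_ring
      _ = _ := by rw [ih hz, D.PMP a z haz, D.PS_insert ha]

lemma Dst_PS_Dst {z : ι} {U : Finset ι} (h : z ∉ U) :
    D.Dst z U * D.PS U * D.Dst z U = D.Dst z U := by
  induction U using Finset.induction_on with
  | empty => simp
  | insert a U ha ih =>
    have hz : z ∉ U := fun e => h (Finset.mem_insert_of_mem e)
    have haz : a ≠ z := fun e => h (e ▸ Finset.mem_insert_self a U)
    have h1 := (D.P_Dst haz ha).eq
    have h2 := (D.M_PS ha hz).eq
    have h3 := (D.M_Dst a z z U).eq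
    calc _ = D.M a z * D.Dst z U * (D.P a * D.PS U) * (D.M a z * D.Dst z U) := by
          rw [D.PS_insert ha, D.Dst_insert ha]
      _ = D.M a z * (D.Dst z U * D.P a) * (D.PS U * D.M a z) * D.Dst z U := by noncomm_ring
      _ = D.M a z * D.P a * (D.Dst z U * D.M a z) * D.PS U * D.Dst z U := by
          rw [← h1, ← h2]; noncomm_ring
      _ = (D.M a z * D.P a * D.M a z) * (D.Dst z U * D.PS U * D.Dst z U) := by
          rw [← h3]; noncomm_ring
      _ = _ := by rw [ih hz, D.MPM a z haz, D.Dst_insert ha]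

lemma T_swap_PS {a b : ι} {U : Finset ι} (ha : a ∈ U) (hb : b ∈ U) :
    D.T (Equiv.swap a b) * D.PS U = D.PS U := by
  rcases eq_or_ne a b with rfl | hab
  · simp [Equiv.swap_self, ← Equiv.Perm.one_def]
  · obtain ⟨V, hV, rfl⟩ : ∃ V, a ∉ V ∧ U = insert a V :=
      ⟨U.erase a, by simp, (Finset.insert_erase ha).symm⟩
    have hb' : b ∈ V := by simpa [hab.symm] using hb
    obtain ⟨W, hW, rfl⟩ : ∃ W, b ∉ W ∧ V = insert b W :=
      ⟨V.erase b, by simp, (Finset.insert_erase hb').symm⟩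
    rw [D.PS_insert hV, D.PS_insert hW, ← mul_assoc (D.P a), ← mul_assoc, D.T_swap_P a b hab]

lemma PS_T_swap {a b : ι} {U : Finset ι} (ha : a ∈ U) (hb : b ∈ U) :
    D.PS U * D.T (Equiv.swap a b) = D.PS U := by
  have h := D.T_PS (Equiv.swap a b) U
  rw [D.T_swap_PS ha hb] at h
  have e : U.map (Equiv.swap a b).toEmbedding = U := by
    ext x
    rw [Finset.mem_map_equiv, Equiv.symm_swap]
    rcases eq_or_ne x a with rfl | h1
    · simp [ha, hb]
    rcases eq_or_ne x b with rfl | h2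
    · simp [ha, hb]
    rw [Equiv.swap_apply_of_ne_of_ne h1 h2]
  rw [e] at h
  exact h.symm

end PData

namespace PData

variable {S : Type} [CommRing S] {d : S} {A : Type} [Ring A] [Algebra S A]
  {ι : Type} [DecidableEq ι] (D : PData S d A ι)

lemma PS_Dst_PS_insert {z : ι} {U : Finset ι} (h : z ∉ U) :
    D.PS (insert z U) * D.Dst z U * D.PS U = D.PS (insert z U) := by
  rw [D.PS_insert h, mul_assoc, mul_assoc, ← mul_assoc (D.PS U), D.PS_Dst_PS h]

lemma PS_Dst_insert {y z : ι} {U : Finset ι} (hz : z ∉ U) (hy : y ∉ U) :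
    D.PS (insert z U) * D.Dst z (insert y U) * D.PS U = D.PS (insert z U) * D.M y z := by
  have h1 := (D.M_PS hy hz).eq
  calc _ = D.PS (insert z U) * D.Dst z U * (D.M y z * D.PS U) := by
        rw [D.Dst_insert' hy]; noncomm_ring
    _ = D.PS (insert z U) * D.Dst z U * D.PS U * D.M y z := by rw [h1]; noncomm_ring
    _ = _ := by rw [D.PS_Dst_PS_insert hz]

lemma PS_Dst_PS_swap {y z : ι} {U : Finset ι} (hz : z ∉ U) (hy : y ∉ U) (hyz : y ≠ z) :
    D.PS (insert z U) * D.Dst z (insert y U) * D.PS (insert y U)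
      = D.PS (insert z U) * D.T (Equiv.swap y z) := by
  rw [D.PS_insert' hy, ← mul_assoc, D.PS_Dst_insert hz hy, D.PS_insert' hz, mul_assoc, mul_assoc,
    ← mul_assoc (D.P z), D.PMP_swap y z hyz, ← mul_assoc]

lemma Dst_PS_M {c z : ι} {U : Finset ι} (hz : z ∉ U) (hc : c ∉ U) (hcz : c ≠ z) :
    D.Dst z (insert c U) * D.PS (insert c U) * D.M c z = D.Dst z (insert c U) * D.PS U := by
  have h1 := (D.M_PS hc hz).eq
  calc _ = D.Dst z U * (D.M c z * D.P c) * (D.PS U * D.M c z) := by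
        rw [D.PS_insert hc, D.Dst_insert' hc]; noncomm_ring
    _ = D.Dst z U * (D.M c z * D.P c * D.M c z) * D.PS U := by rw [← h1]; noncomm_ring
    _ = _ := by rw [D.MPM c z hcz, D.Dst_insert' hc]

lemma Dst_T_swap {a b z : ι} {U : Finset ι} (ha : a ∈ insert z U) (hb : b ∈ insert z U) :
    D.Dst z U * D.T (Equiv.swap a b) = D.Dst z U := by
  have key : ∀ {a : ι}, a ∈ insert z U → D.Dst z U * D.M a z = D.Dst z U := by
    intro a ha
    rcases Finset.mem_insert.1 ha with rfl | ha
    · rw [D.M_self, mul_one]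
    · rw [← Finset.insert_erase ha, D.Dst_insert' (by simp), mul_assoc, D.M_idem]
  have hab : D.Dst z U * D.M a b = D.Dst z U := by
    calc _ = D.Dst z U * D.M a z * D.M a b := by rw [key ha]
      _ = D.Dst z U * D.M a z * D.M z b := by rw [mul_assoc, mul_assoc, ← D.M_trans]
      _ = _ := by rw [key ha, D.M_symm, key hb]
  rw [← hab, mul_assoc, D.M_swap_T]

/-- The permutations fixing every point outside `K`. -/
def fixOut (K : Finset ι) : Subgroup (Equiv.Perm ι) where
  carrier := {σ | ∀ a, a ∉ K → σ a = a}
  mul_mem' := fun {σ τ} hσ hτ a ha => by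
    rw [Equiv.Perm.mul_apply, hτ a ha, hσ a ha]
  one_mem' := fun _ _ => rfl
  inv_mem' := fun {σ} hσ a ha => by
    rw [Equiv.Perm.inv_eq_iff_eq, hσ a ha]

omit [DecidableEq ι] in
lemma mem_fixOut {K : Finset ι} {σ : Equiv.Perm ι} : σ ∈ fixOut K ↔ ∀ a, a ∉ K → σ a = a :=
  Iff.rfl

omit [DecidableEq ι] in
lemma fixOut_mono {K L : Finset ι} (h : K ⊆ L) : fixOut K ≤ fixOut L :=
  fun _ hσ a ha => hσ a fun e => ha (h e)

lemma fixOut_apply_mem {K B : Finset ι} (hKB : K ⊆ B) {σ : Equiv.Perm ι} (hσ : σ ∈ fixOut K)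
    {a : ι} (ha : a ∈ B) : σ a ∈ B := by
  by_contra h
  have h1 : σ (σ a) = σ a := hσ _ fun e => h (hKB e)
  exact h (by rwa [σ.injective h1])

lemma swap_mem_fixOut {K : Finset ι} {a b : ι} (ha : a ∈ K) (hb : b ∈ K) :
    Equiv.swap a b ∈ fixOut K := fun _ hx =>
  Equiv.swap_apply_of_ne_of_ne (fun e => hx (e ▸ ha)) (fun e => hx (e ▸ hb))

/-- The subalgebra generated by the permutations and point idempotents supported in `K` and the
block idempotents supported in `B`. -/
def Alg (K B : Finset ι) : Subalgebra S A :=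
  Algebra.adjoin S (D.T '' fixOut K ∪ D.P '' K ∪ {x | ∃ a ∈ B, ∃ b ∈ B, x = D.M a b})

variable {D} {K B : Finset ι}

lemma T_mem_Alg {σ : Equiv.Perm ι} (h : σ ∈ fixOut K) : D.T σ ∈ D.Alg K B :=
  Algebra.subset_adjoin (Or.inl (Or.inl ⟨σ, h, rfl⟩))

lemma P_mem_Alg {a : ι} (h : a ∈ K) : D.P a ∈ D.Alg K B :=
  Algebra.subset_adjoin (Or.inl (Or.inr ⟨a, h, rfl⟩))

lemma M_mem_Alg {a b : ι} (ha : a ∈ B) (hb : b ∈ B) : D.M a b ∈ D.Alg K B :=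
  Algebra.subset_adjoin (Or.inr ⟨a, ha, b, hb, rfl⟩)

lemma Alg_mono {K' B' : Finset ι} (hK : K ⊆ K') (hB : B ⊆ B') : D.Alg K B ≤ D.Alg K' B' := by
  refine Algebra.adjoin_le ?_
  rintro x ((⟨σ, h, rfl⟩ | ⟨a, h, rfl⟩) | ⟨a, ha, b, hb, rfl⟩)
  · exact T_mem_Alg (fixOut_mono hK h)
  · exact P_mem_Alg (hK h)
  · exact M_mem_Alg (hB ha) (hB hb)

lemma PS_mem_Alg {U : Finset ι} (h : U ⊆ K) : D.PS U ∈ D.Alg K B := by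
  induction U using Finset.induction_on with
  | empty => simp [one_mem]
  | insert a U ha ih =>
    rw [D.PS_insert ha]
    exact mul_mem (P_mem_Alg (h (Finset.mem_insert_self _ _)))
      (ih fun x hx => h (Finset.mem_insert_of_mem hx))

lemma Dst_mem_Alg {U : Finset ι} {z : ι} (h : U ⊆ B) (hz : z ∈ B) : D.Dst z U ∈ D.Alg K B := by
  induction U using Finset.induction_on with
  | empty => simp [one_mem]
  | insert a U ha ih =>
    rw [D.Dst_insert ha]
    exact mul_mem (M_mem_Alg (h (Finset.mem_insert_self _ _)) hz)
      (ih fun x hx => h (Finset.mem_insert_of_mem hx))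

variable (D) in
/-- Products of block idempotents supported in `B`. -/
def MM (B : Finset ι) : Submonoid A :=
  Submonoid.closure {x | ∃ a ∈ B, ∃ b ∈ B, x = D.M a b}

lemma M_mem_MM {a b : ι} (ha : a ∈ B) (hb : b ∈ B) : D.M a b ∈ D.MM B :=
  Submonoid.subset_closure ⟨a, ha, b, hb, rfl⟩

lemma MM_mono {B' : Finset ι} (h : B ⊆ B') : D.MM B ≤ D.MM B' :=
  Submonoid.closure_mono fun _ ⟨a, ha, b, hb, e⟩ => ⟨a, h ha, b, h hb, e⟩

lemma MM_le_Alg : ∀ x ∈ D.MM B, x ∈ D.Alg K B := by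
  intro x hx
  have : D.MM B ≤ (D.Alg K B).toSubmonoid :=
    Submonoid.closure_le.2 fun _ ⟨a, ha, b, hb, e⟩ => e ▸ M_mem_Alg ha hb
  exact this hx

lemma MM_split (j : ι) {x : A} (hx : x ∈ D.MM B) :
    x ∈ D.MM (B.erase j) ∨ ∃ b ∈ B, b ≠ j ∧ ∃ y ∈ D.MM (B.erase j), x = D.M j b * y := by
  induction hx using Submonoid.closure_induction_left with
  | one => exact Or.inl (one_mem _)
  | mul_left w hw y _ ih =>
    obtain ⟨a, ha, c, hc, rfl⟩ := hw
    have key : ∀ c ∈ B, (D.M j c * y ∈ D.MM (B.erase j) ∨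
        ∃ b ∈ B, b ≠ j ∧ ∃ u ∈ D.MM (B.erase j), D.M j c * y = D.M j b * u) := by
      intro c hc
      rcases eq_or_ne c j with rfl | hcj
      · rw [D.M_self, one_mul]; exact ih
      rcases ih with ih | ⟨b, hb, hbj, u, hu, rfl⟩
      · exact Or.inr ⟨c, hc, hcj, y, ih, rfl⟩
      · refine Or.inr ⟨c, hc, hcj, D.M c b * u,
          mul_mem (M_mem_MM (Finset.mem_erase.2 ⟨hcj, hc⟩) (Finset.mem_erase.2 ⟨hbj, hb⟩)) hu, ?_⟩
        rw [← mul_assoc, ← mul_assoc, D.M_trans]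
    rcases eq_or_ne a j with rfl | haj
    · exact key c hc
    rcases eq_or_ne c j with rfl | hcj
    · rw [D.M_symm]; exact key a ha
    have hm : D.M a c ∈ D.MM (B.erase j) :=
      M_mem_MM (Finset.mem_erase.2 ⟨haj, ha⟩) (Finset.mem_erase.2 ⟨hcj, hc⟩)
    rcases ih with ih | ⟨b, hb, hbj, u, hu, rfl⟩
    · exact Or.inl (mul_mem hm ih)
    · refine Or.inr ⟨b, hb, hbj, D.M a c * u, mul_mem hm hu, ?_⟩
      rw [← mul_assoc, (D.M_comm a c j b).eq, mul_assoc]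

lemma P_MM_comm {j : ι} {x : A} (hx : x ∈ D.MM (B.erase j)) : Commute (D.P j) x := by
  induction hx using Submonoid.closure_induction with
  | mem x h =>
    obtain ⟨a, ha, b, hb, rfl⟩ := h
    exact D.P_M_comm j a b (Finset.ne_of_mem_erase ha).symm (Finset.ne_of_mem_erase hb).symm
  | one => exact Commute.one_right _
  | mul x y _ _ hx hy => exact hx.mul_right hy

lemma MM_mul_T {σ : Equiv.Perm ι} (hσ : ∀ a ∈ B, σ⁻¹ a ∈ B) {x : A} (hx : x ∈ D.MM B) :
    ∃ y ∈ D.MM B, x * D.T σ = D.T σ * y := by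
  induction hx using Submonoid.closure_induction with
  | mem x h =>
    obtain ⟨a, ha, b, hb, rfl⟩ := h
    exact ⟨_, M_mem_MM (hσ a ha) (hσ b hb), by rw [D.T_M]; simp⟩
  | one => exact ⟨1, one_mem _, by simp⟩
  | mul x y _ _ hx hy =>
    obtain ⟨x', hx', ex⟩ := hx
    obtain ⟨y', hy', ey⟩ := hy
    exact ⟨x' * y', mul_mem hx' hy', by rw [mul_assoc, ey, ← mul_assoc, ex, mul_assoc]⟩

lemma PS_M_P_left {a b : ι} {U : Finset ι} (hab : a ≠ b) (ha : a ∈ U) :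
    D.PS U * D.M a b * D.P a = D.PS U := by
  obtain ⟨V, hV, rfl⟩ : ∃ V, a ∉ V ∧ U = insert a V :=
    ⟨U.erase a, by simp, (Finset.insert_erase ha).symm⟩
  calc _ = D.PS V * (D.P a * D.M a b * D.P a) := by rw [D.PS_insert' hV]; simp only [mul_assoc]
    _ = _ := by rw [D.PMP a b hab, D.PS_insert' hV]

lemma PS_M_P_right {a b : ι} {U : Finset ι} (hab : a ≠ b) (hb : b ∈ U) :
    D.PS U * D.M a b * D.P a = D.PS U * D.T (Equiv.swap a b) := by
  obtain ⟨V, hV, rfl⟩ : ∃ V, b ∉ V ∧ U = insert b V :=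
    ⟨U.erase b, by simp, (Finset.insert_erase hb).symm⟩
  calc _ = D.PS V * (D.P b * D.M a b * D.P a) := by rw [D.PS_insert' hV]; simp only [mul_assoc]
    _ = _ := by rw [D.PMP_swap a b hab, D.PS_insert' hV, mul_assoc]

lemma PS_P {a : ι} {U : Finset ι} (ha : a ∈ U) : D.PS U * D.P a = d • D.PS U := by
  obtain ⟨V, hV, rfl⟩ : ∃ V, a ∉ V ∧ U = insert a V :=
    ⟨U.erase a, by simp, (Finset.insert_erase ha).symm⟩
  rw [D.PS_insert' hV, mul_assoc, D.P_sq, mul_smul_comm]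

lemma T_mul_P (σ : Equiv.Perm ι) {j : ι} {y : A} (hy : y ∈ D.MM (B.erase j)) :
    D.T σ * y * D.P j = D.P (σ j) * (D.T σ * y) := by
  have h := (P_MM_comm hy).eq
  have h2 := D.T_P σ j
  rw [mul_assoc, ← h, ← mul_assoc, h2, mul_assoc]

lemma T_mul_M_mul_P (σ : Equiv.Perm ι) {j b : ι} {y : A} (hy : y ∈ D.MM (B.erase j)) :
    D.T σ * (D.M j b * y) * D.P j = D.M (σ j) (σ b) * (D.P (σ j) * (D.T σ * y)) := by
  have h := T_mul_P σ hy
  have h2 := D.T_M σ j b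
  calc _ = (D.T σ * D.M j b) * (y * D.P j) := by simp only [mul_assoc]
    _ = D.M (σ j) (σ b) * (D.T σ * y * D.P j) := by rw [h2]; simp only [mul_assoc]
    _ = _ := by rw [h]

/-- Normal form: if the submodule `Q` absorbs the elements in which an extra point is isolated or
two extra points are merged, then modulo `Q` every element of `L * PS U * Alg K B` is a combination
of elements `L * PS U * T σ * x` with `x` a product of block idempotents. -/
lemma normal_form (hKB : K ⊆ B) {U : Finset ι} (hU : U ⊆ K) (L : A) (Q : Submodule S A)
    (hQ : ∀ x ∈ Q, ∀ y ∈ D.Alg K B, x * y ∈ Q)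
    (hP : ∀ a ∈ K, a ∉ U → L * D.PS U * D.P a ∈ Q)
    (hM : ∀ a ∈ K, ∀ b ∈ B, a ∉ U → b ∉ U → a ≠ b → L * D.PS U * D.M a b ∈ Q)
    {x : A} (hx : x ∈ D.Alg K B) :
    L * D.PS U * x ∈ Submodule.span S
      {x | ∃ σ ∈ fixOut K, ∃ y ∈ D.MM B, x = L * D.PS U * D.T σ * y} ⊔ Q := by
  set Y := Submodule.span S
      {x | ∃ σ ∈ fixOut K, ∃ y ∈ D.MM B, x = L * D.PS U * D.T σ * y} ⊔ Q with hY
  have hgen : ∀ σ ∈ fixOut K, ∀ y ∈ D.MM B, L * D.PS U * D.T σ * y ∈ Y := fun σ hσ y hy =>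
    Submodule.mem_sup_left (Submodule.subset_span ⟨σ, hσ, y, hy, rfl⟩)
  have hQY : ∀ x ∈ Q, x ∈ Y := fun x hx => Submodule.mem_sup_right hx
  have key : ∀ g ∈ D.Alg K B,
      (∀ σ ∈ fixOut K, ∀ y ∈ D.MM B, L * D.PS U * D.T σ * y * g ∈ Y) → ∀ v ∈ Y, v * g ∈ Y := by
    intro g hg h v hv
    obtain ⟨v1, hv1, v2, hv2, rfl⟩ := Submodule.mem_sup.1 hv
    rw [add_mul]
    refine add_mem ?_ (hQY _ (hQ _ hv2 _ hg))
    have : Submodule.span S {x | ∃ σ ∈ fixOut K, ∃ y ∈ D.MM B, x = L * D.PS U * D.T σ * y}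
        ≤ Y.comap (LinearMap.mulRight S g) := by
      refine Submodule.span_le.2 ?_
      rintro _ ⟨σ, hσ, y, hy, rfl⟩
      exact h σ hσ y hy
    exact this hv1
  have stable : ∀ g ∈ D.Alg K B, ∀ v ∈ Y, v * g ∈ Y := by
    intro g hg
    induction hg using Algebra.adjoin_induction with
    | mem g hg =>
      refine key g (Algebra.subset_adjoin hg) ?_
      intro σ hσ y hy
      rcases hg with (⟨τ, hτ, rfl⟩ | ⟨j, hj, rfl⟩) | ⟨a, ha, b, hb, rfl⟩
      · obtain ⟨y', hy', e⟩ := MM_mul_T (σ := τ)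
          (fun a ha => fixOut_apply_mem hKB ((fixOut K).inv_mem hτ) ha) hy
        rw [mul_assoc, e, ← mul_assoc, mul_assoc _ (D.T σ), ← map_mul]
        exact hgen _ ((fixOut K).mul_mem hσ hτ) _ hy'
      · have hyA : ∀ y ∈ D.MM (B.erase j), D.T σ * y ∈ D.Alg K B := fun y hy =>
          mul_mem (T_mem_Alg hσ) (MM_le_Alg _ (MM_mono (Finset.erase_subset _ _) hy))
        have hyB : ∀ y ∈ D.MM (B.erase j), y ∈ D.MM B := fun y hy =>
          MM_mono (Finset.erase_subset _ _) hy
        have hσj : σ j ∈ K := fixOut_apply_mem subset_rfl hσ hj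
        rcases MM_split j hy with hy | ⟨b, hb, hbj, y, hy', rfl⟩
        · have e : L * D.PS U * D.T σ * y * D.P j = L * D.PS U * D.P (σ j) * (D.T σ * y) := by
            simpa only [mul_assoc] using congrArg (fun w => L * D.PS U * w) (T_mul_P σ hy)
          rw [e]
          by_cases hjU : σ j ∈ U
          · rw [mul_assoc L, PS_P hjU, mul_smul_comm, smul_mul_assoc, ← mul_assoc]
            exact Y.smul_mem _ (hgen σ hσ y (hyB y hy))
          · exact hQY _ (hQ _ (hP _ hσj hjU) _ (hyA y hy))
        · have e : L * D.PS U * D.T σ * (D.M j b * y) * D.P j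
              = L * D.PS U * D.M (σ j) (σ b) * D.P (σ j) * (D.T σ * y) := by
            simpa only [mul_assoc] using congrArg (fun w => L * D.PS U * w) (T_mul_M_mul_P σ hy')
          rw [e]
          have hσb : σ b ∈ B := fixOut_apply_mem hKB hσ hb
          have hne : σ j ≠ σ b := fun h => hbj (σ.injective h).symm
          by_cases hjU : σ j ∈ U
          · rw [mul_assoc L, mul_assoc L, PS_M_P_left hne hjU, ← mul_assoc]
            exact hgen σ hσ y (hyB y hy')
          by_cases hbU : σ b ∈ U
          · rw [mul_assoc L, mul_assoc L, PS_M_P_right hne hbU, ← mul_assoc, ← mul_assoc, mul_assoc _ _ (D.T σ),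
              ← map_mul]
            exact hgen _ ((fixOut K).mul_mem (swap_mem_fixOut hσj (hU hbU)) hσ) y (hyB y hy')
          · rw [mul_assoc _ (D.P _)]
            exact hQY _ (hQ _ (hM _ hσj _ hσb hjU hbU hne) _
              (mul_mem (P_mem_Alg hσj) (hyA y hy')))
      · rw [mul_assoc]
        exact hgen σ hσ _ (mul_mem hy (M_mem_MM ha hb))
    | algebraMap r =>
      intro v hv
      rw [← Algebra.commutes, ← Algebra.smul_def]
      exact Y.smul_mem _ hv
    | add g g' _ _ hg hg' => intro v hv; rw [mul_add]; exact add_mem (hg v hv) (hg' v hv)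
    | mul g g' _ _ hg hg' => intro v hv; rw [← mul_assoc]; exact hg' _ (hg v hv)
  refine stable x hx _ ?_
  simpa using hgen 1 (one_mem _) 1 (one_mem _)

end PData

/-- The points `n, n + 1, …, k - 1`. -/
def Seg (N n k : ℕ) : Finset (Fin N) := Finset.univ.filter fun a => n ≤ a.val ∧ a.val < k

@[simp] lemma mem_Seg {N n k : ℕ} {a : Fin N} : a ∈ Seg N n k ↔ n ≤ a.val ∧ a.val < k := by
  simp [Seg]

/-- The natural number `k`, as a point. -/
def pt (N k : ℕ) [NeZero N] : Fin N := Fin.ofNat N k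

lemma pt_val {N k : ℕ} [NeZero N] (h : k < N) : (pt N k).val = k := Nat.mod_eq_of_lt h

lemma Seg_succ_right {N n k : ℕ} [NeZero N] (hk : k < N) (h : n ≤ k) :
    Seg N n (k + 1) = insert (pt N k) (Seg N n k) := by
  ext a
  simp only [mem_Seg, Finset.mem_insert, Fin.ext_iff, pt_val hk]
  omega

lemma Seg_succ_left {N n k : ℕ} [NeZero N] (hk : k ≤ N) (h : n < k) :
    Seg N n k = insert (pt N n) (Seg N (n + 1) k) := by
  ext a
  simp only [mem_Seg, Finset.mem_insert, Fin.ext_iff, pt_val (lt_of_lt_of_le h hk)]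
  omega

namespace PData

variable {S : Type} [CommRing S] {d : S} {A : Type} [Ring A] [Algebra S A]
  {N : ℕ} [NeZero N] (D : PData S d A (Fin N))

variable (N) in
/-- The permutations of the first `n` points. -/
abbrev HN (n : ℕ) : Subgroup (Equiv.Perm (Fin N)) := fixOut (Seg N 0 n)

/-- The algebra at level `i` of the tower. -/
def W (i : ℕ) : Subalgebra S A := D.Alg (Seg N 0 (i / 2)) (Seg N 0 ((i + 1) / 2))

/-- The product of contractions at level `i` leaving `n` points free. -/
def e (i n : ℕ) : A :=
  if i % 2 = 0 then D.PS (Seg N n (i / 2)) else D.Dst (pt N (i / 2)) (Seg N n (i / 2))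

/-- The left factor of `lead`: trivial at even levels. -/
def leadL (i n : ℕ) : A := if i % 2 = 0 then 1 else D.Dst (pt N (i / 2)) (Seg N n (i / 2))

/-- The leading element at level `i`. -/
def lead (i n : ℕ) : A := D.leadL i n * D.PS (Seg N n (i / 2))

/-- Elements having fewer than `n` free points. -/
def GN (i n : ℕ) : Set A :=
  {g | ∃ a : Fin N, a.val < n ∧ g = D.lead i n * D.P a} ∪
  {g | ∃ a b : Fin N, a.val < n ∧ b.val < (i + 1) / 2 ∧ (b.val < n ∨ i / 2 ≤ b.val) ∧ a ≠ b ∧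
    g = D.lead i n * D.M a b}

/-- The right submodule generated by `GN`. -/
def NN (i n : ℕ) : Submodule S A := Submodule.span S {x | ∃ g ∈ D.GN i n, ∃ w ∈ D.W i, x = g * w}

lemma e_even (k n : ℕ) : D.e (2 * k) n = D.PS (Seg N n k) := by
  simp [e]

lemma e_odd (k n : ℕ) : D.e (2 * k + 1) n = D.Dst (pt N k) (Seg N n k) := by
  have h : (2 * k + 1) / 2 = k := by omega
  simp [e, h]

lemma lead_even (k n : ℕ) : D.lead (2 * k) n = D.PS (Seg N n k) := by
  simp [lead, leadL]

lemma lead_odd (k n : ℕ) :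
    D.lead (2 * k + 1) n = D.Dst (pt N k) (Seg N n k) * D.PS (Seg N n k) := by
  have h : (2 * k + 1) / 2 = k := by omega
  simp [lead, leadL, h]

omit [NeZero N] in
lemma W_even (k : ℕ) : D.W (2 * k) = D.Alg (Seg N 0 k) (Seg N 0 k) := by
  have h : (2 * k + 1) / 2 = k := by omega
  simp [W, h]

omit [NeZero N] in
lemma W_odd (k : ℕ) : D.W (2 * k + 1) = D.Alg (Seg N 0 k) (Seg N 0 (k + 1)) := by
  have h : (2 * k + 1) / 2 = k := by omega
  have h' : (2 * k + 1 + 1) / 2 = k + 1 := by omega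
  simp [W, h, h']

omit [NeZero N] in
lemma Seg_mono {n n' k k' : ℕ} (h : n' ≤ n) (h' : k ≤ k') : Seg N n k ⊆ Seg N n' k' := by
  intro a
  simp only [mem_Seg]
  omega

omit [NeZero N] in
lemma HN_mono {n k : ℕ} (h : n ≤ k) : HN N n ≤ HN N k := fixOut_mono (Seg_mono le_rfl h)

omit [NeZero N] in
lemma mem_HN {n : ℕ} {σ : Equiv.Perm (Fin N)} : σ ∈ HN N n ↔ ∀ a : Fin N, n ≤ a.val → σ a = a := by
  simp [HN, mem_fixOut]

omit [NeZero N] in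
lemma HN_lt {n : ℕ} {σ : Equiv.Perm (Fin N)} (hσ : σ ∈ HN N n) {a : Fin N} (ha : a.val < n) :
    (σ a).val < n := by
  have := fixOut_apply_mem subset_rfl hσ (a := a) (by simpa using ha)
  simpa using this

omit [NeZero N] in
lemma swap_mem_HN {n : ℕ} {a b : Fin N} (ha : a.val < n) (hb : b.val < n) :
    Equiv.swap a b ∈ HN N n := swap_mem_fixOut (by simpa using ha) (by simpa using hb)

omit [NeZero N] in
lemma W_mono {i j : ℕ} (h : i ≤ j) : D.W i ≤ D.W j :=
  Alg_mono (Seg_mono le_rfl (by omega)) (Seg_mono le_rfl (by omega))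

omit [NeZero N] in
lemma T_mem_W {i n : ℕ} (h : n ≤ i / 2) {σ : Equiv.Perm (Fin N)} (hσ : σ ∈ HN N n) :
    D.T σ ∈ D.W i := T_mem_Alg (HN_mono h hσ)

omit [NeZero N] in
lemma commute_T_PS {n k : ℕ} {σ : Equiv.Perm (Fin N)} (hσ : σ ∈ HN N n) :
    Commute (D.T σ) (D.PS (Seg N n k)) := by
  refine D.commute_PS fun a ha => ?_
  have := D.T_P σ a
  rwa [mem_HN.1 hσ a (mem_Seg.1 ha).1] at this

omit [NeZero N] in
lemma commute_T_Dst {n k : ℕ} {z : Fin N} {σ : Equiv.Perm (Fin N)} (hσ : σ ∈ HN N n)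
    (hz : n ≤ z.val) : Commute (D.T σ) (D.Dst z (Seg N n k)) := by
  refine D.commute_Dst fun a ha => ?_
  have := D.T_M σ a z
  rwa [mem_HN.1 hσ a (mem_Seg.1 ha).1, mem_HN.1 hσ z hz] at this

/-- Level `i` has `i / 2` points, and its special point (if any) exists. -/
lemma pt_half_val {i : ℕ} (hi : (i + 1) / 2 ≤ N) (ho : i % 2 = 1) : (pt N (i / 2)).val = i / 2 :=
  pt_val (by omega)

lemma commute_T_e {i n : ℕ} (hi : (i + 1) / 2 ≤ N) (hn : n ≤ i / 2) {σ : Equiv.Perm (Fin N)}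
    (hσ : σ ∈ HN N n) : Commute (D.T σ) (D.e i n) := by
  unfold e
  split_ifs with h
  · exact D.commute_T_PS hσ
  · exact D.commute_T_Dst hσ (by rw [pt_half_val hi (by omega)]; exact hn)

lemma commute_T_lead {i n : ℕ} (hi : (i + 1) / 2 ≤ N) (hn : n ≤ i / 2) {σ : Equiv.Perm (Fin N)}
    (hσ : σ ∈ HN N n) : Commute (D.T σ) (D.lead i n) := by
  refine Commute.mul_right ?_ (D.commute_T_PS hσ)
  unfold leadL
  split_ifs with h
  · exact Commute.one_right _
  · exact D.commute_T_Dst hσ (by rw [pt_half_val hi (by omega)]; exact hn)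

lemma e_mem_W {i n : ℕ} (hi : (i + 1) / 2 ≤ N) : D.e i n ∈ D.W i := by
  unfold e
  split_ifs with h
  · exact PS_mem_Alg (Seg_mono (Nat.zero_le _) le_rfl)
  · refine Dst_mem_Alg (Seg_mono (Nat.zero_le _) (by omega)) ?_
    rw [mem_Seg, pt_half_val hi (by omega)]
    omega

lemma NN_mul {i n : ℕ} {x y : A} (hx : x ∈ D.NN i n) (hy : y ∈ D.W i) : x * y ∈ D.NN i n := by
  have : D.NN i n ≤ (D.NN i n).comap (LinearMap.mulRight S y) := by
    refine Submodule.span_le.2 ?_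
    rintro _ ⟨g, hg, w, hw, rfl⟩
    exact Submodule.subset_span ⟨g, hg, w * y, mul_mem hw hy, by simp [mul_assoc]⟩
  exact this hx

lemma P_mem_NN {i n : ℕ} {a : Fin N} (ha : a.val < n) : D.lead i n * D.P a ∈ D.NN i n :=
  Submodule.subset_span ⟨_, Or.inl ⟨a, ha, rfl⟩, 1, one_mem _, by simp⟩

lemma M_mem_NN {i n : ℕ} {a b : Fin N} (ha : a.val < n) (hb : b.val < (i + 1) / 2)
    (hb' : b.val < n ∨ i / 2 ≤ b.val) (hab : a ≠ b) : D.lead i n * D.M a b ∈ D.NN i n :=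
  Submodule.subset_span ⟨_, Or.inr ⟨a, b, ha, hb, hb', hab, rfl⟩, 1, one_mem _, by simp⟩

lemma T_mul_NN {i n : ℕ} (hi : (i + 1) / 2 ≤ N) (hn : n ≤ i / 2) {σ : Equiv.Perm (Fin N)}
    (hσ : σ ∈ HN N n) {x : A} (hx : x ∈ D.NN i n) : D.T σ * x ∈ D.NN i n := by
  have : D.NN i n ≤ (D.NN i n).comap (LinearMap.mulLeft S (D.T σ)) := by
    refine Submodule.span_le.2 ?_
    have hc := (D.commute_T_lead hi hn hσ).eq
    rintro _ ⟨g, (⟨a, ha, rfl⟩ | ⟨a, b, ha, hb, hb', hab, rfl⟩), w, hw, rfl⟩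
    · have e1 : D.T σ * (D.lead i n * D.P a * w) = D.lead i n * D.P (σ a) * (D.T σ * w) := by
        rw [← mul_assoc, ← mul_assoc, hc, mul_assoc _ (D.T σ), D.T_P]
        simp only [mul_assoc]
      show D.T σ * (D.lead i n * D.P a * w) ∈ D.NN i n
      rw [e1]
      exact D.NN_mul (D.P_mem_NN (HN_lt hσ ha)) (mul_mem (D.T_mem_W hn hσ) hw)
    · have e1 : D.T σ * (D.lead i n * D.M a b * w)
          = D.lead i n * D.M (σ a) (σ b) * (D.T σ * w) := by
        rw [← mul_assoc, ← mul_assoc, hc, mul_assoc _ (D.T σ), D.T_M]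
        simp only [mul_assoc]
      show D.T σ * (D.lead i n * D.M a b * w) ∈ D.NN i n
      rw [e1]
      refine D.NN_mul (D.M_mem_NN (HN_lt hσ ha) ?_ ?_ (fun h => hab (σ.injective h)))
        (mul_mem (D.T_mem_W hn hσ) hw)
      · rcases hb' with h | h
        · have := HN_lt hσ h; omega
        · rw [mem_HN.1 hσ b (hn.trans h)]; exact hb
      · rcases hb' with h | h
        · exact Or.inl (HN_lt hσ h)
        · rw [mem_HN.1 hσ b (hn.trans h)]; exact Or.inr h
  exact this hx

/-- Restriction of the leading right ideal from level `2 k + 2` to level `2 k + 1`. -/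
lemma even_step {k n : ℕ} (hk : k < N) (hn : n ≤ k + 1) (Y : Submodule S A)
    (h1 : n ≤ k → ∀ w ∈ D.W (2 * k + 1), D.e (2 * (k + 1)) n * D.e (2 * k + 1) n * w ∈ Y)
    (h2 : 1 ≤ n → ∀ σ ∈ HN N n, ∀ w ∈ D.W (2 * k + 1),
      D.T σ * (D.e (2 * (k + 1)) n * D.e (2 * k + 1) (n - 1) * w) ∈ Y)
    (h3 : D.NN (2 * (k + 1)) n ≤ Y) {x : A} (hx : x ∈ D.W (2 * (k + 1))) :
    D.e (2 * (k + 1)) n * x ∈ Y := by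
  have hz : (pt N k).val = k := pt_val hk
  have nf := normal_form (D := D) (K := Seg N 0 (k + 1)) (B := Seg N 0 (k + 1)) subset_rfl
    (U := Seg N n (k + 1)) (Seg_mono (Nat.zero_le _) le_rfl) 1 (D.NN (2 * (k + 1)) n)
    (fun x hx y hy => D.NN_mul hx (by rw [W_even]; exact hy))
    (fun a ha ha' => by
      simp only [mem_Seg] at ha ha'
      rw [one_mul, ← lead_even]; exact D.P_mem_NN (by omega))
    (fun a ha b hb ha' hb' hab => by
      simp only [mem_Seg] at ha ha' hb hb'
      rw [one_mul, ← lead_even]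
      exact D.M_mem_NN (by omega) (by omega) (by omega) hab)
    (by rw [W_even] at hx; exact hx)
  rw [one_mul] at nf
  rw [e_even]
  obtain ⟨v, hv, q, hq, e⟩ := Submodule.mem_sup.1 nf
  rw [← e]
  refine add_mem ?_ (h3 hq)
  refine (Submodule.span_le (p := Y)).2 ?_ hv
  rintro _ ⟨σ, hσ, y, hy, rfl⟩
  have hyW : y ∈ D.W (2 * k + 1) := by
    rw [W_odd]; exact MM_le_Alg _ hy
  have hTW : ∀ ρ : Equiv.Perm (Fin N), ρ ∈ HN N k → D.T ρ ∈ D.W (2 * k + 1) := fun ρ hρ => by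
    rw [W_odd]; exact T_mem_Alg hρ
  have hρk : ∀ ρ : Equiv.Perm (Fin N), ρ ∈ HN N (k + 1) → ρ (pt N k) = pt N k → ρ ∈ HN N k := by
    intro ρ hρ h
    rw [mem_HN] at hρ ⊢
    intro a ha
    rcases eq_or_lt_of_le ha with h' | h'
    · rwa [show a = pt N k from Fin.ext (by rw [hz, h'])]
    · exact hρ a h'
  have hUz : pt N k ∉ Seg N n k := by simp [hz]
  set a := σ (pt N k) with ha
  have hak : a.val < k + 1 := HN_lt hσ (by rw [hz]; omega)
  by_cases hnk : n ≤ k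
  · have hseg := Seg_succ_right hk hnk
    by_cases han : n ≤ a.val
    · have hρ := hρk (Equiv.swap a (pt N k) * σ)
        ((HN N (k + 1)).mul_mem (swap_mem_HN hak (by rw [hz]; omega)) hσ) (by simp [← ha])
      have h4 := h1 hnk (D.PS (Seg N n k) * (D.T (Equiv.swap a (pt N k) * σ) * y))
        (mul_mem (by rw [W_odd]; exact PS_mem_Alg (Seg_mono (Nat.zero_le _) le_rfl))
          (mul_mem (hTW _ hρ) hyW))
      rw [e_even, e_odd, ← mul_assoc, hseg, PS_Dst_PS_insert _ hUz, ← hseg, map_mul, ← mul_assoc,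
        ← mul_assoc, D.PS_T_swap (by simp [han, hak]) (by simp [hz, hnk])] at h4
      exact h4
    · push Not at han
      obtain ⟨p, rfl⟩ : ∃ p, n = p + 1 := ⟨n - 1, by omega⟩
      have hyv : (pt N p).val = p := pt_val (by omega)
      set b := pt N p with hb
      have hbz : b ≠ pt N k := fun h => by
        have := congrArg Fin.val h
        omega
      have haz : a ≠ pt N k := fun h => by
        have := congrArg Fin.val h
        omega
      have hsw : Equiv.swap a b ∈ HN N (p + 1) := swap_mem_HN han (by omega)
      have hρ := hρk (Equiv.swap b (pt N k) * Equiv.swap a b * σ)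
        ((HN N (k + 1)).mul_mem ((HN N (k + 1)).mul_mem (swap_mem_HN (by omega) (by omega))
          (HN_mono (by omega) hsw)) hσ) (by simp [← ha])
      have hUb : b ∉ Seg N (p + 1) k := by simp [hyv]
      have h4 := h2 (by omega) _ hsw (D.PS (Seg N p k) *
          (D.T (Equiv.swap b (pt N k) * Equiv.swap a b * σ) * y))
        (mul_mem (by rw [W_odd]; exact PS_mem_Alg (Seg_mono (Nat.zero_le _) le_rfl))
          (mul_mem (hTW _ hρ) hyW))
      have hseg2 : Seg N p k = insert b (Seg N (p + 1) k) := Seg_succ_left hk.le (by omega)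
      rw [e_even, e_odd, ← mul_assoc (_ * _) (D.PS _), Nat.add_sub_cancel, hseg, hseg2,
        PS_Dst_PS_swap _ hUz hUb hbz, ← hseg, map_mul, map_mul] at h4
      have e5 : D.T (Equiv.swap b (pt N k)) * (D.T (Equiv.swap b (pt N k)) *
          D.T (Equiv.swap a b) * D.T σ * y) = D.T (Equiv.swap a b) * D.T σ * y := by
        rw [← mul_assoc, ← mul_assoc, ← mul_assoc, ← map_mul, Equiv.swap_mul_self, map_one, one_mul]
      rw [mul_assoc (D.PS _) (D.T _), e5, ← mul_assoc, (D.commute_T_PS hsw).eq,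
        mul_assoc (D.PS _), ← mul_assoc (D.T _), ← mul_assoc (D.T _), ← map_mul,
        Equiv.swap_mul_self, map_one, one_mul, ← mul_assoc] at h4
      exact h4
  · obtain rfl : n = k + 1 := by omega
    have hE : Seg N (k + 1) (k + 1) = ∅ := by
      ext x; simp
    have hE' : Seg N k k = ∅ := by
      ext x; simp
    have h4 := h2 (by omega) σ hσ y hyW
    rw [e_even, e_odd, Nat.add_sub_cancel, hE, hE', PS_empty, Dst_empty, one_mul, one_mul] at h4
    rwa [hE, PS_empty, one_mul]

/-- Restriction of the leading right ideal from level `2 k + 1` to level `2 k`. -/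
lemma odd_step {k n : ℕ} (hk : k < N) (hn : n ≤ k) (Y : Submodule S A)
    (h1 : ∀ w ∈ D.W (2 * k), D.e (2 * k + 1) n * D.e (2 * k) n * w ∈ Y)
    (h2 : n < k → ∀ w ∈ D.W (2 * k), D.e (2 * k + 1) n * D.e (2 * k) (n + 1) * w ∈ Y)
    (h3 : D.NN (2 * k + 1) n ≤ Y) {x : A} (hx : x ∈ D.W (2 * k + 1)) :
    D.e (2 * k + 1) n * x ∈ Y := by
  have hz : (pt N k).val = k := pt_val hk
  have hUz : pt N k ∉ Seg N n k := by simp [hz]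
  have hk2 : (2 * k + 1 + 1) / 2 = k + 1 := by omega
  have hk1 : (2 * k + 1) / 2 = k := by omega
  have hE : D.e (2 * k + 1) n = D.lead (2 * k + 1) n * D.e (2 * k + 1) n := by
    rw [lead_odd, e_odd, D.Dst_PS_Dst hUz]
  have nf := normal_form (D := D) (K := Seg N 0 k) (B := Seg N 0 (k + 1))
    (Seg_mono le_rfl (by omega))
    (U := Seg N n k) (Seg_mono (Nat.zero_le _) le_rfl) (D.e (2 * k + 1) n) (D.NN (2 * k + 1) n)
    (fun x hx y hy => D.NN_mul hx (by rw [W_odd]; exact hy))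
    (fun a ha ha' => by
      simp only [mem_Seg] at ha ha'
      rw [e_odd, ← lead_odd]; exact D.P_mem_NN (by omega))
    (fun a ha b hb ha' hb' hab => by
      simp only [mem_Seg] at ha ha' hb hb'
      rw [e_odd, ← lead_odd]
      exact D.M_mem_NN (by omega) (by omega) (by omega) hab)
    (x := D.e (2 * k + 1) n * x) (by rw [← W_odd]; exact mul_mem (D.e_mem_W (by omega)) hx)
  rw [e_odd, ← lead_odd, ← e_odd, ← mul_assoc, ← hE] at nf
  obtain ⟨v, hv, q, hq, e⟩ := Submodule.mem_sup.1 nf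
  rw [← e]
  refine add_mem ?_ (h3 hq)
  refine (Submodule.span_le (p := Y)).2 ?_ hv
  rintro _ ⟨σ, hσ, y, hy, rfl⟩
  have hTW : D.T σ ∈ D.W (2 * k) := by
    rw [W_even]; exact T_mem_Alg hσ
  have hB : (Seg N 0 (k + 1)).erase (pt N k) = Seg N 0 k := by
    ext a
    simp only [Finset.mem_erase, mem_Seg, ne_eq, Fin.ext_iff, hz]
    omega
  rcases MM_split (pt N k) hy with hy' | ⟨b, hb, hbz, u, hu, rfl⟩
  · rw [hB] at hy'
    rw [lead_odd, ← e_odd, ← e_even, mul_assoc]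
    exact h1 _ (mul_mem hTW (by rw [W_even]; exact MM_le_Alg _ hy'))
  · rw [hB] at hu
    have huW : D.T σ * u ∈ D.W (2 * k) := mul_mem hTW (by rw [W_even]; exact MM_le_Alg _ hu)
    have hσz : σ (pt N k) = pt N k := mem_HN.1 hσ _ hz.ge
    have hbk : b.val < k := by
      have h5 : b.val ≠ k := fun h => hbz (Fin.ext (h.trans hz.symm))
      have := (mem_Seg.1 hb).2
      omega
    have hσb : (σ b).val < k := HN_lt hσ hbk
    have e4 : D.lead (2 * k + 1) n * D.T σ * (D.M (pt N k) b * u)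
        = D.lead (2 * k + 1) n * D.M (σ b) (pt N k) * (D.T σ * u) := by
      rw [mul_assoc, ← mul_assoc (D.T σ), D.T_M, hσz, D.M_symm]
      simp only [mul_assoc]
    rw [e4]
    have hcz : σ b ≠ pt N k := fun h => by
      have := congrArg Fin.val h
      omega
    by_cases hc : (σ b).val < n
    · refine h3 (D.NN_mul (D.M_mem_NN hc (by omega) (Or.inr (by omega)) hcz) ?_)
      exact D.W_mono (by omega) huW
    · push Not at hc
      have hnk : n < k := by omega
      have hpn : (pt N n).val = n := pt_val (by omega)
      set c := σ b with hcdef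
      have e6 : (Seg N n k).erase c = (Seg N (n + 1) k).map
          (Equiv.swap c (pt N n)).toEmbedding := by
        ext x
        rw [Finset.mem_map_equiv, Equiv.symm_swap, Finset.mem_erase]
        rcases eq_or_ne x c with rfl | h1
        · simp [hpn]
        rcases eq_or_ne x (pt N n) with rfl | h2
        · have h3' : c.val ≠ n := fun h => h1 (Fin.ext (by rw [hpn, h]))
          simp only [Equiv.swap_apply_right, mem_Seg, hpn, h1, ne_eq, not_false_eq_true, true_and]
          omega
        · rw [Equiv.swap_apply_of_ne_of_ne h1 h2]
          have h3' : x.val ≠ n := fun h => h2 (Fin.ext (by rw [hpn, h]))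
          simp only [mem_Seg, h1, ne_eq, not_false_eq_true, true_and]
          omega
      have hins : Seg N n k = insert c ((Seg N n k).erase c) :=
        (Finset.insert_erase (by simp [hc, hσb])).symm
      have e7 : D.lead (2 * k + 1) n * D.M c (pt N k)
          = D.e (2 * k + 1) n * D.e (2 * k) (n + 1) * D.T (Equiv.swap c (pt N n)) := by
        have h8 := D.Dst_PS_M (c := c) (z := pt N k) (U := (Seg N n k).erase c)
          (fun h => hUz (Finset.mem_of_mem_erase h)) (by simp) hcz
        rw [← hins] at h8
        have h9 := D.T_PS (Equiv.swap c (pt N n)) (Seg N (n + 1) k)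
        rw [← e6] at h9
        have h10 : D.PS ((Seg N n k).erase c) = D.T (Equiv.swap c (pt N n)) *
            (D.PS (Seg N (n + 1) k) * D.T (Equiv.swap c (pt N n))) := by
          rw [← mul_assoc, h9, mul_assoc, ← map_mul, Equiv.swap_mul_self, map_one, mul_one]
        rw [lead_odd, h8, h10, ← mul_assoc, D.Dst_T_swap (by simp [hc, hσb]) (by simp [hpn, hnk]),
          e_odd, e_even, mul_assoc]
      rw [e7, mul_assoc _ (D.T _)]
      refine h2 hnk _ (mul_mem ?_ huW)
      exact D.T_mem_W (n := k) (by omega) (swap_mem_HN hσb (by omega))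

end PData

namespace PData

variable {S : Type} [CommRing S] {d : S} {A : Type} [Ring A] [Algebra S A]
  {N : ℕ} [NeZero N] (D : PData S d A (Fin N))

lemma NN_induction {i n : ℕ} {Y : Submodule S A}
    (hP : ∀ a : Fin N, a.val < n → ∀ w ∈ D.W i, D.lead i n * D.P a * w ∈ Y)
    (hM : ∀ a b : Fin N, a.val < n → b.val < (i + 1) / 2 → (b.val < n ∨ i / 2 ≤ b.val) → a ≠ b →
      ∀ w ∈ D.W i, D.lead i n * D.M a b * w ∈ Y) {q : A} (hq : q ∈ D.NN i n) : q ∈ Y := by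
  refine (Submodule.span_le (p := Y)).2 ?_ hq
  rintro _ ⟨g, (⟨a, ha, rfl⟩ | ⟨a, b, ha, hb, hb', hab, rfl⟩), w, hw, rfl⟩
  exacts [hP a ha w hw, hM a b ha hb hb' hab w hw]

lemma e_even_mul_lead_pred {k n : ℕ} (hk : k < N) (hn : n + 1 ≤ k + 1) :
    D.e (2 * (k + 1)) (n + 1) * D.lead (2 * k + 1) n
      = D.lead (2 * (k + 1)) (n + 1) * D.T (Equiv.swap (pt N n) (pt N k)) := by
  have hz : (pt N k).val = k := pt_val hk
  have hy : (pt N n).val = n := pt_val (by omega)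
  rw [e_even, lead_even, lead_odd]
  rcases eq_or_lt_of_le hn with h | h
  · obtain rfl : n = k := by omega
    have hE : Seg N n n = ∅ := by ext x; simp
    rw [hE, PS_empty, Dst_empty, Equiv.swap_self, one_mul]
    exact congrArg _ (map_one D.T).symm
  · have hyz : pt N n ≠ pt N k := fun h' => by
      have := congrArg Fin.val h'
      omega
    rw [Seg_succ_right hk (by omega), Seg_succ_left (n := n) hk.le (by omega), ← mul_assoc,
      D.PS_Dst_PS_swap (by simp [hz]) (by simp [hy]) hyz]

lemma e_even_mul_lead {k n : ℕ} (hk : k < N) (hn : n ≤ k) :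
    D.e (2 * (k + 1)) n * D.lead (2 * k + 1) n = D.lead (2 * (k + 1)) n := by
  have hz : (pt N k).val = k := pt_val hk
  rw [e_even, lead_even, lead_odd, Seg_succ_right hk hn, ← mul_assoc,
    D.PS_Dst_PS_insert (by simp [hz])]

lemma e_even_mul_NN_pred {k n : ℕ} (hk : k < N) (hn : n ≤ k) {q : A}
    (hq : q ∈ D.NN (2 * k + 1) n) :
    D.e (2 * (k + 1)) (n + 1) * q ∈ D.NN (2 * (k + 1)) (n + 1) := by
  have hz : (pt N k).val = k := pt_val hk
  have hy : (pt N n).val = n := pt_val (by omega)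
  have hT : D.T (Equiv.swap (pt N n) (pt N k)) ∈ D.W (2 * (k + 1)) :=
    D.T_mem_W (n := k + 1) (by omega) (swap_mem_HN (by omega) (by omega))
  have hW := D.W_mono (show 2 * k + 1 ≤ 2 * (k + 1) by omega)
  have hne : ∀ {a : Fin N}, a.val < n → Equiv.swap (pt N n) (pt N k) a = a := fun ha =>
    Equiv.swap_apply_of_ne_of_ne (fun h => by rw [h] at ha; omega) (fun h => by rw [h] at ha; omega)
  refine D.NN_induction (Y := (D.NN (2 * (k + 1)) (n + 1)).comap (LinearMap.mulLeft S _)) ?_ ?_ hq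
  · intro a ha w hw
    rw [Submodule.mem_comap, LinearMap.mulLeft_apply, ← mul_assoc, ← mul_assoc,
      D.e_even_mul_lead_pred hk (by omega), mul_assoc _ _ (D.P a), D.T_P, hne ha, ← mul_assoc,
      mul_assoc]
    exact D.NN_mul (D.P_mem_NN (by omega)) (mul_mem hT (hW hw))
  · intro a b ha hb hb' hab w hw
    rw [Submodule.mem_comap, LinearMap.mulLeft_apply, ← mul_assoc, ← mul_assoc,
      D.e_even_mul_lead_pred hk (by omega), mul_assoc _ _ (D.M a b), D.T_M, hne ha, ← mul_assoc,
      mul_assoc]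
    have hb2 : (Equiv.swap (pt N n) (pt N k) b).val < n + 1 := by
      rcases hb' with h | h
      · rw [hne h]; omega
      · obtain rfl : b = pt N k := Fin.ext (by omega)
        rw [Equiv.swap_apply_right]; omega
    refine D.NN_mul (D.M_mem_NN (by omega) (by omega) (Or.inl hb2) fun h => hab ?_)
      (mul_mem hT (hW hw))
    rw [← hne ha] at h
    exact (Equiv.swap _ _).injective h

lemma e_even_mul_NN {k n : ℕ} (hk : k < N) (hn : n ≤ k) (Y : Submodule S A)
    (h2 : 1 ≤ n → ∀ σ ∈ HN N n, ∀ w ∈ D.W (2 * k + 1),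
      D.T σ * (D.e (2 * (k + 1)) n * D.e (2 * k + 1) (n - 1) * w) ∈ Y)
    (h3 : D.NN (2 * (k + 1)) n ≤ Y) {q : A} (hq : q ∈ D.NN (2 * k + 1) n) :
    D.e (2 * (k + 1)) n * q ∈ Y := by
  have hz : (pt N k).val = k := pt_val hk
  have hW := D.W_mono (show 2 * k + 1 ≤ 2 * (k + 1) by omega)
  refine D.NN_induction (Y := Y.comap (LinearMap.mulLeft S _)) ?_ ?_ hq
  · intro a ha w hw
    rw [Submodule.mem_comap, LinearMap.mulLeft_apply, ← mul_assoc, ← mul_assoc,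
      D.e_even_mul_lead hk hn]
    exact h3 (D.NN_mul (D.P_mem_NN ha) (hW hw))
  · intro a b ha hb hb' hab w hw
    rw [Submodule.mem_comap, LinearMap.mulLeft_apply, ← mul_assoc, ← mul_assoc,
      D.e_even_mul_lead hk hn]
    rcases hb' with h | h
    · exact h3 (D.NN_mul (D.M_mem_NN ha (by omega) (Or.inl h) hab) (hW hw))
    obtain rfl : b = pt N k := Fin.ext (by omega)
    obtain ⟨p, rfl⟩ : ∃ p, n = p + 1 := ⟨n - 1, by omega⟩
    have hy : (pt N p).val = p := pt_val (by omega)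
    have hσ : Equiv.swap a (pt N p) ∈ HN N (p + 1) := swap_mem_HN ha (by omega)
    have hσz : Equiv.swap a (pt N p) (pt N k) = pt N k := mem_HN.1 hσ _ (by omega)
    have h4 := h2 (by omega) _ hσ (D.PS (Seg N (p + 1) k) * (D.T (Equiv.swap a (pt N p)) * w))
      (mul_mem (by rw [W_odd]; exact PS_mem_Alg (Seg_mono (Nat.zero_le _) le_rfl))
        (mul_mem (D.T_mem_W (n := p + 1) (by omega) hσ) hw))
    have hU : pt N k ∉ Seg N (p + 1) k := by simp [hz]
    rw [Nat.add_sub_cancel, ← mul_assoc (_ * _) (D.PS _), e_even, e_odd,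
      Seg_succ_right hk hn, Seg_succ_left (n := p) hk.le (by omega),
      D.PS_Dst_insert hU (by simp [hy]), ← Seg_succ_right hk hn, ← mul_assoc, ← mul_assoc,
      ← mul_assoc, (D.commute_T_PS hσ).eq, mul_assoc (D.PS _) (D.T _), D.T_M,
      Equiv.swap_apply_right, hσz, ← mul_assoc, mul_assoc _ (D.T _) (D.T _), ← map_mul,
      Equiv.swap_mul_self, map_one, mul_one] at h4
    rw [lead_even]
    exact h4

lemma e_odd_mul_NN {k n : ℕ} {q : A} (hq : q ∈ D.NN (2 * k) n) :
    D.e (2 * k + 1) n * q ∈ D.NN (2 * k + 1) n := by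
  have hW := D.W_mono (show 2 * k ≤ 2 * k + 1 by omega)
  have hl : D.e (2 * k + 1) n * D.lead (2 * k) n = D.lead (2 * k + 1) n := by
    rw [lead_odd, e_odd, lead_even]
  refine D.NN_induction (Y := (D.NN (2 * k + 1) n).comap (LinearMap.mulLeft S _)) ?_ ?_ hq
  · intro a ha w hw
    rw [Submodule.mem_comap, LinearMap.mulLeft_apply, ← mul_assoc, ← mul_assoc, hl]
    exact D.NN_mul (D.P_mem_NN ha) (hW hw)
  · intro a b ha hb hb' hab w hw
    rw [Submodule.mem_comap, LinearMap.mulLeft_apply, ← mul_assoc, ← mul_assoc, hl]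
    exact D.NN_mul (D.M_mem_NN ha (by omega) (by omega) hab) (hW hw)

lemma e_odd_mul_NN_succ {k n : ℕ} (hk : k < N) (hn : n < k) (Y : Submodule S A)
    (h1 : ∀ w ∈ D.W (2 * k), D.e (2 * k + 1) n * D.e (2 * k) n * w ∈ Y)
    (h3 : D.NN (2 * k + 1) n ≤ Y) {q : A} (hq : q ∈ D.NN (2 * k) (n + 1)) :
    D.e (2 * k + 1) n * q ∈ Y := by
  have hz : (pt N k).val = k := pt_val hk
  have hy : (pt N n).val = n := pt_val (by omega)
  have hyz : pt N n ≠ pt N k := fun h => by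
    have := congrArg Fin.val h
    omega
  have hW := D.W_mono (show 2 * k ≤ 2 * k + 1 by omega)
  have hseg : Seg N n k = insert (pt N n) (Seg N (n + 1) k) := Seg_succ_left hk.le hn
  have hyU : pt N n ∉ Seg N (n + 1) k := by simp [hy]
  have hl : D.e (2 * k + 1) n * D.lead (2 * k) (n + 1)
      = D.lead (2 * k + 1) n * D.M (pt N n) (pt N k) := by
    rw [lead_odd, e_odd, lead_even, hseg, D.Dst_PS_M (by simp [hz]) hyU hyz]
  have hMW : D.M (pt N n) (pt N k) ∈ D.W (2 * k + 1) := by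
    rw [W_odd]
    exact M_mem_Alg (by rw [mem_Seg]; omega) (by rw [mem_Seg]; omega)
  have hMn : ∀ a : Fin N, a.val < n → ∀ w ∈ D.W (2 * k),
      D.lead (2 * k + 1) n * D.M (pt N n) (pt N k) * D.M a (pt N n) * w ∈ Y := fun a ha w hw => by
    rw [mul_assoc _ (D.M _ _) (D.M _ _), D.M_symm _ (pt N k), D.M_symm a, D.M_trans,
      (D.M_comm _ _ _ _).eq, D.M_symm _ a, ← mul_assoc, mul_assoc _ (D.M _ _) w,
      D.M_symm (pt N k) (pt N n)]
    refine h3 (D.NN_mul (D.M_mem_NN ha (by omega) (Or.inr (by omega)) fun h => ?_)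
      (mul_mem hMW (hW hw)))
    have := congrArg Fin.val h
    omega
  refine D.NN_induction (Y := Y.comap (LinearMap.mulLeft S _)) ?_ ?_ hq
  · intro a ha w hw
    rw [Submodule.mem_comap, LinearMap.mulLeft_apply, ← mul_assoc, ← mul_assoc]
    rcases Nat.lt_succ_iff_lt_or_eq.1 ha with h | h
    · rw [hl, mul_assoc _ _ (D.P a), ← (D.P_M_comm a _ _ (fun h' => by rw [h'] at h; omega)
        (fun h' => by rw [h'] at h; omega)).eq, ← mul_assoc, mul_assoc]
      exact h3 (D.NN_mul (D.P_mem_NN h) (mul_mem hMW (hW hw)))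
    · obtain rfl : a = pt N n := Fin.ext (by omega)
      rw [lead_even, mul_assoc _ (D.PS _), ← D.PS_insert' hyU, ← hseg, ← e_even]
      exact h1 w hw
  · intro a b ha hb hb' hab w hw
    rw [Submodule.mem_comap, LinearMap.mulLeft_apply, ← mul_assoc, ← mul_assoc, hl]
    have hb2 : b.val < n + 1 := by omega
    rcases Nat.lt_succ_iff_lt_or_eq.1 ha with h | h
    · rcases Nat.lt_succ_iff_lt_or_eq.1 hb2 with h' | h'
      · rw [mul_assoc _ _ (D.M a b), (D.M_comm _ _ _ _).eq, ← mul_assoc, mul_assoc]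
        exact h3 (D.NN_mul (D.M_mem_NN h (by omega) (Or.inl h') hab) (mul_mem hMW (hW hw)))
      · obtain rfl : b = pt N n := Fin.ext (by omega)
        exact hMn a h w hw
    · obtain rfl : a = pt N n := Fin.ext (by omega)
      rw [D.M_symm _ b]
      refine hMn b ?_ w hw
      have : b.val ≠ n := fun h' => hab (Fin.ext (h.trans h'.symm))
      omega

/-- Elements with fewer free points lie in the two-sided ideal generated by `e i (n - 1)`. -/
lemma NN_le_ideal {i n : ℕ} (hi : (i + 1) / 2 ≤ N) (hn : n + 1 ≤ i / 2) {q : A}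
    (hq : q ∈ D.NN i (n + 1)) :
    q ∈ Submodule.span S {x | ∃ u ∈ D.W i, ∃ w ∈ D.W i, x = u * D.e i n * w} := by
  set Y := Submodule.span S {x | ∃ u ∈ D.W i, ∃ w ∈ D.W i, x = u * D.e i n * w} with hY
  have hYl : ∀ u ∈ D.W i, ∀ y ∈ Y, ∀ w ∈ D.W i, u * y * w ∈ Y := by
    intro u hu y hy w hw
    have : Y ≤ Y.comap ((LinearMap.mulRight S w).comp (LinearMap.mulLeft S u)) := by
      refine Submodule.span_le.2 ?_
      rintro _ ⟨u', hu', w', hw', rfl⟩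
      exact Submodule.subset_span ⟨u * u', mul_mem hu hu', w' * w, mul_mem hw' hw,
        by simp [mul_assoc]⟩
    exact this hy
  have hy : (pt N n).val = n := pt_val (by omega)
  have h0 : D.lead i (n + 1) * D.P (pt N n) ∈ Y := by
    have hyU : pt N n ∉ Seg N (n + 1) (i / 2) := by simp [hy]
    have hseg : Seg N n (i / 2) = insert (pt N n) (Seg N (n + 1) (i / 2)) :=
      Seg_succ_left (by omega) (by omega)
    rcases Nat.even_or_odd' i with ⟨k, rfl | rfl⟩
    · rw [show 2 * k / 2 = k by omega] at hseg hyU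
      refine Submodule.subset_span ⟨1, one_mem _, 1, one_mem _, ?_⟩
      rw [lead_even, e_even, ← D.PS_insert' hyU, hseg, one_mul, mul_one]
    · rw [show (2 * k + 1) / 2 = k by omega] at hseg hyU
      have hz : (pt N k).val = k := pt_val (by omega)
      have hPS : D.PS (Seg N n k) ∈ D.W (2 * k + 1) := by
        rw [W_odd]; exact PS_mem_Alg (Seg_mono (Nat.zero_le _) le_rfl)
      have hD : D.Dst (pt N k) (Seg N (n + 1) k) ∈ D.W (2 * k + 1) := by
        rw [← e_odd]; exact D.e_mem_W hi
      refine Submodule.subset_span ⟨_, mul_mem hD hPS, _, hPS, ?_⟩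
      rw [lead_odd, e_odd, mul_assoc, ← D.PS_insert' hyU, ← hseg, mul_assoc, mul_assoc,
        ← mul_assoc (D.PS _), D.PS_Dst_PS (by simp [hz])]
  have h1 : ∀ a : Fin N, a.val < n + 1 → D.lead i (n + 1) * D.P a ∈ Y := by
    intro a ha
    have hσ : Equiv.swap a (pt N n) ∈ HN N (n + 1) := swap_mem_HN ha (by omega)
    have hW := D.T_mem_W hn hσ
    have := hYl _ hW _ h0 _ hW
    rwa [← mul_assoc, (D.commute_T_lead hi hn hσ).eq, mul_assoc (D.lead _ _) (D.T _), D.T_P,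
      Equiv.swap_apply_right, ← mul_assoc, mul_assoc _ (D.T _) (D.T _), ← map_mul,
      Equiv.swap_mul_self, map_one, mul_one] at this
  refine D.NN_induction (Y := Y) ?_ ?_ hq
  · intro a ha w hw
    have := hYl 1 (one_mem _) _ (h1 a ha) w hw
    rwa [one_mul] at this
  · intro a b ha hb hb' hab w hw
    have hMW : D.M a b ∈ D.W i := M_mem_Alg (by rw [mem_Seg]; omega) (by rw [mem_Seg]; omega)
    have hc : Commute (D.M a b) (D.lead i (n + 1)) := by
      refine Commute.mul_right ?_ (D.M_PS (by rw [mem_Seg]; omega) (by rw [mem_Seg]; omega))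
      unfold leadL
      split_ifs
      · exact Commute.one_right _
      · exact D.M_Dst _ _ _ _
    have := hYl _ hMW _ (h1 a ha) _ (mul_mem hMW hw)
    rwa [← mul_assoc, ← mul_assoc, hc.eq, mul_assoc _ (D.M a b) (D.P a),
      mul_assoc (D.lead _ _), D.MPM a b hab] at this

end PData

/-! ### Row-constant sums of permutations -/

namespace Tab

variable {ι : Type} [DecidableEq ι]

/-- Relabel the points of `Z` by `q`. -/
def upd (f : ι → ℕ) (Z : Finset ι) (q : ℕ) : ι → ℕ := fun b => if b ∈ Z then q else f b

lemma upd_apply (f : ι → ℕ) (Z : Finset ι) (q : ℕ) (b : ι) :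
    upd f Z q b = if b ∈ Z then q else f b := rfl

lemma upd_comp (f : ι → ℕ) (Z : Finset ι) (q : ℕ) (w : Equiv.Perm ι) :
    upd f (Z.map w.toEmbedding) q ∘ w = upd (f ∘ w) Z q := by
  ext b
  simp [upd_apply]

lemma upd_comp_singleton (f : ι → ℕ) (z : ι) (q : ℕ) (w : Equiv.Perm ι) :
    upd f {w z} q ∘ w = upd (f ∘ w) {z} q := by
  rw [← upd_comp, Finset.map_singleton]
  rfl

variable [Fintype ι]

/-- The points with label `q`. -/
def fib (f : ι → ℕ) (q : ℕ) : Finset ι := Finset.univ.filter fun a => f a = q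

omit [DecidableEq ι] in
@[simp] lemma mem_fib {f : ι → ℕ} {q : ℕ} {a : ι} : a ∈ fib f q ↔ f a = q := by simp [fib]

omit [DecidableEq ι] in
lemma card_fib_comp (f : ι → ℕ) (q : ℕ) (w : Equiv.Perm ι) :
    (fib (f ∘ w) q).card = (fib f q).card := by
  refine Finset.card_bij (fun a _ => w a) (by simp) (fun a _ b _ h => w.injective h) ?_
  intro b hb
  exact ⟨w⁻¹ b, by simpa using hb, by simp⟩

omit [DecidableEq ι] in
lemma exists_perm_of_card_fib {f g : ι → ℕ} (h : ∀ q, (fib f q).card = (fib g q).card) :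
    ∃ w : Equiv.Perm ι, g ∘ w = f := by
  have e : ∀ q, Nonempty ({a // f a = q} ≃ {a // g a = q}) := fun q => by
    refine ⟨Fintype.equivOfCardEq ?_⟩
    have := h q
    simpa [Fintype.card_subtype, fib] using this
  exact ⟨Equiv.ofFiberEquiv fun q => (e q).some, funext fun a =>
    Equiv.ofFiberEquiv_map (fun q => (e q).some) a⟩

variable {A : Type} [Ring A] (T : Equiv.Perm ι →* A)

/-- The sum of all permutations carrying the labelling `g` to `f`. -/
def X (g f : ι → ℕ) : A := ∑ w ∈ Finset.univ.filter (fun w : Equiv.Perm ι => g ∘ w = f), T w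

lemma X_mul_T (g f : ι → ℕ) (σ : Equiv.Perm ι) : X T g f * T σ = X T g (f ∘ σ) := by
  unfold X
  rw [Finset.sum_mul]
  refine Finset.sum_bij (fun w _ => w * σ) ?_ (fun a _ b _ h => mul_right_cancel h) ?_ ?_
  · intro w hw
    simp only [Finset.mem_filter, Finset.mem_univ, true_and] at hw ⊢
    rw [← hw]; rfl
  · intro w hw
    simp only [Finset.mem_filter, Finset.mem_univ, true_and] at hw
    refine ⟨w * σ⁻¹, ?_, by simp⟩
    simp only [Finset.mem_filter, Finset.mem_univ, true_and]
    ext b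
    have := congrFun hw (σ⁻¹ b)
    simpa using this
  · intro w _
    rw [map_mul]

lemma T_mul_X (g f : ι → ℕ) (σ : Equiv.Perm ι) : T σ⁻¹ * X T g f = X T (g ∘ σ) f := by
  unfold X
  rw [Finset.mul_sum]
  refine Finset.sum_bij (fun w _ => σ⁻¹ * w) ?_ (fun a _ b _ h => mul_left_cancel h) ?_ ?_
  · intro w hw
    simp only [Finset.mem_filter, Finset.mem_univ, true_and] at hw ⊢
    rw [← hw]
    ext b
    simp
  · intro w hw
    simp only [Finset.mem_filter, Finset.mem_univ, true_and] at hw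
    refine ⟨σ * w, ?_, by simp⟩
    simp only [Finset.mem_filter, Finset.mem_univ, true_and]
    rw [← hw]; rfl
  · intro w _
    rw [map_mul]

lemma X_relabel {π : ℕ → ℕ} (hπ : Function.Injective π) (g f : ι → ℕ) :
    X T (π ∘ g) (π ∘ f) = X T g f := by
  unfold X
  refine Finset.sum_congr (Finset.filter_congr fun w _ => ?_) fun _ _ => rfl
  rw [Function.comp_assoc]
  exact hπ.comp_left.eq_iff

lemma X_eq_zero {g f : ι → ℕ} (h : ∀ w : Equiv.Perm ι, g ∘ w ≠ f) : X T g f = 0 := by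
  unfold X
  rw [Finset.filter_false_of_mem fun w _ => h w, Finset.sum_empty]

/-- Moving `r` labels from `p` to `q` on the right is moving `r` labels from `q` to `p` on the
left. -/
lemma sum_X_upd (g h : ι → ℕ) (p q r : ℕ) :
    ∑ Z ∈ (fib h p).powersetCard r, X T g (upd h Z q)
      = ∑ Z ∈ (fib g q).powersetCard r, X T (upd g Z p) h := by
  unfold X
  rw [Finset.sum_sigma', Finset.sum_sigma']
  refine Finset.sum_bij' (fun x _ => ⟨x.1.map x.2.toEmbedding, x.2⟩)
    (fun x _ => ⟨x.1.map x.2.symm.toEmbedding, x.2⟩) ?_ ?_ ?_ ?_ ?_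
  · rintro ⟨Z, w⟩ hx
    simp only [Finset.mem_sigma, Finset.mem_powersetCard, Finset.mem_filter, Finset.mem_univ,
      true_and, Finset.card_map] at hx ⊢
    obtain ⟨⟨hZ, hc⟩, hw⟩ := hx
    refine ⟨⟨fun a ha => ?_, hc⟩, ?_⟩
    · obtain ⟨b, hb, rfl⟩ := Finset.mem_map.1 ha
      have := congrFun hw b
      simpa [upd_apply, hb] using this
    · rw [upd_comp, hw]
      ext b
      by_cases hb : b ∈ Z
      · simpa [upd_apply, hb] using (mem_fib.1 (hZ hb)).symm
      · simp [upd_apply, hb]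
  · rintro ⟨Z, w⟩ hx
    simp only [Finset.mem_sigma, Finset.mem_powersetCard, Finset.mem_filter, Finset.mem_univ,
      true_and, Finset.card_map] at hx ⊢
    obtain ⟨⟨hZ, hc⟩, hw⟩ := hx
    have hmem : ∀ b, b ∈ Z.map w.symm.toEmbedding ↔ w b ∈ Z := fun b => by
      rw [Finset.mem_map_equiv]; simp
    refine ⟨⟨fun a ha => ?_, hc⟩, ?_⟩
    · have := congrFun hw a
      rw [mem_fib, ← this, Function.comp_apply, upd_apply, if_pos ((hmem a).1 ha)]
    · ext b
      rw [upd_apply, ← hw]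
      by_cases hb : w b ∈ Z
      · simpa [hmem, hb] using hZ hb
      · simp [hb, upd_apply]
  · rintro ⟨Z, w⟩ _
    simp only [Sigma.mk.injEq, heq_eq_eq, and_true]
    ext b; simp [Finset.mem_map_equiv]
  · rintro ⟨Z, w⟩ _
    simp only [Sigma.mk.injEq, heq_eq_eq, and_true]
    ext b; simp [Finset.mem_map_equiv]
  · rintro ⟨Z, w⟩ _; rfl

lemma sum_X_upd_singleton (g h : ι → ℕ) (p q : ℕ) {z : ι} (hz : fib g q = {z}) :
    ∑ y ∈ fib h p, X T g (upd h {y} q) = X T (upd g {z} p) h := by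
  have := sum_X_upd T g h p q 1
  rw [hz, Finset.powersetCard_one, Finset.powersetCard_one, Finset.map_singleton,
    Finset.sum_singleton, Finset.sum_map] at this
  exact this

/-- Splitting a row-constant sum according to the image of the point `z`. -/
lemma sum_T_mul_X {G g f : ι → ℕ} {z : ι} {j L : ℕ} {c : ι → Equiv.Perm ι}
    (hg : ∀ b, g b = L ↔ b = z) (hf : f z = L)
    (hc : ∀ y, G y = j → c y z = y ∧ G ∘ c y = upd g {z} j) :
    ∑ y ∈ fib G j, T (c y) * X T g f = X T G (upd f {z} j) := by
  unfold X
  rw [← Finset.sum_fiberwise_of_maps_to (s := Finset.univ.filter fun w : Equiv.Perm ι =>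
    G ∘ w = upd f {z} j) (t := fib G j) (g := fun w => w z)]
  · refine Finset.sum_congr rfl fun y hy => ?_
    obtain ⟨h1, h2⟩ := hc y (mem_fib.1 hy)
    rw [Finset.mul_sum]
    have key : ∀ w : Equiv.Perm ι, (G ∘ (c y * w : Equiv.Perm ι) = upd f {z} j ∧ w z = z) ↔
        g ∘ w = f := by
      intro w
      have e : G ∘ (c y * w : Equiv.Perm ι) = upd g {z} j ∘ w := by rw [← h2]; rfl
      rw [e]
      constructor
      · rintro ⟨h3, h4⟩
        ext b
        by_cases hb : b = z
        · subst hb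
          rw [Function.comp_apply, h4, hf, hg]
        · have h5 : w b ≠ z := fun h => hb (w.injective (h.trans h4.symm))
          simpa [upd_apply, hb, h5] using congrFun h3 b
      · rintro rfl
        have h4 : w z = z := (hg _).1 hf
        refine ⟨?_, h4⟩
        ext b
        by_cases hb : b = z
        · subst hb; simp [upd_apply, h4]
        · have h5 : w b ≠ z := fun h => hb (w.injective (h.trans h4.symm))
          simp [upd_apply, hb, h5]
    refine Finset.sum_bij (fun w _ => c y * w) ?_ (fun a _ b _ h => mul_left_cancel h) ?_ ?_
    · intro w hw
      simp only [Finset.mem_filter, Finset.mem_univ, true_and] at hw ⊢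
      obtain ⟨h3, h4⟩ := (key w).2 hw
      exact ⟨h3, by rw [Equiv.Perm.mul_apply, h4, h1]⟩
    · intro w hw
      simp only [Finset.mem_filter, Finset.mem_univ, true_and] at hw
      refine ⟨(c y)⁻¹ * w, ?_, by simp⟩
      simp only [Finset.mem_filter, Finset.mem_univ, true_and]
      refine (key _).1 ⟨by rw [mul_inv_cancel_left]; exact hw.1, ?_⟩
      rw [Equiv.Perm.mul_apply, hw.2, Equiv.Perm.inv_eq_iff_eq, h1]
    · intro w _
      rw [map_mul]
  · intro w hw
    simp only [Finset.mem_filter, Finset.mem_univ, true_and] at hw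
    have := congrFun hw z
    simpa [upd_apply] using this

/-- Inclusion-exclusion: if `f` has fewer labels `p` than `q`, any function of `f` is a combination
of sums over the ways of moving `r ≥ 1` labels from `p` to `q`. -/
lemma mem_span_sum_upd {S M : Type} [CommRing S] [AddCommGroup M] [Module S M]
    (Ψ : (ι → ℕ) → M) {f : ι → ℕ} {p q : ℕ} (hlt : (fib f p).card < (fib f q).card) :
    Ψ f ∈ Submodule.span S {x | ∃ r, 1 ≤ r ∧ ∃ h : ι → ℕ,
      (∀ b, f b ≠ p → f b ≠ q → h b = f b) ∧
      x = ∑ Z ∈ (fib h p).powersetCard r, Ψ (upd h Z q)} := by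
  set Y0 := fib f q with hY0
  set B := fib f p ∪ fib f q with hB
  have hpq : p ≠ q := fun h => by rw [hY0, h] at hlt; exact lt_irrefl _ hlt
  let h : Finset ι → ι → ℕ := fun Y => upd (upd f B p) Y q
  let G : Finset ι → M := fun Y => ∑ Y' ∈ (B.powersetCard Y0.card).filter (Y ⊆ ·), Ψ (h Y')
  have hBm : ∀ b, b ∈ B ↔ f b = p ∨ f b = q := fun b => by simp [hB]
  have hY0B : Y0 ⊆ B := Finset.subset_union_right
  have hfib : ∀ Y, Y ⊆ Y0 → fib (h Y) p = B \ Y := by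
    intro Y hY
    ext b
    simp only [mem_fib, h, upd_apply, Finset.mem_sdiff]
    have := hBm b
    split_ifs with h1 h2
    · simp [h1, hpq.symm]
    · simp [h1, h2]
    · simp only [h1, h2, false_and, iff_false]
      tauto
  have hG : ∀ Y, Y ⊆ Y0 →
      ∑ Z ∈ (fib (h Y) p).powersetCard (Y0.card - Y.card), Ψ (upd (h Y) Z q) = G Y := by
    intro Y hY
    rw [hfib Y hY]
    have hc := Finset.card_le_card hY
    refine Finset.sum_bij (fun Z _ => Y ∪ Z) ?_ ?_ ?_ ?_
    · intro Z hZ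
      rw [Finset.mem_powersetCard] at hZ
      have hd : Disjoint Y Z := by
        refine Finset.disjoint_left.2 fun b hb hb' => ?_
        exact (Finset.mem_sdiff.1 (hZ.1 hb')).2 hb
      rw [Finset.mem_filter, Finset.mem_powersetCard, Finset.card_union_of_disjoint hd, hZ.2]
      exact ⟨⟨Finset.union_subset (hY.trans hY0B) (hZ.1.trans Finset.sdiff_subset), by omega⟩,
        Finset.subset_union_left⟩
    · intro Z hZ Z' hZ' e
      rw [Finset.mem_powersetCard] at hZ hZ'
      have : ∀ {Z : Finset ι}, Z ⊆ B \ Y → (Y ∪ Z) \ Y = Z := fun {Z} hZ => by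
        ext b
        have := @hZ b
        simp only [Finset.mem_sdiff, Finset.mem_union] at this ⊢
        tauto
      rw [← this hZ.1, e, this hZ'.1]
    · intro Y' hY'
      rw [Finset.mem_filter, Finset.mem_powersetCard] at hY'
      refine ⟨Y' \ Y, ?_, Finset.union_sdiff_of_subset hY'.2⟩
      rw [Finset.mem_powersetCard, Finset.card_sdiff_of_subset hY'.2, hY'.1.2]
      exact ⟨Finset.sdiff_subset_sdiff hY'.1.1 le_rfl, rfl⟩
    · intro Z _
      congr 1
      ext b
      simp only [h, upd_apply, Finset.mem_union]
      split_ifs <;> tauto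
  have hY0f : h Y0 = f := by
    ext b
    have h1 := hBm b
    have h2 : b ∈ Y0 ↔ f b = q := by simp [hY0]
    simp only [h, upd_apply]
    split_ifs with h3 h4
    · exact (h2.1 h3).symm
    · tauto
    · rfl
  have hGY0 : G Y0 = Ψ f := by
    rw [← hG Y0 subset_rfl, Nat.sub_self, Finset.powersetCard_zero, Finset.sum_singleton, hY0f]
    congr 1
  have hsum : ∑ Y ∈ Y0.powerset, (-1 : ℤ) ^ Y.card • G Y = 0 := by
    simp only [G, Finset.smul_sum, Finset.sum_filter]
    rw [Finset.sum_comm]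
    refine Finset.sum_eq_zero fun Y' hY' => ?_
    rw [Finset.mem_powersetCard] at hY'
    have hne : (Y0 ∩ Y').Nonempty := by
      by_contra hcon
      rw [Finset.not_nonempty_iff_eq_empty] at hcon
      have : Y' ⊆ fib f p := fun b hb => by
        rcases Finset.mem_union.1 (hY'.1 hb) with h1 | h1
        · exact h1
        · exact absurd (Finset.mem_inter.2 ⟨h1, hb⟩) (by rw [hcon]; simp)
      have := Finset.card_le_card this
      omega
    simp only [smul_ite, smul_zero]
    rw [← Finset.sum_filter (p := fun Y => Y ⊆ Y')]
    have hfilt : Y0.powerset.filter (fun Y => Y ⊆ Y') = (Y0 ∩ Y').powerset := by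
      ext Y
      simp only [Finset.mem_filter, Finset.mem_powerset, Finset.subset_inter_iff]
    rw [hfilt, ← Finset.sum_smul, Finset.sum_powerset_neg_one_pow_card_of_nonempty hne, zero_smul]
  rw [← Finset.add_sum_erase _ _ (Finset.mem_powerset_self Y0), hGY0] at hsum
  have hmem : (-1 : ℤ) ^ Y0.card • Ψ f ∈ Submodule.span S {x | ∃ r, 1 ≤ r ∧ ∃ h : ι → ℕ,
      (∀ b, f b ≠ p → f b ≠ q → h b = f b) ∧
      x = ∑ Z ∈ (fib h p).powersetCard r, Ψ (upd h Z q)} := by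
    rw [eq_neg_of_add_eq_zero_left hsum]
    refine neg_mem (sum_mem fun Y hY => zsmul_mem (Submodule.subset_span ?_) _)
    obtain ⟨hne, hY⟩ := Finset.mem_erase.1 hY
    rw [Finset.mem_powerset] at hY
    have := Finset.card_lt_card (hY.ssubset_of_ne hne)
    refine ⟨Y0.card - Y.card, by omega, h Y, fun b h1 h2 => ?_, (hG Y hY).symm⟩
    have h3 : b ∉ B := by rw [hBm]; tauto
    have h4 : b ∉ Y := fun h => h3 (hY0B (hY h))
    simp [h, upd_apply, h3, h4]
  rcases neg_one_pow_eq_or ℤ Y0.card with h1 | h1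
  · rwa [h1, one_smul] at hmem
  · rwa [h1, neg_smul, one_smul, neg_mem_iff] at hmem

end Tab

/-! ### Young diagrams and superstandard labellings -/

/-- The number of nodes in the first `k` rows. -/
def psum (lam : YoungDiagram) (k : ℕ) : ℕ := ∑ i ∈ Finset.range k, lam.rowLen i

lemma psum_succ (lam : YoungDiagram) (k : ℕ) : psum lam (k + 1) = psum lam k + lam.rowLen k :=
  Finset.sum_range_succ _ _

lemma psum_mono (lam : YoungDiagram) {k l : ℕ} (h : k ≤ l) : psum lam k ≤ psum lam l :=
  Finset.sum_le_sum_of_subset (Finset.range_mono h)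

lemma fst_lt_card {lam : YoungDiagram} {c : ℕ × ℕ} (hc : c ∈ lam) : c.1 < lam.card := by
  have : (Finset.range (c.1 + 1)).card ≤ lam.cells.card := by
    refine Finset.card_le_card_of_injOn (fun i => (i, 0)) (fun i hi => ?_) fun i _ j _ h => ?_
    · exact YoungDiagram.up_left_mem lam (by simpa [Nat.lt_succ_iff] using hi) (Nat.zero_le _) hc
    · exact (Prod.mk.inj h).1
  rwa [Finset.card_range] at this

lemma rowLen_eq_zero {lam : YoungDiagram} {i : ℕ} (h : lam.card ≤ i) : lam.rowLen i = 0 := by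
  by_contra hne
  have := fst_lt_card (YoungDiagram.mem_iff_lt_rowLen.2 (Nat.pos_of_ne_zero hne))
  simp only at this
  omega

lemma psum_eq_card {lam : YoungDiagram} {k : ℕ} (h : lam.card ≤ k) : psum lam k = lam.card := by
  unfold psum YoungDiagram.card
  rw [Finset.card_eq_sum_card_fiberwise (f := Prod.fst) (t := Finset.range k)]
  · exact Finset.sum_congr rfl fun i _ => lam.rowLen_eq_card
  · intro c hc
    simpa using (fst_lt_card hc).trans_le h

lemma psum_le_card (lam : YoungDiagram) (k : ℕ) : psum lam k ≤ lam.card := by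
  rcases le_total lam.card k with h | h
  · exact (psum_eq_card h).le
  · exact (psum_mono lam h).trans (psum_eq_card le_rfl).le

lemma le_psum {lam : YoungDiagram} {r : ℕ} (h : 0 < lam.rowLen r) : r + 1 ≤ psum lam (r + 1) := by
  have : ∑ _i ∈ Finset.range (r + 1), 1 ≤ psum lam (r + 1) := by
    refine Finset.sum_le_sum fun i hi => ?_
    have := lam.rowLen_anti i r (by simpa [Nat.lt_succ_iff] using hi)
    omega
  simpa using this

lemma rowOfNum_of_lt {lam : YoungDiagram} {a j : ℕ} (h : psum lam j ≤ a)
    (h' : a < psum lam (j + 1)) : rowOfNum lam (a + 1) = j := by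
  have : (Finset.range (a + 1)).filter (fun r => psum lam (r + 1) < a + 1) = Finset.range j := by
    ext r
    simp only [Finset.mem_filter, Finset.mem_range]
    constructor
    · rintro ⟨-, h1⟩
      by_contra h2
      have := psum_mono lam (show j + 1 ≤ r + 1 by omega)
      omega
    · intro hr
      have h1 := psum_mono lam (show r + 1 ≤ j by omega)
      have h2 := psum_succ lam j
      have h3 := le_psum (lam := lam) (r := r) (by
        have := lam.rowLen_anti r j hr.le
        omega)
      omega
  unfold rowOfNum
  exact (congrArg Finset.card this).trans (Finset.card_range j)

lemma rowOfNum_of_ge {lam : YoungDiagram} {a : ℕ} (h : lam.card ≤ a) :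
    rowOfNum lam (a + 1) = a + 1 := by
  unfold rowOfNum
  rw [Finset.filter_true_of_mem, Finset.card_range]
  intro r _
  have := psum_le_card lam (r + 1)
  unfold psum at this
  omega

lemma exists_row {lam : YoungDiagram} {a : ℕ} (h : a < lam.card) :
    ∃ j, j ≤ a ∧ psum lam j ≤ a ∧ a < psum lam (j + 1) := by
  have hex : ∃ j, a < psum lam (j + 1) := ⟨lam.card, by rwa [psum_eq_card (by omega)]⟩
  have h1 := Nat.find_spec hex
  have h2 : psum lam (Nat.find hex) ≤ a := by
    rcases hj : Nat.find hex with _ | j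
    · simp [psum]
    · have := Nat.find_min hex (show j < Nat.find hex by omega)
      omega
  refine ⟨_, ?_, h2, h1⟩
  have h3 := psum_succ lam (Nat.find hex)
  rcases hj : Nat.find hex with _ | j
  · omega
  · have := le_psum (lam := lam) (r := j) (by
      have := lam.rowLen_anti j (Nat.find hex) (by omega)
      omega)
    rw [hj] at h2
    omega

/-- `nu` is obtained from `lam` by adding a node in row `j`. -/
def Box (lam nu : YoungDiagram) (j : ℕ) : Prop :=
  ∀ i, nu.rowLen i = lam.rowLen i + if i = j then 1 else 0

lemma psum_box {lam nu : YoungDiagram} {j : ℕ} (h : Box lam nu j) (k : ℕ) :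
    psum nu k = psum lam k + if j < k then 1 else 0 := by
  induction k with
  | zero => simp [psum]
  | succ k ih =>
    rw [psum_succ, psum_succ, ih, h k]
    split_ifs <;> omega

lemma rowLen_mono {lam nu : YoungDiagram} (h : lam ≤ nu) (i : ℕ) :
    lam.rowLen i ≤ nu.rowLen i := by
  by_contra hlt
  push Not at hlt
  have h1 := h (YoungDiagram.mem_iff_lt_rowLen.2 hlt)
  exact lt_irrefl _ (YoungDiagram.mem_iff_lt_rowLen.1 h1)

lemma le_of_rowLen_le {lam nu : YoungDiagram} (h : ∀ i, lam.rowLen i ≤ nu.rowLen i) :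
    lam ≤ nu := by
  rintro ⟨i, j⟩ hc
  exact YoungDiagram.mem_iff_lt_rowLen.2
    ((YoungDiagram.mem_iff_lt_rowLen.1 hc).trans_le (h i))

lemma ext_rowLen {lam nu : YoungDiagram} (h : ∀ i, lam.rowLen i = nu.rowLen i) : lam = nu :=
  le_antisymm (le_of_rowLen_le fun i => (h i).le) (le_of_rowLen_le fun i => (h i).ge)

lemma exists_box {lam nu : YoungDiagram} (h : lam ≤ nu) (hc : nu.card = lam.card + 1) :
    ∃ j, j ≤ lam.card ∧ Box lam nu j := by
  have h1 := psum_eq_card (lam := lam) (k := nu.card) (by omega)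
  have h2 := psum_eq_card (lam := nu) (k := nu.card) le_rfl
  have h3 : ∃ j ∈ Finset.range nu.card, lam.rowLen j < nu.rowLen j := by
    refine Finset.exists_lt_of_sum_lt ?_
    unfold psum at h1 h2
    omega
  obtain ⟨j, hj, hlt⟩ := h3
  have h4 := Finset.add_sum_erase (Finset.range nu.card) lam.rowLen hj
  have h5 := Finset.add_sum_erase (Finset.range nu.card) nu.rowLen hj
  have h6 : ∑ i ∈ (Finset.range nu.card).erase j, lam.rowLen i ≤
      ∑ i ∈ (Finset.range nu.card).erase j, nu.rowLen i :=
    Finset.sum_le_sum fun i _ => rowLen_mono h i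
  unfold psum at h1 h2
  have h7 := (Finset.sum_eq_sum_iff_of_le fun i (_ : i ∈ (Finset.range nu.card).erase j) =>
    rowLen_mono h i).1 (by omega)
  refine ⟨j, by rw [Finset.mem_range] at hj; omega, fun i => ?_⟩
  split_ifs with hij
  · subst hij
    omega
  · by_cases hi : i < nu.card
    · rw [h7 i (Finset.mem_erase.2 ⟨hij, Finset.mem_range.2 hi⟩), add_zero]
    · rw [rowLen_eq_zero (by omega), rowLen_eq_zero (by omega)]

lemma Box.card {lam nu : YoungDiagram} {j : ℕ} (h : Box lam nu j) : nu.card = lam.card + 1 := by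
  have := psum_box h (lam.card + nu.card + j + 1)
  rwa [psum_eq_card (by omega), psum_eq_card (by omega), if_pos (by omega)] at this

lemma Box.le {lam nu : YoungDiagram} {j : ℕ} (h : Box lam nu j) : lam ≤ nu :=
  le_of_rowLen_le fun i => by rw [h i]; omega

lemma Box.row_le {lam nu : YoungDiagram} {j : ℕ} (h : Box lam nu j) : j ≤ lam.card := by
  have h1 := h j
  have := h.card
  by_contra hlt
  rw [rowLen_eq_zero (by omega), if_pos rfl] at h1
  omega

lemma addedRow_eq {lam nu : YoungDiagram} {j : ℕ} (h : Box lam nu j) : addedRow lam nu = j := by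
  unfold addedRow
  have h1 := h.row_le
  have h2 := h.card
  rw [Finset.sum_eq_single j]
  · rw [if_pos (by rw [h j]; simp)]
  · intro i _ hij
    rw [if_neg (by rw [h i]; simp [hij])]
  · intro hj
    exact absurd (Finset.mem_range.2 (by omega)) hj

lemma aVal_eq {lam nu : YoungDiagram} {j : ℕ} (h : Box lam nu j) :
    aVal lam nu = psum nu (j + 1) := by
  unfold aVal psum
  rw [addedRow_eq h]

/-- The Young diagram with the given row lengths. -/
def ofRows (f : ℕ → ℕ) (hf : Antitone f) (n : ℕ) (_hn : ∀ i, n ≤ i → f i = 0) : YoungDiagram where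
  cells := (Finset.range n ×ˢ Finset.range (f 0)).filter fun c => c.2 < f c.1
  isLowerSet := by
    rintro ⟨a, b⟩ ⟨c, d⟩ hle h
    simp only [Finset.coe_filter, Finset.mem_product, Finset.mem_range, Set.mem_ofPred_eq] at h ⊢
    obtain ⟨h1, h2⟩ := Prod.mk_le_mk.1 hle
    have := hf h1
    omega

lemma rowLen_ofRows {f : ℕ → ℕ} (hf : Antitone f) (n : ℕ) (hn : ∀ i, n ≤ i → f i = 0) (i : ℕ) :
    (ofRows f hf n hn).rowLen i = f i := by
  have key : ∀ j, j < (ofRows f hf n hn).rowLen i ↔ j < f i := by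
    intro j
    rw [← YoungDiagram.mem_iff_lt_rowLen, ← YoungDiagram.mem_cells]
    simp only [ofRows, Finset.mem_filter, Finset.mem_product, Finset.mem_range]
    constructor
    · exact fun h => h.2
    · intro h
      have h1 := hf (Nat.zero_le i)
      refine ⟨⟨?_, by omega⟩, h⟩
      by_contra hi
      have := hn i (by omega)
      omega
  refine le_antisymm ?_ ?_
  · by_contra h
    push Not at h
    exact lt_irrefl _ ((key _).1 h)
  · by_contra h
    push Not at h
    exact lt_irrefl _ ((key _).2 h)

lemma card_ofRows {f : ℕ → ℕ} (hf : Antitone f) (n : ℕ) (hn : ∀ i, n ≤ i → f i = 0) :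
    (ofRows f hf n hn).card = ∑ i ∈ Finset.range n, f i := by
  set lam := ofRows f hf n hn with hlam
  have h1 := psum_eq_card (lam := lam) (k := max n lam.card) (le_max_right _ _)
  rw [← h1, psum, ← Finset.sum_subset (Finset.range_mono (le_max_left n lam.card))]
  · exact Finset.sum_congr rfl fun i _ => rowLen_ofRows hf n hn i
  · intro i _ hi
    rw [rowLen_ofRows, hn i (by simpa using hi)]

lemma exists_box_of_lt {lam : YoungDiagram} {j : ℕ} (h : lam.rowLen (j + 1) < lam.rowLen j) :
    ∃ mu, Box mu lam j := by
  let f : ℕ → ℕ := fun i => lam.rowLen i - if i = j then 1 else 0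
  have hf : Antitone f := antitone_nat_of_succ_le fun i => by
    have h1 := lam.rowLen_anti i (i + 1) (by omega)
    simp only [f]
    by_cases hi : i = j
    · subst hi
      simp only [if_true]
      split_ifs <;> omega
    · rw [if_neg hi]
      split_ifs <;> omega
  refine ⟨ofRows f hf lam.card fun i hi => ?_, fun i => ?_⟩
  · simp [f, rowLen_eq_zero hi]
  · rw [rowLen_ofRows]
    simp only [f]
    split_ifs with hi
    · subst hi; omega
    · rfl

lemma exists_box_of_addable {lam : YoungDiagram} {j : ℕ}
    (h : ∀ i, i + 1 = j → lam.rowLen j < lam.rowLen i) : ∃ nu, Box lam nu j := by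
  let f : ℕ → ℕ := fun i => lam.rowLen i + if i = j then 1 else 0
  have hf : Antitone f := antitone_nat_of_succ_le fun i => by
    have h1 := lam.rowLen_anti i (i + 1) (by omega)
    have h2 := h i
    simp only [f]
    by_cases hi : i + 1 = j
    · subst hi
      have := h2 rfl
      simp only [if_true]
      split_ifs <;> omega
    · rw [if_neg hi]
      split_ifs <;> omega
  refine ⟨ofRows f hf (lam.card + j + 1) fun i hi => ?_, fun i => ?_⟩
  · simp only [f]
    rw [rowLen_eq_zero (by omega), if_neg (by omega)]
  · rw [rowLen_ofRows]

lemma sum_le_sum_range {f : ℕ → ℕ} (hf : Antitone f) (s : Finset ℕ) :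
    ∑ i ∈ s, f i ≤ ∑ i ∈ Finset.range s.card, f i := by
  induction s using Finset.induction_on_max with
  | empty => simp
  | insert a s ha ih =>
    have hna : a ∉ s := fun h => lt_irrefl _ (ha a h)
    have hc : s.card ≤ a := by
      have := Finset.card_le_card (show s ⊆ Finset.range a from fun x hx =>
        Finset.mem_range.2 (ha x hx))
      rwa [Finset.card_range] at this
    rw [Finset.sum_insert hna, Finset.card_insert_of_notMem hna, Finset.sum_range_succ, add_comm]
    exact add_le_add ih (hf hc)

/-- The content `κ` can be sorted into a partition. -/
lemma exists_sorted (n : ℕ) (κ : ℕ → ℕ) (hκ : ∀ i, n ≤ i → κ i = 0) :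
    ∃ (tau : YoungDiagram) (π : Equiv.Perm ℕ), (∀ i, n ≤ i → π i = i) ∧
      (∀ i, tau.rowLen i = κ (π i)) ∧ tau.card = ∑ i ∈ Finset.range n, κ i ∧
      ∀ k, ∑ i ∈ Finset.range k, κ i ≤ psum tau k := by
  set g : Fin n → ℕᵒᵈ := fun i => OrderDual.toDual (κ i) with hg
  set s : Equiv.Perm (Fin n) := Tuple.sort g with hs
  have hmono : Monotone (g ∘ s) := Tuple.monotone_sort g
  let π : Equiv.Perm ℕ := s.extendDomain (Fin.equivSubtype (n := n))
  have hπ1 : ∀ i, n ≤ i → π i = i := fun i hi =>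
    Equiv.Perm.extendDomain_apply_not_subtype _ _ (by simpa using hi)
  have hπ2 : ∀ i (hi : i < n), π i = s ⟨i, hi⟩ := fun i hi =>
    Equiv.Perm.extendDomain_apply_image s (Fin.equivSubtype (n := n)) ⟨i, hi⟩
  have hf : Antitone fun i => κ (π i) := by
    intro i j hij
    by_cases hj : j < n
    · have := hmono (show (⟨i, by omega⟩ : Fin n) ≤ ⟨j, hj⟩ from hij)
      simp only
      rw [hπ2 i (by omega), hπ2 j hj]
      exact this
    · simp only
      rw [hπ1 j (by omega), hκ j (by omega)]
      exact Nat.zero_le _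
  have hn : ∀ i, n ≤ i → κ (π i) = 0 := fun i hi => by rw [hπ1 i hi, hκ i hi]
  refine ⟨ofRows _ hf n hn, π, hπ1, rowLen_ofRows hf n hn, ?_, fun k => ?_⟩
  · rw [card_ofRows]
    rw [Finset.sum_range, Finset.sum_range, ← Equiv.sum_comp s fun i => κ i]
    exact Finset.sum_congr rfl fun i _ => by rw [hπ2 i i.2]
  · have h1 := sum_le_sum_range hf ((Finset.range k).map π.symm.toEmbedding)
    rw [Finset.sum_map, Finset.card_map, Finset.card_range] at h1
    simp only [Equiv.coe_toEmbedding, Equiv.apply_symm_apply] at h1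
    refine h1.trans (le_of_eq (Finset.sum_congr rfl fun i _ => ?_))
    rw [rowLen_ofRows]

section

/-- The row labelling of the superstandard tableau of shape `lam`, extended by `b ↦ b + 1`. -/
def rl (N : ℕ) (lam : YoungDiagram) : Fin N → ℕ := fun a => rowOfNum lam (a.val + 1)

/-- Labellings that agree with `b ↦ b + 1` from `n` on. -/
def Lab {N : ℕ} (n : ℕ) (h : Fin N → ℕ) : Prop := ∀ b : Fin N, n ≤ b.val → h b = b.val + 1

lemma Lab.mono {N n k : ℕ} {h : Fin N → ℕ} (hh : Lab n h) (hk : n ≤ k) : Lab k h :=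
  fun b hb => hh b (hk.trans hb)

lemma Lab.comp {N n : ℕ} [NeZero N] {h : Fin N → ℕ} (hh : Lab n h) {σ : Equiv.Perm (Fin N)}
    (hσ : σ ∈ PData.HN N n) : Lab n (h ∘ σ) := fun b hb => by
  rw [Function.comp_apply, PData.mem_HN.1 hσ b hb, hh b hb]

lemma lab_rl {N : ℕ} (lam : YoungDiagram) : Lab lam.card (rl N lam) :=
  fun _ hb => rowOfNum_of_ge hb

lemma rl_eq_of {N : ℕ} {lam : YoungDiagram} {a : Fin N} {j : ℕ} (h : psum lam j ≤ a.val)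
    (h' : a.val < psum lam (j + 1)) : rl N lam a = j := rowOfNum_of_lt h h'

lemma rl_eq_iff {N : ℕ} {lam : YoungDiagram} {a : Fin N} {j : ℕ} (hj : j ≤ lam.card) :
    rl N lam a = j ↔ psum lam j ≤ a.val ∧ a.val < psum lam (j + 1) := by
  constructor
  · intro h
    by_cases ha : a.val < lam.card
    · obtain ⟨i, _, h1, h2⟩ := exists_row ha
      rw [rl_eq_of h1 h2] at h
      subst h
      exact ⟨h1, h2⟩
    · rw [lab_rl lam a (by omega)] at h
      omega
  · exact fun h => rl_eq_of h.1 h.2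

lemma rl_lt {N : ℕ} {lam : YoungDiagram} {a : Fin N} (ha : a.val < lam.card) :
    rl N lam a < lam.card := by
  obtain ⟨i, h, h1, h2⟩ := exists_row ha
  rw [rl_eq_of h1 h2]
  omega

lemma rl_eq_iff_of_ge {N : ℕ} {lam : YoungDiagram} {a : Fin N} {j : ℕ} (hj : lam.card ≤ j) :
    rl N lam a = j ↔ lam.card ≤ a.val ∧ a.val + 1 = j := by
  constructor
  · intro h
    by_cases ha : a.val < lam.card
    · have := rl_lt ha
      omega
    · rw [lab_rl lam a (by omega)] at h
      omega
  · rintro ⟨h, rfl⟩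
    exact lab_rl lam a h

open Tab

lemma card_fib_rl {N : ℕ} {lam : YoungDiagram} (hN : lam.card ≤ N) {j : ℕ} (hj : j ≤ lam.card) :
    (fib (rl N lam) j).card = lam.rowLen j := by
  have h1 : (fib (rl N lam) j).map Fin.valEmbedding = Finset.Ico (psum lam j) (psum lam (j + 1)) := by
    ext a
    have := psum_le_card lam (j + 1)
    simp only [Finset.mem_map, mem_fib, Fin.valEmbedding_apply, Finset.mem_Ico]
    constructor
    · rintro ⟨b, hb, rfl⟩
      exact (rl_eq_iff hj).1 hb
    · exact fun h => ⟨⟨a, by omega⟩, (rl_eq_iff hj).2 h, rfl⟩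
  rw [← Finset.card_map Fin.valEmbedding, h1, Nat.card_Ico, psum_succ]
  omega

section Sym

variable {N : ℕ} [NeZero N] {S : Type} [CommRing S] {A : Type} [Ring A] [Algebra S A]
  (T : Equiv.Perm (Fin N) →* A)

/-- Garnir-type elements, which are combinations of elements of more dominant shape. -/
def Gen (lam : YoungDiagram) : Set A :=
  {x | ∃ (p r : ℕ) (h : Fin N → ℕ), p < lam.card ∧ 1 ≤ r ∧ Lab lam.card h ∧
    x = ∑ Z ∈ (fib h p).powersetCard r, X T (rl N lam) (upd h Z (p + 1))}

lemma X_rl_eq_zero {n : ℕ} (hn : n < N) {lam : YoungDiagram} (hl : lam.card = n + 1)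
    {f : Fin N → ℕ} (hf : Lab (n + 1) f) (hz : n + 1 ≤ f (pt N n)) : X T (rl N lam) f = 0 := by
  refine X_eq_zero T fun w hw => ?_
  have h1 : rl N lam (w (pt N n)) = f (pt N n) := congrFun hw _
  rw [rl_eq_iff_of_ge (by omega)] at h1
  have h2 : rl N lam (w (w (pt N n))) = f (w (pt N n)) := congrFun hw _
  rw [hf _ (by omega), rl_eq_iff_of_ge (by omega)] at h2
  have h3 : w (w (pt N n)) = w (pt N n) := Fin.ext (by omega)
  have h4 := w.injective h3
  rw [h4, pt_val hn] at h1
  omega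

lemma sum_range_moved {lam : YoungDiagram} {p r : ℕ} (hr : r ≤ lam.rowLen (p + 1)) (k : ℕ) :
    ∑ i ∈ Finset.range k, (lam.rowLen i + (if i = p then r else 0) - if i = p + 1 then r else 0)
      = psum lam k + if k = p + 1 then r else 0 := by
  induction k with
  | zero => simp [psum]
  | succ k ih =>
    rw [Finset.sum_range_succ, ih, psum_succ]
    by_cases h1 : k = p
    · subst h1
      simp
      omega
    · by_cases h2 : k = p + 1
      · subst h2
        simp
        omega
      · simp [h1, h2]

omit [NeZero N] in
lemma card_fib_moved {g : Fin N → ℕ} {p q : ℕ} (hpq : p ≠ q) {Z : Finset (Fin N)}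
    (hZ : Z ⊆ fib g q) (i : ℕ) :
    (fib (upd g Z p) i).card
      = (fib g i).card + (if i = p then Z.card else 0) - if i = q then Z.card else 0 := by
  by_cases h1 : i = p
  · subst h1
    have : fib (upd g Z i) i = fib g i ∪ Z := by
      ext a
      simp only [mem_fib, upd_apply, Finset.mem_union]
      split_ifs with h <;> simp [h]
    rw [this, Finset.card_union_of_disjoint, if_pos rfl, if_neg hpq]
    · omega
    · refine Finset.disjoint_left.2 fun a ha haZ => hpq ?_
      rw [← mem_fib.1 ha, mem_fib.1 (hZ haZ)]
  · by_cases h2 : i = q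
    · subst h2
      have : fib (upd g Z p) i = fib g i \ Z := by
        ext a
        simp only [mem_fib, upd_apply, Finset.mem_sdiff]
        split_ifs with h <;> simp [h, Ne.symm h1]
      rw [this, Finset.card_sdiff_of_subset hZ]
      simp [h1]
    · have : fib (upd g Z p) i = fib g i := by
        ext a
        simp only [mem_fib, upd_apply]
        split_ifs with h
        · have := mem_fib.1 (hZ h)
          simp only [Ne.symm h1, false_iff]
          omega
        · rfl
      simp [this, h1, h2]

omit [NeZero N] in
/-- Garnir-type elements lie in the ideal of more dominant shapes. -/
lemma Gen_mem_span {lam : YoungDiagram} (hN : lam.card ≤ N) {x : A} (hx : x ∈ Gen T lam) :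
    x ∈ Submodule.span S {y | ∃ (tau : YoungDiagram) (u w : Equiv.Perm (Fin N)),
      tau.card = lam.card ∧ Dominates tau lam ∧ tau ≠ lam ∧ u ∈ PData.HN N lam.card ∧
      w ∈ PData.HN N lam.card ∧ y = T u * X T (rl N tau) (rl N tau) * T w} := by
  obtain ⟨p, r, h, hp, hr, hh, rfl⟩ := hx
  rw [sum_X_upd]
  refine Submodule.sum_mem _ fun Z hZ => ?_
  obtain ⟨hZ1, hZ2⟩ := Finset.mem_powersetCard.1 hZ
  by_cases hw : ∃ w : Equiv.Perm (Fin N), upd (rl N lam) Z p ∘ w = h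
  swap
  · rw [X_eq_zero T fun w hw' => hw ⟨w, hw'⟩]
    exact Submodule.zero_mem _
  obtain ⟨w, hw⟩ := hw
  set g := upd (rl N lam) Z p with hg
  have hrl : r ≤ lam.rowLen (p + 1) := by
    rw [← card_fib_rl hN (by omega), ← hZ2]
    exact Finset.card_le_card hZ1
  have hp1 : p + 1 < lam.card := by
    by_contra hc
    have := rowLen_eq_zero (lam := lam) (i := p + 1) (by omega)
    omega
  have hgl : ∀ {b : Fin N} {j : ℕ}, lam.card ≤ j → (g b = j ↔ rl N lam b = j) := by
    intro b j hj
    rw [hg, upd_apply]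
    split_ifs with hb
    · have := mem_fib.1 (hZ1 hb)
      constructor <;> intro <;> omega
    · rfl
  obtain ⟨tau, π, hπ1, hπ2, hπ3, hπ4⟩ := exists_sorted lam.card
    (fun i => lam.rowLen i + (if i = p then r else 0) - if i = p + 1 then r else 0) (by
      intro i hi
      rw [rowLen_eq_zero hi, if_neg (by omega)]
      omega)
  simp only [sum_range_moved hrl] at hπ3 hπ4
  rw [if_neg (by omega), psum_eq_card le_rfl, add_zero] at hπ3
  have hπlt : ∀ i, i < lam.card → π i < lam.card := fun i hi => by
    by_contra hc
    have := π.injective (hπ1 (π i) (by omega))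
    omega
  have hcont : ∀ q, (fib g q).card = (fib (π ∘ rl N tau) q).card := fun q => by
    obtain ⟨i, rfl⟩ := π.surjective q
    have e1 : fib (π ∘ rl N tau) (π i) = fib (rl N tau) i := by
      ext a
      simp
    rw [e1]
    by_cases hi : i < lam.card
    · rw [card_fib_rl (by omega) (by omega), hπ2, hg, card_fib_moved (by omega) hZ1, hZ2,
        card_fib_rl hN (hπlt i hi).le]
    · rw [hπ1 i (by omega)]
      congr 1
      ext a
      rw [mem_fib, mem_fib, hgl (by omega), rl_eq_iff_of_ge (by omega),
        rl_eq_iff_of_ge (by omega), hπ3]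
  obtain ⟨u, hu⟩ := exists_perm_of_card_fib hcont
  have hu' : u ∈ PData.HN N lam.card := PData.mem_HN.2 fun a ha => by
    have h1 : π (rl N tau (u a)) = g a := congrFun hu a
    rw [(hgl (b := a) (j := a.val + 1) (by omega)).2 (lab_rl lam a ha),
      ← hπ1 (a.val + 1) (by omega)] at h1
    have h2 := (rl_eq_iff_of_ge (by omega)).1 (π.injective h1)
    exact Fin.ext (by omega)
  have hw' : w ∈ PData.HN N lam.card := PData.mem_HN.2 fun a ha => by
    have h1 : g (w a) = h a := congrFun hw a
    rw [hh a ha, hgl (by omega), rl_eq_iff_of_ge (by omega)] at h1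
    exact Fin.ext (by omega)
  refine Submodule.subset_span ⟨tau, u⁻¹, u * w, hπ3, fun k => ?_, ?_, inv_mem hu',
    mul_mem hu' hw', ?_⟩
  · exact (Nat.le_add_right _ _).trans (hπ4 k)
  · rintro rfl
    have := hπ4 (p + 1)
    rw [if_pos rfl] at this
    omega
  · rw [T_mul_X, X_mul_T, ← hw, ← hu, Function.comp_assoc, Function.comp_assoc,
      X_relabel T π.injective]
    rfl

/-- The cycle `k ↦ k + 1` on `[a, b]`, where points are numbered from `1`. -/
def asc (N a b : ℕ) : Equiv.Perm (Fin N) := ((List.range (b - a)).map fun k => swN N (a + k)).prod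

omit [NeZero N] in
lemma asc_self (a : ℕ) : asc N a a = 1 := by simp [asc]

omit [NeZero N] in
lemma asc_succ {a b : ℕ} (h : a ≤ b) : asc N a (b + 1) = asc N a b * swN N b := by
  unfold asc
  rw [show b + 1 - a = b - a + 1 by omega, List.range_succ]
  simp [show a + (b - a) = b by omega]

omit [NeZero N] in
lemma asc_mul_asc {a b k : ℕ} (h : a ≤ b) (h' : b ≤ k) :
    asc N a b * asc N b k = asc N a k := by
  induction k, h' using Nat.le_induction with
  | base => rw [asc_self, mul_one]
  | succ k hk ih => rw [asc_succ hk, asc_succ (h.trans hk), ← mul_assoc, ih]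

omit [NeZero N] in
lemma asc_apply {a b : ℕ} (ha : 1 ≤ a) (h : a ≤ b) (hb : b ≤ N) (x : Fin N) :
    (asc N a b x).val = if a ≤ x.val + 1 ∧ x.val + 1 < b then x.val + 1
      else if x.val + 1 = b then a - 1 else x.val := by
  induction b, h using Nat.le_induction generalizing x with
  | base =>
    rw [asc_self, Equiv.Perm.one_apply]
    split_ifs <;> omega
  | succ b hab ih =>
    rw [asc_succ hab, Equiv.Perm.mul_apply, ih (by omega)]
    have hs : (swN N b x).val
        = if x.val = b - 1 then b else if x.val = b then b - 1 else x.val := by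
      rw [swN, dif_pos (by omega), Equiv.swap_apply_def]
      simp only [Fin.ext_iff]
      split_ifs <;> rfl
    rw [hs]
    split_ifs <;> omega

/-- The cycle moving the point `n` to `y`. -/
def cyc (n : ℕ) (y : Fin N) : Equiv.Perm (Fin N) := asc N (y.val + 1) (n + 1)

lemma cyc_pt {n : ℕ} (hn : n < N) {y : Fin N} (hy : y.val ≤ n) : cyc n y (pt N n) = y := by
  refine Fin.ext ?_
  rw [cyc, asc_apply (by omega) (by omega) (by omega), pt_val hn]
  split_ifs <;> omega

omit [NeZero N] in
lemma rl_box_le {lam nu : YoungDiagram} {j : ℕ} (hb : Box lam nu j) {y : Fin N}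
    (hy : rl N nu y = j) : y.val ≤ lam.card := by
  have := hb.row_le
  have h1 := hb.card
  have h2 := (rl_eq_iff (by omega)).1 hy
  have := psum_le_card nu (j + 1)
  omega

lemma rl_comp_cyc {lam nu : YoungDiagram} {j : ℕ} (hb : Box lam nu j) (hn : lam.card < N)
    {y : Fin N} (hy : rl N nu y = j) :
    rl N nu ∘ cyc lam.card y = upd (rl N lam) {pt N lam.card} j := by
  have hjc := hb.row_le
  have hc := hb.card
  have hyn := rl_box_le hb hy
  have hy2 := (rl_eq_iff (by omega)).1 hy
  have p1 := psum_box hb j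
  have p2 := psum_box hb (j + 1)
  rw [if_neg (by omega)] at p1
  rw [if_pos (by omega)] at p2
  ext x
  simp only [upd_apply, Function.comp_apply, Finset.mem_singleton]
  split_ifs with hx
  · rw [hx, cyc_pt hn hyn, hy]
  have hxn : x.val ≠ lam.card := fun h => hx (Fin.ext (by rw [pt_val hn, h]))
  have hv : (cyc lam.card y x).val = _ := asc_apply (by omega) (by omega) (by omega) x
  by_cases hxl : x.val < lam.card
  · obtain ⟨i, hi, h1, h2⟩ := exists_row hxl
    rw [rl_eq_of (j := i) h1 h2]
    have q1 := psum_box hb i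
    have q2 := psum_box hb (i + 1)
    by_cases hxy : x.val < y.val
    · have hij : i ≤ j := by
        by_contra hc
        have := psum_mono lam (show j + 1 ≤ i by omega)
        omega
      rw [if_neg (by omega)] at q1
      refine rl_eq_of ?_ ?_ <;> rw [hv, if_neg (by omega), if_neg (by omega)] <;> omega
    · have hij : j ≤ i := by
        by_contra hc
        have := psum_mono lam (show i + 1 ≤ j by omega)
        omega
      rw [if_pos (by omega)] at q2
      have : psum nu i ≤ psum lam i + 1 := by rw [q1]; split_ifs <;> omega
      refine rl_eq_of ?_ ?_ <;> rw [hv, if_pos (by omega)] <;> omega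
  · rw [if_neg (by omega), if_neg (by omega)] at hv
    rw [Fin.ext hv, lab_rl nu x (by omega), lab_rl lam x (by omega)]

lemma rl_eq_card_add_one {lam : YoungDiagram} (hn : lam.card < N) (b : Fin N) :
    rl N lam b = lam.card + 1 ↔ b = pt N lam.card := by
  rw [rl_eq_iff_of_ge (by omega), Fin.ext_iff, pt_val hn]
  omega

lemma fib_rl_card_add_one {lam : YoungDiagram} (hn : lam.card < N) :
    fib (rl N lam) (lam.card + 1) = {pt N lam.card} := by
  ext b
  simp [rl_eq_card_add_one hn]

/-- Inducing on the left. -/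
lemma sum_T_cyc_mul_X {lam nu : YoungDiagram} {j : ℕ} (hb : Box lam nu j) (hn : lam.card < N)
    {f : Fin N → ℕ} (hf : Lab lam.card f) :
    (∑ y ∈ fib (rl N nu) j, T (cyc lam.card y)) * X T (rl N lam) f
      = X T (rl N nu) (upd f {pt N lam.card} j) := by
  rw [Finset.sum_mul]
  refine sum_T_mul_X T (rl_eq_card_add_one hn) ?_ fun y hy =>
    ⟨cyc_pt hn (rl_box_le hb hy), rl_comp_cyc hb hn hy⟩
  rw [hf _ (pt_val hn).ge, pt_val hn]

lemma sum_T_cyc_mul_self {lam nu : YoungDiagram} {j : ℕ} (hb : Box lam nu j) (hn : lam.card < N)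
    {y : Fin N} (hy : rl N nu y = j) :
    (∑ y ∈ fib (rl N nu) j, T (cyc lam.card y)) * X T (rl N lam) (rl N lam)
      = X T (rl N nu) (rl N nu) * T (cyc lam.card y) := by
  rw [sum_T_cyc_mul_X T hb hn (lab_rl lam), X_mul_T, rl_comp_cyc hb hn hy]

/-- Restricting on the left. -/
lemma T_cyc_inv_mul_X {lam nu : YoungDiagram} {j : ℕ} (hb : Box lam nu j) (hn : lam.card < N)
    {y : Fin N} (hy : rl N nu y = j) (f : Fin N → ℕ) :
    T (cyc lam.card y)⁻¹ * X T (rl N nu) f = X T (upd (rl N lam) {pt N lam.card} j) f := by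
  rw [T_mul_X, rl_comp_cyc hb hn hy]

lemma T_cyc_inv_mul_self {lam nu : YoungDiagram} {j : ℕ} (hb : Box lam nu j) (hn : lam.card < N)
    {y : Fin N} (hy : rl N nu y = j) :
    T (cyc lam.card y)⁻¹ * X T (rl N nu) (rl N nu)
      = X T (rl N lam) (rl N lam) * ∑ y ∈ fib (rl N nu) j, T (cyc lam.card y)⁻¹ := by
  rw [T_cyc_inv_mul_X T hb hn hy, ← sum_X_upd_singleton T _ _ _ _ (fib_rl_card_add_one hn),
    Finset.mul_sum]
  refine Finset.sum_congr rfl fun y hy => ?_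
  rw [mem_fib] at hy
  have h1 : upd (rl N nu) {y} (lam.card + 1) ∘ cyc lam.card y = rl N lam := by
    have := upd_comp_singleton (rl N nu) (pt N lam.card) (lam.card + 1) (cyc lam.card y)
    rw [cyc_pt hn (rl_box_le hb hy), rl_comp_cyc hb hn hy] at this
    rw [this]
    ext b
    simp only [upd_apply, Finset.mem_singleton]
    split_ifs with h
    · exact ((rl_eq_card_add_one hn b).2 h).symm
    · rfl
  rw [X_mul_T]
  congr 1
  conv_rhs => rw [← h1]
  rw [Function.comp_assoc, ← Equiv.Perm.coe_mul, mul_inv_cancel, Equiv.Perm.coe_one,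
    Function.comp_id]

end Sym

end

section

open Tab

section Sym

variable {N : ℕ} [NeZero N] {S : Type} [CommRing S] {A : Type} [Ring A] [Algebra S A]
  (T : Equiv.Perm (Fin N) →* A)

variable (S) in
/-- The labellings of shape `lam` whose last label is at least `j`. -/
def LastGe (n : ℕ) (lam : YoungDiagram) (j : ℕ) : Submodule S A :=
  Submodule.span S {x | ∃ f : Fin N → ℕ, Lab (n + 1) f ∧ j ≤ f (pt N n) ∧ x = X T (rl N lam) f}

lemma Lab.upd {n : ℕ} (hn : n < N) {h : Fin N → ℕ} (hh : Lab (n + 1) h) (j : ℕ) :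
    Lab (n + 1) (upd h {pt N n} j) := fun b hb => by
  rw [upd_apply, if_neg, hh b hb]
  rw [Finset.mem_singleton, Fin.ext_iff, pt_val hn]
  omega

omit [NeZero N] in
lemma Lab.upd_fib {n p q r : ℕ} {h : Fin N → ℕ} (hh : Lab n h) (hp : p ≤ n)
    {Z : Finset (Fin N)} (hZ : Z ∈ (fib h p).powersetCard r) : Lab n (Tab.upd h Z q) :=
  fun b hb => by
    rw [upd_apply, if_neg, hh b hb]
    intro hbZ
    have := mem_fib.1 ((Finset.mem_powersetCard.1 hZ).1 hbZ)
    rw [hh b hb] at this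
    omega

lemma upd_upd_comm {ι : Type} [DecidableEq ι] (h : ι → ℕ) {Z : Finset ι} {z : ι} (hz : z ∉ Z)
    (p j : ℕ) : upd (upd h Z p) {z} j = upd (upd h {z} j) Z p := by
  ext b
  simp only [upd_apply, Finset.mem_singleton]
  split_ifs with h1 h2
  · subst h1; contradiction
  all_goals rfl

lemma upd_upd_self {ι : Type} [DecidableEq ι] (h : ι → ℕ) (z : ι) (p j : ℕ) :
    upd (upd h {z} p) {z} j = upd h {z} j := by
  ext b
  simp only [upd_apply]
  split_ifs <;> rfl

lemma upd_eq_self {ι : Type} [DecidableEq ι] {h : ι → ℕ} {z : ι} {j : ℕ} (hz : h z = j) :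
    upd h {z} j = h := by
  ext b
  simp only [upd_apply, Finset.mem_singleton]
  split_ifs with hb
  · rw [hb, hz]
  · rfl

lemma upd_upd_same {ι : Type} [DecidableEq ι] (h : ι → ℕ) (Z : Finset ι) (z : ι) (p : ℕ) :
    upd (upd h Z p) {z} p = upd h (insert z Z) p := by
  ext b
  simp only [upd_apply, Finset.mem_singleton, Finset.mem_insert]
  split_ifs <;> tauto

/-- Splitting a sum over the `r`-subsets of `insert z F`. -/
lemma sum_powersetCard_insert {ι M : Type} [DecidableEq ι] [AddCommMonoid M] {z : ι}
    {F : Finset ι} (hz : z ∉ F) (r : ℕ) (φ : Finset ι → M) :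
    ∑ Z ∈ (insert z F).powersetCard (r + 1), φ Z
      = ∑ Z ∈ F.powersetCard (r + 1), φ Z + ∑ Z ∈ F.powersetCard r, φ (insert z Z) := by
  rw [Finset.powersetCard_succ_insert hz, Finset.sum_union, Finset.sum_image]
  · intro a ha b hb hab
    have h1 : z ∉ a := fun h => hz ((Finset.mem_powersetCard.1 ha).1 h)
    have h2 : z ∉ b := fun h => hz ((Finset.mem_powersetCard.1 hb).1 h)
    rw [← Finset.erase_insert h1, ← Finset.erase_insert h2, hab]
  · refine Finset.disjoint_left.2 fun a ha hb => ?_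
    obtain ⟨b, _, rfl⟩ := Finset.mem_image.1 hb
    exact hz ((Finset.mem_powersetCard.1 ha).1 (Finset.mem_insert_self _ _))

lemma sum_upd_upd_mem {n : ℕ} (hn : n < N) {lam : YoungDiagram} (hl : lam.card = n + 1)
    {p r j : ℕ} (hp : p < n) (hr : 1 ≤ r) {h : Fin N → ℕ} (hh : Lab n h) :
    ∑ Z ∈ (fib h p).powersetCard r, X T (rl N lam) (upd (upd h Z (p + 1)) {pt N n} j)
      ∈ Submodule.span S (Gen T lam) ⊔ LastGe S T n lam (j + 1) := by
  set z := pt N n with hz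
  have hzp : z ∉ fib h p := by
    rw [mem_fib, hh z (by rw [hz, pt_val hn]), hz, pt_val hn]
    omega
  have hsum : ∀ Z ∈ (fib h p).powersetCard r, X T (rl N lam) (upd (upd h Z (p + 1)) {z} j)
      = X T (rl N lam) (upd (upd h {z} j) Z (p + 1)) := fun Z hZ => by
    rw [upd_upd_comm _ fun hzZ => hzp ((Finset.mem_powersetCard.1 hZ).1 hzZ)]
  rw [Finset.sum_congr rfl hsum]
  have hL : Lab (n + 1) (upd h {z} j) := Lab.upd hn (hh.mono (by omega)) j
  have hgen : ∑ Z ∈ (fib (upd h {z} j) p).powersetCard r,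
      X T (rl N lam) (upd (upd h {z} j) Z (p + 1)) ∈ Submodule.span S (Gen T lam) :=
    Submodule.subset_span ⟨p, r, _, by omega, hr, by rwa [hl], rfl⟩
  by_cases hjp : j = p
  · have hfib : fib (upd h {z} j) p = insert z (fib h p) := by
      ext b
      simp only [mem_fib, upd_apply, Finset.mem_singleton, Finset.mem_insert]
      split_ifs with hb <;> simp [hb, hjp]
    obtain ⟨r, rfl⟩ := Nat.exists_eq_add_of_le' hr
    rw [hfib, sum_powersetCard_insert hzp] at hgen
    rw [← add_sub_cancel_right (∑ Z ∈ (fib h p).powersetCard (r + 1), _)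
      (∑ Z ∈ (fib h p).powersetCard r, X T (rl N lam) (upd (upd h {z} j) (insert z Z) (p + 1)))]
    refine Submodule.sub_mem _ (Submodule.mem_sup_left hgen) (Submodule.mem_sup_right ?_)
    refine Submodule.sum_mem _ fun Z hZ => Submodule.subset_span ⟨_, ?_, ?_, rfl⟩
    · refine hL.upd_fib (p := p) (r := r + 1) (by omega) (Finset.mem_powersetCard.2 ⟨?_, ?_⟩)
      · rw [hfib]
        exact Finset.insert_subset_insert _ (Finset.mem_powersetCard.1 hZ).1
      · rw [Finset.card_insert_of_notMem
          fun h => hzp ((Finset.mem_powersetCard.1 hZ).1 h), (Finset.mem_powersetCard.1 hZ).2]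
    · rw [upd_apply, if_pos (Finset.mem_insert_self _ _), hjp]
  · have hfib : fib (upd h {z} j) p = fib h p := by
      ext b
      simp only [mem_fib, upd_apply, Finset.mem_singleton]
      split_ifs with hb
      · simp only [hjp, false_iff, hb]
        exact fun h => hzp (mem_fib.2 h)
      · rfl
    rw [hfib] at hgen
    exact Submodule.mem_sup_left hgen

omit [NeZero N] in
lemma X_eq_zero_of_card {g f : Fin N → ℕ} {j : ℕ} (h : (fib g j).card ≠ (fib f j).card) :
    X T g f = 0 :=
  X_eq_zero T fun w hw => h (by rw [← hw, card_fib_comp])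

lemma card_fib_upd_singleton {ι : Type} [DecidableEq ι] [Fintype ι] {f : ι → ℕ} {z : ι} {k : ℕ}
    (hk : f z ≠ k) (i : ℕ) : (fib (upd f {z} k) i).card
      = (fib f i).card + (if i = k then 1 else 0) - if i = f z then 1 else 0 := by
  by_cases h1 : i = k
  · subst h1
    have : fib (upd f {z} i) i = insert z (fib f i) := by
      ext b
      simp only [mem_fib, upd_apply, Finset.mem_singleton, Finset.mem_insert]
      split_ifs with hb <;> simp [hb]
    rw [this, Finset.card_insert_of_notMem (by simpa using hk), if_pos rfl, if_neg (Ne.symm hk)]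
    rfl
  · by_cases h2 : i = f z
    · have : fib (upd f {z} k) i = (fib f i).erase z := by
        ext b
        simp only [mem_fib, upd_apply, Finset.mem_singleton, Finset.mem_erase]
        split_ifs with hb <;> simp [hb, Ne.symm h1]
      rw [this, Finset.card_erase_of_mem (by simp [h2]), if_neg h1, if_pos h2]
      rfl
    · have : fib (upd f {z} k) i = fib f i := by
        ext b
        simp only [mem_fib, upd_apply, Finset.mem_singleton]
        split_ifs with hb
        · simp [hb, Ne.symm h1, Ne.symm h2]
        · rfl
      simp [this, h1, h2]

/-- If the row `j` of `lam` has no removable node, the last label can be increased. -/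
lemma X_mem_of_rowLen_eq {n : ℕ} (hn : n < N) {lam : YoungDiagram} (hl : lam.card = n + 1)
    {f : Fin N → ℕ} (hf : Lab (n + 1) f) {j : ℕ} (hj : f (pt N n) = j)
    (hrow : lam.rowLen j = lam.rowLen (j + 1)) :
    X T (rl N lam) f ∈ Submodule.span S (Gen T lam) ⊔ LastGe S T n lam (j + 1) := by
  by_cases hjn : n + 1 ≤ j
  · rw [X_rl_eq_zero T hn hl hf (by omega)]
    exact Submodule.zero_mem _
  by_cases h0 : (fib (rl N lam) j).card = (fib f j).card
  swap
  · rw [X_eq_zero_of_card T h0]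
    exact Submodule.zero_mem _
  by_cases h1 : (fib (rl N lam) (j + 1)).card = (fib f (j + 1)).card
  swap
  · rw [X_eq_zero_of_card T h1]
    exact Submodule.zero_mem _
  rw [card_fib_rl (by omega) (by omega)] at h0 h1
  have hpos : 0 < (fib f j).card := Finset.card_pos.2 ⟨pt N n, mem_fib.2 hj⟩
  have hjn' : j < n := by
    have := le_psum (lam := lam) (r := j + 1) (by omega)
    have := psum_le_card lam (j + 1 + 1)
    omega
  have hc := card_fib_upd_singleton (f := f) (z := pt N n) (k := n + 1) (by omega)
  set f0 := upd f {pt N n} (n + 1) with hf0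
  have hf0L : Lab n f0 := fun b hb => by
    rw [hf0, upd_apply]
    by_cases hbz : b = pt N n
    · rw [if_pos (by simpa using hbz), hbz, pt_val hn]
    · rw [if_neg (by simpa using hbz), hf b]
      have : b.val ≠ n := fun h => hbz (Fin.ext (by rw [h, pt_val hn]))
      omega
  have hlt : (fib f0 j).card < (fib f0 (j + 1)).card := by
    rw [hc, hc, if_neg (by omega), if_pos hj.symm, if_neg (by omega), if_neg (by omega)]
    omega
  have key := mem_span_sum_upd (S := S) (fun f' => X T (rl N lam) (upd f' {pt N n} j)) hlt
  simp only [hf0, upd_upd_self, upd_eq_self hj] at key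
  refine (Submodule.span_le.2 ?_ : _ ≤ _) key
  rintro _ ⟨r, hr, h, hh, rfl⟩
  refine sum_upd_upd_mem T hn hl hjn' hr fun b hb => ?_
  have hb' := hf0L b hb
  rw [hf0] at hb'
  rw [hh b (by omega) (by omega), hb']

/-- The right ideal generated by the Garnir-type elements. -/
def GenH (S : Type) [CommRing S] {A : Type} [Ring A] [Algebra S A]
    (T : Equiv.Perm (Fin N) →* A) (lam : YoungDiagram) : Submodule S A :=
  Submodule.span S {x | ∃ g ∈ Gen T lam, ∃ σ ∈ PData.HN N (lam.card + 1), x = g * T σ}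

omit [NeZero N] in
lemma fib_comp (h : Fin N → ℕ) (p : ℕ) (w : Equiv.Perm (Fin N)) :
    (fib (h ∘ w) p).map w.toEmbedding = fib h p := by
  ext a
  simp only [Finset.mem_map_equiv, mem_fib, Function.comp_apply, Equiv.apply_symm_apply]

omit [NeZero N] in
lemma sum_X_upd_mul_T (g h : Fin N → ℕ) (p q r : ℕ) (w : Equiv.Perm (Fin N)) :
    (∑ Z ∈ (fib h p).powersetCard r, X T g (upd h Z q)) * T w
      = ∑ Z ∈ (fib (h ∘ w) p).powersetCard r, X T g (upd (h ∘ w) Z q) := by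
  rw [← fib_comp h p w, Finset.powersetCard_map, Finset.sum_map, Finset.sum_mul]
  refine Finset.sum_congr rfl fun Z _ => ?_
  rw [X_mul_T]
  exact congrArg _ (upd_comp h Z q w)

/-- Two-sided relabelling of Garnir type for a shape with an extra point of label `j`. -/
lemma sum_X_upd_upd_mem_GenH {lam : YoungDiagram} (hn : lam.card < N) {p r j : ℕ}
    (hp : p < lam.card) (hj : j ≤ lam.card) (hr : 1 ≤ r) {h : Fin N → ℕ}
    (hh : Lab (lam.card + 1) h) :
    ∑ Z ∈ (fib (rl N lam) (p + 1)).powersetCard r,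
      X T (upd (upd (rl N lam) Z p) {pt N lam.card} j) h ∈ GenH S T lam := by
  have h1 : ∀ Z ∈ (fib (rl N lam) (p + 1)).powersetCard r,
      X T (upd (upd (rl N lam) Z p) {pt N lam.card} j) h
        = ∑ y ∈ fib h j, X T (upd (rl N lam) Z p) (upd h {y} (lam.card + 1)) := by
    intro Z hZ
    refine (sum_X_upd_singleton T _ _ _ _ ?_).symm
    rw [← fib_rl_card_add_one hn]
    ext b
    rw [mem_fib, mem_fib, upd_apply]
    split_ifs with hb
    · have := mem_fib.1 ((Finset.mem_powersetCard.1 hZ).1 hb)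
      constructor <;> intro <;> omega
    · rfl
  rw [Finset.sum_congr rfl h1, Finset.sum_comm]
  refine Submodule.sum_mem _ fun y hy => ?_
  rw [← sum_X_upd]
  rw [mem_fib] at hy
  have hyn : y.val < lam.card + 1 := by
    by_contra hc
    have := hh y (by omega)
    omega
  set w := Equiv.swap y (pt N lam.card) with hw
  have hwH : w ∈ PData.HN N (lam.card + 1) := PData.swap_mem_HN hyn (by rw [pt_val hn]; omega)
  refine Submodule.subset_span ⟨_, ⟨p, r, upd h {y} (lam.card + 1) ∘ w, hp, hr, ?_, rfl⟩, w, hwH, ?_⟩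
  · intro b hb
    simp only [Function.comp_apply, upd_apply, Finset.mem_singleton]
    by_cases hbz : b = pt N lam.card
    · rw [hbz, hw, Equiv.swap_apply_right, if_pos rfl, pt_val hn]
    · have hbn : b.val ≠ lam.card := fun h => hbz (Fin.ext (by rw [h, pt_val hn]))
      have hby : b ≠ y := fun h => by rw [h] at hbn hb; omega
      rw [hw, Equiv.swap_apply_of_ne_of_ne hby hbz, if_neg hby, hh b (by omega)]
  · rw [sum_X_upd_mul_T]
    have : w * w = 1 := Equiv.swap_mul_self _ _
    rw [Function.comp_assoc, ← Equiv.Perm.coe_mul, this, Equiv.Perm.coe_one, Function.comp_id]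

/-- The restricted Garnir elements. -/
lemma sum_X_upd_left_mem {lam : YoungDiagram} (hn : lam.card < N) {p r j : ℕ}
    (hp : p < lam.card + 1) (hj : j ≤ lam.card) (hr : 1 ≤ r) {h : Fin N → ℕ}
    (hh : Lab (lam.card + 1) h) :
    ∑ Z ∈ (fib h p).powersetCard r, X T (upd (rl N lam) {pt N lam.card} j) (upd h Z (p + 1))
      ∈ Submodule.span S {x | p + 1 = j ∧ x = X T (upd (rl N lam) {pt N lam.card} p) h}
        ⊔ GenH S T lam := by
  set z := pt N lam.card with hz
  have hzr : rl N lam z = lam.card + 1 := (rl_eq_card_add_one hn z).2 rfl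
  rw [sum_X_upd]
  by_cases hjp : p + 1 = j
  · have hzp : z ∉ fib (rl N lam) (p + 1) := by
      rw [mem_fib, hzr]
      omega
    have hfib : fib (upd (rl N lam) {z} j) (p + 1) = insert z (fib (rl N lam) (p + 1)) := by
      ext b
      simp only [mem_fib, upd_apply, Finset.mem_singleton, Finset.mem_insert]
      split_ifs with hb <;> simp [hb, hjp]
    obtain ⟨r, rfl⟩ := Nat.exists_eq_add_of_le' hr
    rw [hfib, sum_powersetCard_insert hzp]
    refine Submodule.add_mem _ (Submodule.mem_sup_right ?_) ?_
    · rw [Finset.sum_congr rfl fun Z hZ => by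
        rw [← upd_upd_comm (rl N lam) (fun h => hzp ((Finset.mem_powersetCard.1 hZ).1 h)) p j]]
      exact sum_X_upd_upd_mem_GenH T hn (by omega) hj hr hh
    · have hin : ∀ Z ∈ (fib (rl N lam) (p + 1)).powersetCard r,
          X T (upd (upd (rl N lam) {z} j) (insert z Z) p) h
            = X T (upd (upd (rl N lam) Z p) {z} p) h := fun Z _ => by
        rw [upd_upd_same]
        congr 1
        ext b
        simp only [upd_apply, Finset.mem_singleton, Finset.mem_insert]
        split_ifs <;> tauto
      rw [Finset.sum_congr rfl hin]
      rcases Nat.eq_zero_or_pos r with rfl | hr'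
      · refine Submodule.mem_sup_left (Submodule.subset_span ⟨hjp, ?_⟩)
        rw [Finset.powersetCard_zero, Finset.sum_singleton]
        congr 1
      · exact Submodule.mem_sup_right (sum_X_upd_upd_mem_GenH T hn (by omega) (by omega) hr' hh)
  · refine Submodule.mem_sup_right ?_
    have hfib : fib (upd (rl N lam) {z} j) (p + 1) = (fib (rl N lam) (p + 1)).erase z := by
      ext b
      simp only [mem_fib, upd_apply, Finset.mem_singleton, Finset.mem_erase]
      split_ifs with hb
      · simp [hb, Ne.symm hjp]
      · simp [hb]
    by_cases hpn : p = lam.card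
    · rw [hfib, hpn, fib_rl_card_add_one hn, Finset.erase_singleton,
        Finset.powersetCard_eq_empty.2 (by rw [Finset.card_empty]; omega),
        Finset.sum_empty]
      exact Submodule.zero_mem _
    · have hzp : z ∉ fib (rl N lam) (p + 1) := by
        rw [mem_fib, hzr]
        omega
      rw [hfib, Finset.erase_eq_of_notMem hzp]
      rw [Finset.sum_congr rfl fun Z hZ => by
        rw [← upd_upd_comm (rl N lam) (fun h => hzp ((Finset.mem_powersetCard.1 hZ).1 h)) p j]]
      exact sum_X_upd_upd_mem_GenH T hn (by omega) hj hr hh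

/-- If the row `j` of `lam` has no addable node, the extra label can be decreased. -/
lemma X_upd_mem_of_rowLen_eq {lam : YoungDiagram} (hn : lam.card < N) {j : ℕ}
    (hj : j + 1 ≤ lam.card) (hrow : lam.rowLen j = lam.rowLen (j + 1)) {f : Fin N → ℕ}
    (hf : Lab (lam.card + 1) f) :
    X T (upd (rl N lam) {pt N lam.card} (j + 1)) f
      ∈ Submodule.span S {x | ∃ h : Fin N → ℕ, Lab (lam.card + 1) h ∧
          x = X T (upd (rl N lam) {pt N lam.card} j) h} ⊔ GenH S T lam := by
  have hzr : rl N lam (pt N lam.card) = lam.card + 1 := (rl_eq_card_add_one hn _).2 rfl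
  by_cases h0 : (fib (upd (rl N lam) {pt N lam.card} (j + 1)) j).card = (fib f j).card
  swap
  · rw [X_eq_zero_of_card T h0]
    exact Submodule.zero_mem _
  by_cases h1 : (fib (upd (rl N lam) {pt N lam.card} (j + 1)) (j + 1)).card
    = (fib f (j + 1)).card
  swap
  · rw [X_eq_zero_of_card T h1]
    exact Submodule.zero_mem _
  rw [card_fib_upd_singleton (by omega), hzr, card_fib_rl hn.le (by omega)] at h0 h1
  rw [if_neg (by omega), if_neg (by omega)] at h0
  rw [if_pos rfl, if_neg (by omega)] at h1
  refine (Submodule.span_le.2 ?_ : _ ≤ _) (mem_span_sum_upd (S := S)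
    (X T (upd (rl N lam) {pt N lam.card} (j + 1))) (show (fib f j).card < (fib f (j + 1)).card by
      omega))
  rintro _ ⟨r, hr, h, hh, rfl⟩
  have hhL : Lab (lam.card + 1) h := fun b hb => by
    have := hf b hb
    rw [hh b (by omega) (by omega), this]
  have key := sum_X_upd_left_mem (S := S) T hn (p := j) (by omega) hj hr hhL
  refine (sup_le (le_sup_of_le_left (Submodule.span_mono ?_)) le_sup_right :
    _ ≤ _ ⊔ GenH S T lam) key
  rintro _ ⟨_, rfl⟩
  exact ⟨h, hhL, rfl⟩

lemma X_self_eq {lam : YoungDiagram} (hn : lam.card < N) :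
    X T (rl N lam) (rl N lam) = X T (upd (rl N lam) {pt N lam.card} lam.card)
      (upd (rl N lam) {pt N lam.card} lam.card) := by
  have : upd (rl N lam) {pt N lam.card} lam.card
      = Equiv.swap lam.card (lam.card + 1) ∘ rl N lam := by
    ext b
    simp only [upd_apply, Finset.mem_singleton, Function.comp_apply]
    split_ifs with hb
    · rw [(rl_eq_card_add_one hn b).2 hb, Equiv.swap_apply_right]
    · have h1 := mt (rl_eq_card_add_one hn b).1 hb
      have h2 : rl N lam b ≠ lam.card := by
        intro h
        rw [rl_eq_iff_of_ge le_rfl] at h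
        omega
      rw [Equiv.swap_apply_of_ne_of_ne h2 h1]
  rw [this, X_relabel T (Equiv.injective _)]

end Sym

end

section

open Tab

namespace PData

variable {S : Type} [CommRing S] {d : S} {A : Type} [Ring A] [Algebra S A]
  {N : ℕ} [NeZero N] (D : PData S d A (Fin N))

/-- The sum of the row stabiliser. -/
def cS (lam : YoungDiagram) : A := X D.T (rl N lam) (rl N lam)

/-- The products of branching coefficients along paths. -/
inductive DElt : ℕ → YoungDiagram → A → Prop
  | zero : DElt 0 ⊥ 1
  | even_same {k : ℕ} {lam : YoungDiagram} {t : A} (hk : lam.card ≤ k)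
      (ht : DElt (2 * k + 1) lam t) : DElt (2 * (k + 1)) lam (D.e (2 * k + 1) lam.card * t)
  | even_box {k j : ℕ} {mu lam : YoungDiagram} {t : A} (hk : mu.card ≤ k) (hb : Box mu lam j)
      (ht : DElt (2 * k + 1) mu t) :
      DElt (2 * (k + 1)) lam
        (D.T (cyc mu.card (pt N (psum lam (j + 1) - 1))) * D.e (2 * k + 1) mu.card * t)
  | odd_same {k : ℕ} {lam : YoungDiagram} {t : A} (hk : lam.card ≤ k) (ht : DElt (2 * k) lam t) :
      DElt (2 * k + 1) lam (D.e (2 * k) lam.card * t)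
  | odd_box {k j : ℕ} {lam nu : YoungDiagram} {t : A} (hk : nu.card ≤ k) (hb : Box lam nu j)
      (ht : DElt (2 * k) nu t) :
      DElt (2 * k + 1) lam
        ((∑ y ∈ fib (rl N nu) j, D.T (cyc lam.card y)⁻¹) * D.e (2 * k) nu.card * t)

/-- The part of `c_x W` that lies in the ideal of larger labels. -/
def KK (i : ℕ) (lam : YoungDiagram) : Submodule S A :=
  Submodule.span S {x | ∃ g ∈ Gen D.T lam, ∃ y ∈ D.W i, x = g * D.e i lam.card * y} ⊔
    (D.NN i lam.card).map (LinearMap.mulLeft S (D.cS lam))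

/-- The span of the `c_x d_t` together with `KK`. -/
def VV (i : ℕ) (lam : YoungDiagram) : Submodule S A :=
  Submodule.span S {x | ∃ t, D.DElt i lam t ∧ x = D.cS lam * D.e i lam.card * t} ⊔ D.KK i lam

variable {D}

lemma VV_induction {i : ℕ} {lam : YoungDiagram} (u : A) (Y : Submodule S A)
    (hd : ∀ t, D.DElt i lam t → u * (D.cS lam * D.e i lam.card * t) ∈ Y)
    (hg : ∀ g ∈ Gen D.T lam, ∀ y ∈ D.W i, u * (g * D.e i lam.card * y) ∈ Y)
    (hq : ∀ q ∈ D.NN i lam.card, u * (D.cS lam * q) ∈ Y) {v : A} (hv : v ∈ D.VV i lam) :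
    u * v ∈ Y := by
  have : D.VV i lam ≤ Y.comap (LinearMap.mulLeft S u) := by
    refine sup_le (Submodule.span_le.2 ?_) (sup_le (Submodule.span_le.2 ?_)
      (Submodule.map_le_iff_le_comap.2 fun q hq' => hq q hq'))
    · rintro _ ⟨t, ht, rfl⟩
      exact hd t ht
    · rintro _ ⟨g, hg', y, hy, rfl⟩
      exact hg g hg' y hy
  exact this hv

lemma DElt_mem_VV {i : ℕ} {lam : YoungDiagram} {t : A} (ht : D.DElt i lam t) :
    D.cS lam * D.e i lam.card * t ∈ D.VV i lam :=
  Submodule.mem_sup_left (Submodule.subset_span ⟨t, ht, rfl⟩)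

lemma Gen_mem_VV {i : ℕ} {lam : YoungDiagram} {g y : A} (hg : g ∈ Submodule.span S (Gen D.T lam))
    (hy : y ∈ D.W i) : g * D.e i lam.card * y ∈ D.VV i lam := by
  have : Submodule.span S (Gen D.T lam) ≤ (D.VV i lam).comap
      (LinearMap.mulRight S (D.e i lam.card * y)) := by
    refine Submodule.span_le.2 fun g hg => ?_
    refine Submodule.mem_sup_right (Submodule.mem_sup_left (Submodule.subset_span
      ⟨g, hg, y, hy, ?_⟩))
    rw [LinearMap.mulRight_apply, mul_assoc]
  have h := this hg
  rwa [Submodule.mem_comap, LinearMap.mulRight_apply, ← mul_assoc] at h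

lemma NN_mem_VV {i : ℕ} {lam : YoungDiagram} {q : A} (hq : q ∈ D.NN i lam.card) :
    D.cS lam * q ∈ D.VV i lam :=
  Submodule.mem_sup_right (Submodule.mem_sup_right (Submodule.mem_map_of_mem hq))

omit [NeZero N] in
lemma mem_HN_of_comp {lam : YoungDiagram} {n : ℕ} (hn : lam.card ≤ n) {f : Fin N → ℕ}
    (hf : Lab n f) {w : Equiv.Perm (Fin N)} (hw : rl N lam ∘ w = f) : w ∈ HN N n :=
  mem_HN.2 fun a ha => by
    have h := congrFun hw a
    rw [Function.comp_apply, hf a ha, rl_eq_iff_of_ge (by omega)] at h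
    exact Fin.ext (by omega)

omit [NeZero N] in
lemma commute_X_of {lam : YoungDiagram} {n : ℕ} (hn : lam.card ≤ n) {f : Fin N → ℕ}
    (hf : Lab n f) {y : A} (hy : ∀ σ ∈ HN N n, Commute (D.T σ) y) :
    Commute (X D.T (rl N lam) f) y := by
  refine Commute.sum_left _ _ _ fun w hw => hy w ?_
  exact mem_HN_of_comp hn hf (Finset.mem_filter.1 hw).2

omit [NeZero N] in
lemma commute_cS {lam : YoungDiagram} {y : A} (hy : ∀ σ ∈ HN N lam.card, Commute (D.T σ) y) :
    Commute (D.cS lam) y := commute_X_of le_rfl (lab_rl lam) hy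

omit [NeZero N] in
lemma commute_Gen {lam : YoungDiagram} {g y : A} (hg : g ∈ Gen D.T lam)
    (hy : ∀ σ ∈ HN N lam.card, Commute (D.T σ) y) : Commute g y := by
  obtain ⟨p, r, h, hp, hr, hh, rfl⟩ := hg
  exact Commute.sum_left _ _ _ fun Z hZ => commute_X_of le_rfl (hh.upd_fib hp.le hZ) hy

omit [NeZero N] in
lemma X_eq_cS_mul {lam : YoungDiagram} {n : ℕ} (hn : lam.card ≤ n) {f : Fin N → ℕ}
    (hf : Lab n f) :
    X D.T (rl N lam) f = 0 ∨ ∃ σ ∈ HN N n, X D.T (rl N lam) f = D.cS lam * D.T σ := by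
  by_cases hw : ∃ w : Equiv.Perm (Fin N), rl N lam ∘ w = f
  · obtain ⟨w, hw⟩ := hw
    exact Or.inr ⟨w, mem_HN_of_comp hn hf hw, by rw [cS, X_mul_T, hw]⟩
  · exact Or.inl (X_eq_zero _ fun w h => hw ⟨w, h⟩)

omit [NeZero N] in
lemma cyc_mem_HN {n : ℕ} {y : Fin N} (hy : y.val ≤ n) : cyc n y ∈ HN N (n + 1) :=
  mem_HN.2 fun a ha => by
    refine Fin.ext ?_
    rw [cyc, asc_apply (by omega) (by omega) (by omega), if_neg (by omega), if_neg (by omega)]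

lemma rl_pt_psum {lam nu : YoungDiagram} {j : ℕ} (hb : Box lam nu j) (hn : lam.card < N) :
    rl N nu (pt N (psum nu (j + 1) - 1)) = j := by
  have h1 := psum_le_card nu (j + 1)
  have h2 := hb.card
  have h3 := hb j
  rw [if_pos rfl] at h3
  have h4 := psum_succ nu j
  have hv : (pt N (psum nu (j + 1) - 1)).val = psum nu (j + 1) - 1 := pt_val (by omega)
  exact rl_eq_of (by omega) (by omega)

lemma cyc_psum_mem_HN {lam nu : YoungDiagram} {j : ℕ} (hb : Box lam nu j) (hn : lam.card < N) :
    cyc lam.card (pt N (psum nu (j + 1) - 1)) ∈ HN N (lam.card + 1) :=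
  cyc_mem_HN (rl_box_le hb (rl_pt_psum hb hn))

lemma DElt_mem_W {i : ℕ} (hi : (i + 1) / 2 ≤ N) {lam : YoungDiagram} {t : A}
    (ht : D.DElt i lam t) : t ∈ D.W i := by
  induction ht with
  | zero => exact one_mem _
  | @even_same k lam t hk ht ih =>
    exact D.W_mono (show 2 * k + 1 ≤ 2 * (k + 1) by omega)
      (mul_mem (D.e_mem_W (by omega)) (ih (by omega)))
  | @even_box k j mu lam t hk hb ht ih =>
    have hW := D.W_mono (show 2 * k + 1 ≤ 2 * (k + 1) by omega)
    refine mul_mem (mul_mem ?_ (hW (D.e_mem_W (by omega)))) (hW (ih (by omega)))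
    exact D.T_mem_W (by omega) (cyc_psum_mem_HN hb (by omega))
  | @odd_same k lam t hk ht ih =>
    exact D.W_mono (show 2 * k ≤ 2 * k + 1 by omega)
      (mul_mem (D.e_mem_W (by omega)) (ih (by omega)))
  | @odd_box k j lam nu t hk hb ht ih =>
    have hW := D.W_mono (show 2 * k ≤ 2 * k + 1 by omega)
    refine mul_mem (mul_mem ?_ (hW (D.e_mem_W (by omega)))) (hW (ih (by omega)))
    have := hb.card
    refine sum_mem fun y hy => D.T_mem_W (n := lam.card + 1) (by omega) (inv_mem (cyc_mem_HN ?_))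
    exact rl_box_le hb (mem_fib.1 hy)

/-- The property that `VV` contains the right ideal generated by `c_x`. -/
def Good (D : PData S d A (Fin N)) (i : ℕ) : Prop :=
  ∀ lam : YoungDiagram, lam.card ≤ i / 2 → ∀ w ∈ D.W i, D.cS lam * D.e i lam.card * w ∈ D.VV i lam

lemma good_zero : D.Good 0 := by
  intro lam hl w hw
  have hlam : lam = ⊥ := by
    rw [eq_bot_iff]
    exact le_of_rowLen_le fun i => by rw [rowLen_eq_zero (by omega)]; exact Nat.zero_le _
  subst hlam
  have hle : D.W 0 ≤ ⊥ := by
    refine Algebra.adjoin_le ?_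
    rintro x ((⟨σ, hσ, rfl⟩ | ⟨a, ha, rfl⟩) | ⟨a, ha, b, hb, rfl⟩)
    · have : σ = 1 := Equiv.ext fun a => (mem_HN (n := 0)).1 hσ a (Nat.zero_le _)
      rw [this, map_one]
      exact one_mem _
    · simp at ha
    · simp at ha
  obtain ⟨r, rfl⟩ := Algebra.mem_bot.1 (hle hw)
  rw [← Algebra.commutes, ← Algebra.smul_def]
  have := DElt_mem_VV (D := D) DElt.zero
  rw [mul_one] at this
  exact Submodule.smul_mem _ _ this

lemma X_upd_mul_mem_VV {k : ℕ} (hk : k < N) (ih : D.Good (2 * k + 1)) {m : ℕ}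
    {lam : YoungDiagram} (hlm : lam.card = m + 1) (hm : m ≤ k) {j : ℕ} (hj : j ≤ m + 1)
    {f : Fin N → ℕ} (hf : Lab (m + 1) f) (hjf : j ≤ f (pt N m)) {w : A}
    (hw : w ∈ D.W (2 * k + 1)) :
    X D.T (rl N lam) f * D.e (2 * (k + 1)) (m + 1) * (D.e (2 * k + 1) m * w)
      ∈ D.VV (2 * (k + 1)) lam := by
  have hmN : m < N := by omega
  induction hj using Nat.decreasingInduction generalizing f w with
  | self =>
    rw [X_rl_eq_zero D.T hmN hlm hf hjf, zero_mul, zero_mul]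
    exact Submodule.zero_mem _
  | of_succ j hj ihj =>
    have hW := D.W_mono (show 2 * k + 1 ≤ 2 * (k + 1) by omega)
    have hE : D.e (2 * k + 1) m ∈ D.W (2 * k + 1) := D.e_mem_W (by omega)
    have hsup : ∀ y ∈ Submodule.span S (Gen D.T lam) ⊔ LastGe S D.T m lam (j + 1),
        ∀ w ∈ D.W (2 * k + 1),
        y * D.e (2 * (k + 1)) (m + 1) * (D.e (2 * k + 1) m * w) ∈ D.VV (2 * (k + 1)) lam := by
      intro y hy w hw
      have : Submodule.span S (Gen D.T lam) ⊔ LastGe S D.T m lam (j + 1)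
          ≤ (D.VV (2 * (k + 1)) lam).comap (LinearMap.mulRight S
            (D.e (2 * (k + 1)) (m + 1) * (D.e (2 * k + 1) m * w))) := by
        refine sup_le (fun g hg => ?_) (Submodule.span_le.2 ?_)
        · rw [Submodule.mem_comap, LinearMap.mulRight_apply, ← mul_assoc, ← hlm]
          exact Gen_mem_VV hg (hW (mul_mem hE hw))
        · rintro _ ⟨f, hf, hjf, rfl⟩
          rw [SetLike.mem_coe, Submodule.mem_comap, LinearMap.mulRight_apply, ← mul_assoc]
          exact ihj hf hjf hw
      have h := this hy
      rwa [Submodule.mem_comap, LinearMap.mulRight_apply, ← mul_assoc] at h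
    by_cases hjf' : j + 1 ≤ f (pt N m)
    · exact ihj hf hjf' hw
    have hfj : f (pt N m) = j := by omega
    by_cases hrow : lam.rowLen (j + 1) < lam.rowLen j
    swap
    · exact hsup _ (X_mem_of_rowLen_eq D.T hmN hlm hf hfj
        (le_antisymm (by omega) (lam.rowLen_anti _ _ (Nat.le_succ j)))) w hw
    obtain ⟨mu, hb⟩ := exists_box_of_lt hrow
    have hmu : mu.card = m := by
      have := hb.card
      omega
    subst hmu
    have hf0 : Lab mu.card (upd f {pt N mu.card} (mu.card + 1)) := fun b hb => by
      simp only [upd_apply, Finset.mem_singleton]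
      split_ifs with hbz
      · rw [hbz, pt_val hmN]
      · have : b.val ≠ mu.card := fun h => hbz (Fin.ext (by rw [h, pt_val hmN]))
        exact hf b (by omega)
    have hX := sum_T_cyc_mul_X D.T hb hmN hf0
    rw [upd_upd_self, upd_eq_self hfj] at hX
    rw [← hX]
    rcases X_eq_cS_mul (D := D) le_rfl hf0 with h0 | ⟨σ, hσ, h0⟩
    · rw [h0, mul_zero, zero_mul, zero_mul]
      exact Submodule.zero_mem _
    rw [h0]
    set ub := ∑ y ∈ fib (rl N lam) j, D.T (cyc mu.card y) with hub
    set E := D.e (2 * (k + 1)) (mu.card + 1) with hEdef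
    have hTE : ∀ σ ∈ HN N (mu.card + 1), Commute (D.T σ) E := fun σ hσ =>
      D.commute_T_e (by omega) (by omega) hσ
    have hubE : Commute ub E := Commute.sum_left _ _ _ fun y hy =>
      hTE _ (cyc_mem_HN (rl_box_le hb (mem_fib.1 hy)))
    have hcE : Commute (D.cS mu) E := commute_cS fun σ hσ =>
      hTE σ (HN_mono (Nat.le_succ _) hσ)
    have hσE : Commute (D.T σ) E := hTE σ (HN_mono (Nat.le_succ _) hσ)
    have hσE' : Commute (D.T σ) (D.e (2 * k + 1) mu.card) :=
      D.commute_T_e (by omega) (by omega) hσ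
    have hre : ub * (D.cS mu * D.T σ) * E * (D.e (2 * k + 1) mu.card * w)
        = E * ub * (D.cS mu * D.e (2 * k + 1) mu.card * (D.T σ * w)) := by
      have h1 : ub * (D.cS mu * D.T σ) * E = E * ub * D.cS mu * D.T σ := by
        rw [← hubE.eq, mul_assoc ub E, ← hcE.eq]
        simp only [mul_assoc]
        rw [hσE.eq]
      rw [h1]
      simp only [mul_assoc]
      rw [← mul_assoc (D.T σ), hσE'.eq]
      simp only [mul_assoc]
    rw [hre]
    have hlE : Commute (D.cS lam) E := commute_cS fun σ hσ => hTE σ (by rwa [hlm] at hσ)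
    have hy0 := rl_pt_psum (N := N) hb hmN
    have hubc := sum_T_cyc_mul_self D.T hb hmN hy0
    have hcyc := cyc_psum_mem_HN (N := N) hb hmN
    set y0 := pt N (psum lam (j + 1) - 1) with hy0def
    have hubc' : E * (ub * D.cS mu) = D.cS lam * (E * D.T (cyc mu.card y0)) := by
      rw [show ub * D.cS mu = D.cS lam * D.T (cyc mu.card y0) from hubc, ← mul_assoc, ← hlE.eq,
        mul_assoc]
    refine VV_induction (E * ub) _ ?_ ?_ ?_ (ih mu (by omega) _
      (mul_mem (D.T_mem_W (by omega) hσ) hw))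
    · intro t ht
      have := DElt_mem_VV (DElt.even_box hm hb ht)
      convert this using 1
      rw [hlm, ← hEdef, ← hy0def, mul_assoc E, mul_assoc (D.cS mu), ← mul_assoc ub, ← mul_assoc,
        hubc']
      simp only [mul_assoc]
    · intro g hg y hy
      have hgE : Commute g E := commute_Gen hg fun σ hσ => hTE σ (HN_mono (Nat.le_succ _) hσ)
      have h2 : E * ub * (g * D.e (2 * k + 1) mu.card * y)
          = ub * g * E * (D.e (2 * k + 1) mu.card * y) := by
        have h1 : E * ub * g = ub * g * E := by
          rw [← hubE.eq, mul_assoc, ← hgE.eq, mul_assoc]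
        rw [← h1]
        simp only [mul_assoc]
      rw [h2]
      refine hsup _ ?_ y hy
      obtain ⟨p, r, h, hp, hr, hh, rfl⟩ := hg
      rw [Finset.mul_sum, Finset.sum_congr rfl fun Z hZ =>
        sum_T_cyc_mul_X D.T hb hmN (hh.upd_fib hp.le hZ)]
      exact sum_upd_upd_mem D.T hmN hlm hp hr hh
    · intro q hq
      have h2 : E * ub * (D.cS mu * q) = D.cS lam * (D.T (cyc mu.card y0) * (E * q)) := by
        rw [mul_assoc, ← mul_assoc ub, ← mul_assoc, hubc', (hTE _ hcyc).symm.eq]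
        simp only [mul_assoc]
      rw [h2]
      refine NN_mem_VV ?_
      rw [hlm]
      exact D.T_mul_NN (by omega) (by omega) hcyc (D.e_even_mul_NN_pred hk hm hq)

lemma good_even {k : ℕ} (hk : k < N) (ih : D.Good (2 * k + 1)) : D.Good (2 * (k + 1)) := by
  intro lam hl w hw
  have hW := D.W_mono (show 2 * k + 1 ≤ 2 * (k + 1) by omega)
  rw [mul_assoc]
  set Y := (D.VV (2 * (k + 1)) lam).comap (LinearMap.mulLeft S (D.cS lam)) with hY
  have h3 : D.NN (2 * (k + 1)) lam.card ≤ Y := fun q hq => NN_mem_VV hq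
  have hTE : ∀ σ ∈ HN N lam.card, Commute (D.T σ) (D.e (2 * (k + 1)) lam.card) := fun σ hσ =>
    D.commute_T_e (by omega) (by omega) hσ
  have hcE : Commute (D.cS lam) (D.e (2 * (k + 1)) lam.card) := commute_cS hTE
  have h2 : 1 ≤ lam.card → ∀ σ ∈ HN N lam.card, ∀ w ∈ D.W (2 * k + 1),
      D.T σ * (D.e (2 * (k + 1)) lam.card * D.e (2 * k + 1) (lam.card - 1) * w) ∈ Y := by
    intro h1 σ hσ w hw
    obtain ⟨n, hn⟩ := Nat.exists_eq_add_of_le' h1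
    have := X_upd_mul_mem_VV hk ih hn (by omega) (Nat.zero_le _)
      (hn ▸ (lab_rl lam).comp hσ) (Nat.zero_le _) hw
    rw [← X_mul_T, ← hn] at this
    rw [hY, Submodule.mem_comap, LinearMap.mulLeft_apply, hn, Nat.add_sub_cancel, ← hn]
    convert this using 1
    simp only [cS, mul_assoc]
  refine D.even_step hk (by omega) Y ?_ h2 h3 hw
  intro hn w hw
  rw [hY, Submodule.mem_comap, LinearMap.mulLeft_apply]
  have hre : D.cS lam * (D.e (2 * (k + 1)) lam.card * D.e (2 * k + 1) lam.card * w)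
      = D.e (2 * (k + 1)) lam.card * (D.cS lam * D.e (2 * k + 1) lam.card * w) := by
    simp only [← mul_assoc]
    rw [hcE.eq]
  rw [hre]
  refine VV_induction _ _ ?_ ?_ ?_ (ih lam (by omega) w hw)
  · intro t ht
    have := DElt_mem_VV (DElt.even_same hn ht)
    convert this using 1
    simp only [← mul_assoc]
    rw [hcE.eq]
  · intro g hg y hy
    have := Gen_mem_VV (Submodule.subset_span hg)
      (hW (mul_mem (D.e_mem_W (i := 2 * k + 1) (n := lam.card) (by omega)) hy))
    convert this using 1
    simp only [← mul_assoc]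
    rw [(commute_Gen hg hTE).eq]
  · intro q hq
    rw [← mul_assoc, ← hcE.eq, mul_assoc]
    exact D.e_even_mul_NN hk hn Y h2 h3 hq

lemma X_upd_left_mul_mem_VV {k : ℕ} (hk : k < N) (ih : D.Good (2 * k)) {lam : YoungDiagram}
    (hlk : lam.card < k)
    (h1 : ∀ w ∈ D.W (2 * k), D.e (2 * k + 1) lam.card * D.e (2 * k) lam.card * w
      ∈ (D.VV (2 * k + 1) lam).comap (LinearMap.mulLeft S (D.cS lam)))
    {j : ℕ} (hj : j ≤ lam.card) {f : Fin N → ℕ} (hf : Lab (lam.card + 1) f) {w : A}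
    (hw : w ∈ D.W (2 * k)) :
    D.e (2 * k + 1) lam.card * X D.T (upd (rl N lam) {pt N lam.card} j) f *
      (D.e (2 * k) (lam.card + 1) * w) ∈ D.VV (2 * k + 1) lam := by
  have hmN : lam.card < N := by omega
  have hW := D.W_mono (show 2 * k ≤ 2 * k + 1 by omega)
  have hE' : D.e (2 * k) (lam.card + 1) ∈ D.W (2 * k) := D.e_mem_W (by omega)
  set h := D.e (2 * k + 1) lam.card with hdef
  have hTh : ∀ σ ∈ HN N lam.card, Commute (D.T σ) h := fun σ hσ =>
    D.commute_T_e (by omega) (by omega) hσ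
  have hcE : Commute (D.cS lam) h := commute_cS hTh
  have hGenH : ∀ y ∈ GenH S D.T lam, ∀ w ∈ D.W (2 * k),
      h * y * (D.e (2 * k) (lam.card + 1) * w) ∈ D.VV (2 * k + 1) lam := by
    intro y hy w hw
    have : GenH S D.T lam ≤ (D.VV (2 * k + 1) lam).comap ((LinearMap.mulRight S
        (D.e (2 * k) (lam.card + 1) * w)).comp (LinearMap.mulLeft S h)) := by
      refine Submodule.span_le.2 ?_
      rintro _ ⟨g, hg, σ, hσ, rfl⟩
      have := Gen_mem_VV (i := 2 * k + 1) (Submodule.subset_span hg)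
        (mul_mem (D.T_mem_W (by omega) hσ) (hW (mul_mem hE' hw)))
      rw [SetLike.mem_coe, Submodule.mem_comap, LinearMap.comp_apply, LinearMap.mulLeft_apply,
        LinearMap.mulRight_apply]
      convert this using 1
      rw [(commute_Gen hg hTh).eq]
      simp only [mul_assoc]
    exact this hy
  induction j using Nat.strong_induction_on generalizing f w with
  | h j ihj =>
    by_cases hadd : ∀ i, i + 1 = j → lam.rowLen j < lam.rowLen i
    swap
    · push Not at hadd
      obtain ⟨i, rfl, hrow⟩ := hadd
      have hmem := X_upd_mem_of_rowLen_eq D.T hmN hj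
        (le_antisymm hrow (lam.rowLen_anti _ _ (Nat.le_succ i))) hf (S := S)
      refine (sup_le (Submodule.span_le.2 ?_) (fun y hy => hGenH y hy w hw) :
        _ ≤ (D.VV (2 * k + 1) lam).comap ((LinearMap.mulRight S
        (D.e (2 * k) (lam.card + 1) * w)).comp (LinearMap.mulLeft S h))) hmem
      rintro _ ⟨f', hf', rfl⟩
      exact ihj i (Nat.lt_succ_self i) (by omega) hf' hw
    obtain ⟨nu, hb⟩ := exists_box_of_addable hadd
    have hnu := hb.card
    set y0 := pt N (psum nu (j + 1) - 1) with hy0def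
    have hy0 : rl N nu y0 = j := rl_pt_psum hb hmN
    have hcyc : cyc lam.card y0 ∈ HN N (lam.card + 1) := cyc_psum_mem_HN hb hmN
    set E := D.e (2 * k) (lam.card + 1) with hEdef
    have hTE : ∀ σ ∈ HN N (lam.card + 1), Commute (D.T σ) E := fun σ hσ =>
      D.commute_T_e (by omega) (by omega) hσ
    rw [← T_cyc_inv_mul_X D.T hb hmN hy0]
    rcases X_eq_cS_mul (D := D) hnu.le hf with h0 | ⟨σ, hσ, h0⟩
    · rw [h0, mul_zero, mul_zero, zero_mul]
      exact Submodule.zero_mem _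
    rw [h0]
    have hre : h * (D.T (cyc lam.card y0)⁻¹ * (D.cS nu * D.T σ)) * (E * w)
        = h * D.T (cyc lam.card y0)⁻¹ * (D.cS nu * D.e (2 * k) nu.card * (D.T σ * w)) := by
      rw [hnu, ← hEdef]
      simp only [mul_assoc]
      rw [← mul_assoc (D.T σ), (hTE σ hσ).eq]
      simp only [mul_assoc]
    rw [hre]
    have hself := T_cyc_inv_mul_self D.T hb hmN hy0
    set ub := ∑ y ∈ fib (rl N nu) j, D.T (cyc lam.card y)⁻¹ with hub
    have hself' : h * D.T (cyc lam.card y0)⁻¹ * D.cS nu = D.cS lam * (h * ub) := by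
      rw [mul_assoc, show D.T (cyc lam.card y0)⁻¹ * D.cS nu = D.cS lam * ub from hself,
        ← mul_assoc, ← hcE.eq, mul_assoc]
    refine VV_induction (h * D.T (cyc lam.card y0)⁻¹) _ ?_ ?_ ?_ (ih nu (by omega) _
      (mul_mem (D.T_mem_W (by omega) hσ) hw))
    · intro t ht
      have := DElt_mem_VV (DElt.odd_box (by omega) hb ht)
      convert this using 1
      rw [← hub, ← hdef, ← mul_assoc, ← mul_assoc, hself']
      simp only [mul_assoc]
    · rintro _ ⟨p, r, h', hp, hr, hh, rfl⟩ y hy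
      rw [hnu] at hp hh
      have hmem := sum_X_upd_left_mem D.T hmN hp hj hr hh (S := S)
      have hre2 : h * D.T (cyc lam.card y0)⁻¹ *
          ((∑ Z ∈ (fib h' p).powersetCard r, X D.T (rl N nu) (upd h' Z (p + 1))) *
            D.e (2 * k) nu.card * y)
          = h * (∑ Z ∈ (fib h' p).powersetCard r,
              X D.T (upd (rl N lam) {pt N lam.card} j) (upd h' Z (p + 1))) * (E * y) := by
        rw [hnu, ← hEdef, ← Finset.sum_congr rfl fun Z _ =>
          T_cyc_inv_mul_X D.T hb hmN hy0 (upd h' Z (p + 1)), ← Finset.mul_sum]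
        simp only [mul_assoc]
      rw [hre2]
      refine (sup_le (Submodule.span_le.2 ?_) (fun x hx => hGenH x hx y hy) :
        _ ≤ (D.VV (2 * k + 1) lam).comap ((LinearMap.mulRight S (E * y)).comp
          (LinearMap.mulLeft S h))) hmem
      rintro _ ⟨hpj, rfl⟩
      exact ihj p (by omega) (by omega) hh hy
    · intro q hq
      rw [hnu] at hq
      rw [← mul_assoc, hself', mul_assoc, mul_assoc]
      refine D.e_odd_mul_NN_succ hk hlk _ h1 (fun q hq => NN_mem_VV hq) ?_
      rw [hub, Finset.sum_mul]
      refine Submodule.sum_mem _ fun y hy => D.T_mul_NN (by omega) (by omega)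
        (inv_mem (cyc_mem_HN (rl_box_le hb (mem_fib.1 hy)))) hq

lemma good_odd {k : ℕ} (hk : k < N) (ih : D.Good (2 * k)) : D.Good (2 * k + 1) := by
  intro lam hl w hw
  have hlk : lam.card ≤ k := by omega
  have hW := D.W_mono (show 2 * k ≤ 2 * k + 1 by omega)
  have hTh : ∀ σ ∈ HN N lam.card, Commute (D.T σ) (D.e (2 * k + 1) lam.card) := fun σ hσ =>
    D.commute_T_e (by omega) (by omega) hσ
  have hch : Commute (D.cS lam) (D.e (2 * k + 1) lam.card) := commute_cS hTh
  have h3 : D.NN (2 * k + 1) lam.card ≤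
      (D.VV (2 * k + 1) lam).comap (LinearMap.mulLeft S (D.cS lam)) := fun q hq => NN_mem_VV hq
  have h1 : ∀ w ∈ D.W (2 * k), D.e (2 * k + 1) lam.card * D.e (2 * k) lam.card * w
      ∈ (D.VV (2 * k + 1) lam).comap (LinearMap.mulLeft S (D.cS lam)) := by
    intro w hw
    have hre : D.cS lam * (D.e (2 * k + 1) lam.card * D.e (2 * k) lam.card * w)
        = D.e (2 * k + 1) lam.card * (D.cS lam * D.e (2 * k) lam.card * w) := by
      simp only [← mul_assoc]
      rw [hch.eq]
    rw [Submodule.mem_comap, LinearMap.mulLeft_apply, hre]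
    refine VV_induction _ _ ?_ ?_ ?_ (ih lam (by omega) w hw)
    · intro t ht
      have := DElt_mem_VV (DElt.odd_same hlk ht)
      convert this using 1
      simp only [← mul_assoc]
      rw [hch.eq]
    · intro g hg y hy
      have := Gen_mem_VV (Submodule.subset_span hg)
        (hW (mul_mem (D.e_mem_W (i := 2 * k) (n := lam.card) (by omega)) hy))
      convert this using 1
      simp only [← mul_assoc]
      rw [(commute_Gen hg hTh).eq]
    · intro q hq
      rw [← mul_assoc, ← hch.eq, mul_assoc]
      exact NN_mem_VV (D.e_odd_mul_NN hq)
  rw [mul_assoc]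
  refine D.odd_step hk hlk _ h1 ?_ h3 hw
  intro hlt w hw
  have hN : lam.card < N := by omega
  have hself := X_self_eq D.T hN
  have := X_upd_left_mul_mem_VV hk ih hlt h1 le_rfl
    (f := upd (rl N lam) {pt N lam.card} lam.card)
    (((lab_rl lam).mono (Nat.le_succ _)).upd hN _) hw
  rw [← hself] at this
  rw [Submodule.mem_comap, LinearMap.mulLeft_apply]
  convert this using 1
  rw [show X D.T (rl N lam) (rl N lam) = D.cS lam from rfl, ← hch.eq]
  simp only [mul_assoc]

lemma good : ∀ i : ℕ, (i + 1) / 2 ≤ N → D.Good i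
  | 0, _ => good_zero
  | i + 1, hi => by
    have ih := good i (by omega)
    rcases Nat.even_or_odd' i with ⟨k, rfl | rfl⟩
    · exact good_odd (by omega) ih
    · exact good_even (by omega) ih

end PData

end

section

open Tab

namespace Tab

lemma antitone_colRows (n : ℕ) : Antitone fun i : ℕ => if i < n then 1 else 0 := fun a b h => by
  show (if b < n then 1 else 0) ≤ (if a < n then 1 else 0)
  split_ifs <;> omega

/-- The column with `n` boxes. -/
def colD (n : ℕ) : YoungDiagram :=
  ofRows (fun i => if i < n then 1 else 0) (antitone_colRows n) n (fun _ hi => if_neg hi.not_gt)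

lemma card_colD (n : ℕ) : (colD n).card = n := by
  rw [colD, card_ofRows, Finset.sum_congr rfl fun i hi => if_pos (Finset.mem_range.1 hi)]
  simp

lemma psum_colD {n j : ℕ} (hj : j ≤ n) : psum (colD n) j = j := by
  have : ∀ i ∈ Finset.range j, (colD n).rowLen i = 1 := fun i hi => by
    rw [colD, rowLen_ofRows, if_pos]
    have := Finset.mem_range.1 hi
    omega
  rw [psum, Finset.sum_congr rfl this]
  simp

lemma rl_colD_injective (N n : ℕ) : Function.Injective (rl N (colD n)) := by
  have h1 : ∀ a : Fin N, a.val < n → rl N (colD n) a = a.val := fun a ha =>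
    rl_eq_of (by rw [psum_colD ha.le]) (by rw [psum_colD ha]; exact Nat.lt_succ_self _)
  have h2 : ∀ a : Fin N, n ≤ a.val → rl N (colD n) a = a.val + 1 := fun a ha => by
    rw [rl_eq_iff_of_ge (by rw [card_colD]; omega), card_colD]
    exact ⟨ha, rfl⟩
  intro a b hab
  refine Fin.ext ?_
  rcases lt_or_ge a.val n with ha | ha <;> rcases lt_or_ge b.val n with hb | hb
  · rwa [h1 a ha, h1 b hb] at hab
  · rw [h1 a ha, h2 b hb] at hab
    omega
  · rw [h2 a ha, h1 b hb] at hab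
    omega
  · rw [h2 a ha, h2 b hb] at hab
    omega

/-- The order on diagrams of bounded size: smaller size, or equal size and more dominant. -/
def Above (mu lam : YoungDiagram) : Prop :=
  mu.card < lam.card ∨ (mu.card = lam.card ∧ Dominates mu lam ∧ mu ≠ lam)

lemma Above.card_le {mu lam : YoungDiagram} (h : Above mu lam) : mu.card ≤ lam.card :=
  h.elim le_of_lt fun h => h.1.le

lemma Dominates.antisymm {mu lam : YoungDiagram} (h1 : Dominates mu lam) (h2 : Dominates lam mu) :
    mu = lam := by
  have h : ∀ k, psum mu k = psum lam k := fun k => le_antisymm (h2 k) (h1 k)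
  refine ext_rowLen fun i => ?_
  have h3 := h (i + 1)
  rw [psum_succ, psum_succ, h i] at h3
  omega

lemma Above.trans {a b c : YoungDiagram} (h1 : Above a b) (h2 : Above b c) : Above a c := by
  rcases h1 with h1 | ⟨h1, h1', h1''⟩ <;> rcases h2 with h2 | ⟨h2, h2', h2''⟩
  · exact Or.inl (h1.trans h2)
  · exact Or.inl (by omega)
  · exact Or.inl (by omega)
  · refine Or.inr ⟨h1.trans h2, fun k => (h2' k).trans (h1' k), ?_⟩
    rintro rfl
    exact h1'' (Dominates.antisymm h1' h2')

lemma Above.irrefl (a : YoungDiagram) : ¬ Above a a := by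
  rintro (h | ⟨_, _, h⟩)
  · exact lt_irrefl _ h
  · exact h rfl

lemma snd_lt_card {lam : YoungDiagram} {c : ℕ × ℕ} (hc : c ∈ lam.cells) : c.2 < lam.card := by
  have h1 : c.1 < lam.card := fst_lt_card hc
  have h2 : c.2 < lam.rowLen c.1 := YoungDiagram.mem_iff_lt_rowLen.1 hc
  have h3 := psum_succ lam c.1
  have h4 := psum_le_card lam (c.1 + 1)
  omega

lemma finite_card_le (L : ℕ) : Finite {lam : YoungDiagram // lam.card ≤ L} := by
  refine Finite.of_injective (β := (Finset.range L ×ˢ Finset.range L).powerset)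
    (fun lam => ⟨lam.1.cells, Finset.mem_powerset.2 fun c hc => ?_⟩) fun a b h => ?_
  · have h1 := fst_lt_card hc
    have h2 := snd_lt_card hc
    have h3 := lam.2
    exact Finset.mem_product.2 ⟨Finset.mem_range.2 (by omega), Finset.mem_range.2 (by omega)⟩
  · exact Subtype.ext (YoungDiagram.ext (congrArg Subtype.val h))

lemma above_induction {L : ℕ} {p : YoungDiagram → Prop}
    (h : ∀ lam, lam.card ≤ L → (∀ mu, Above mu lam → p mu) → p lam) {lam : YoungDiagram}
    (hl : lam.card ≤ L) : p lam := by
  have := finite_card_le L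
  let r : {lam : YoungDiagram // lam.card ≤ L} → {lam : YoungDiagram // lam.card ≤ L} → Prop :=
    fun a b => Above a.1 b.1
  have : IsTrans _ r := ⟨fun _ _ _ => Above.trans⟩
  have : Std.Irrefl r := ⟨fun a => Above.irrefl a.1⟩
  have key : ∀ a : {lam : YoungDiagram // lam.card ≤ L}, p a.1 := fun a =>
    (Finite.wellFounded_of_trans_of_irrefl r).induction a fun a ih =>
      h a.1 a.2 fun mu hmu => ih ⟨mu, hmu.card_le.trans a.2⟩ hmu
  exact key ⟨lam, hl⟩

end Tab

namespace PData

variable {S : Type} [CommRing S] {d : S} {A : Type} [Ring A] [Algebra S A]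
  {N : ℕ} [NeZero N] (D : PData S d A (Fin N))

variable {D} in
omit [NeZero N] in
lemma sum_T_inv_eq_cS (lam : YoungDiagram) :
    ∑ w ∈ Finset.univ.filter (fun w : Equiv.Perm (Fin N) => rl N lam ∘ w = rl N lam), D.T w⁻¹ =
      D.cS lam := by
  unfold PData.cS X
  refine Finset.sum_equiv (Equiv.inv _) (fun w => ?_) fun w _ => rfl
  simp only [Finset.mem_filter, Finset.mem_univ, true_and, Equiv.inv_apply]
  constructor
  · intro h
    rw [← h, Function.comp_assoc, h]
    ext a
    simp
  · intro h
    rw [← h, Function.comp_assoc, h]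
    ext a
    simp

/-- The involution fixing the standard generators. -/
structure IsStar (st : A →ₗ[S] A) : Prop where
  mul : ∀ x y, st (x * y) = st y * st x
  invol : ∀ x, st (st x) = x
  T : ∀ σ, st (D.T σ) = D.T σ⁻¹
  P : ∀ a, st (D.P a) = D.P a
  M : ∀ a b, st (D.M a b) = D.M a b

/-- The elements `c_x`. -/
def cE (i : ℕ) (lam : YoungDiagram) : A := D.cS lam * D.e i lam.card

/-- The span of the two-sided multiples of the `c_x` with larger label. -/
def JJ (i : ℕ) (lam : YoungDiagram) : Submodule S A :=
  Submodule.span S {x | ∃ mu, Above mu lam ∧ ∃ u ∈ D.W i, ∃ w ∈ D.W i, x = u * D.cE i mu * w}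

variable {D}

lemma commute_cS_e {i : ℕ} (hi : (i + 1) / 2 ≤ N) {lam : YoungDiagram} (hl : lam.card ≤ i / 2) :
    Commute (D.cS lam) (D.e i lam.card) :=
  commute_cS fun _ hσ => D.commute_T_e hi hl hσ

omit [NeZero N] in
lemma cS_mem_W {i : ℕ} {lam : YoungDiagram} (hl : lam.card ≤ i / 2) : D.cS lam ∈ D.W i :=
  sum_mem fun _ hw => D.T_mem_W hl (mem_HN_of_comp le_rfl (lab_rl lam) (Finset.mem_filter.1 hw).2)

lemma cE_mem_W {i : ℕ} (hi : (i + 1) / 2 ≤ N) {lam : YoungDiagram} (hl : lam.card ≤ i / 2) :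
    D.cE i lam ∈ D.W i := mul_mem (cS_mem_W hl) (D.e_mem_W hi)

omit [NeZero N] in
lemma cS_colD (n : ℕ) : D.cS (colD n) = 1 := by
  rw [cS, X, Finset.sum_eq_single_of_mem 1, map_one]
  · simp
  · intro w hw hne
    refine absurd (Equiv.ext fun a => rl_colD_injective N n ?_) hne
    exact congrFun (Finset.mem_filter.1 hw).2 a

lemma mul_JJ_mul {i : ℕ} {lam : YoungDiagram} {u x w : A} (hu : u ∈ D.W i)
    (hx : x ∈ D.JJ i lam) (hw : w ∈ D.W i) : u * x * w ∈ D.JJ i lam := by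
  refine (Submodule.span_le.2 ?_ : _ ≤ (D.JJ i lam).comap
    ((LinearMap.mulRight S w).comp (LinearMap.mulLeft S u))) hx
  rintro _ ⟨mu, hmu, u', hu', w', hw', rfl⟩
  refine Submodule.subset_span ⟨mu, hmu, u * u', mul_mem hu hu', w' * w, mul_mem hw' hw, ?_⟩
  simp only [LinearMap.comp_apply, LinearMap.mulLeft_apply, LinearMap.mulRight_apply, mul_assoc]

lemma KK_le_JJ {i : ℕ} (hi : (i + 1) / 2 ≤ N) {lam : YoungDiagram} (hl : lam.card ≤ i / 2) :
    D.KK i lam ≤ D.JJ i lam := by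
  refine sup_le (Submodule.span_le.2 ?_) (Submodule.map_le_iff_le_comap.2 fun q hq => ?_)
  · rintro _ ⟨g, hg, y, hy, rfl⟩
    have hg' := Gen_mem_span (S := S) D.T (by omega) hg
    rw [mul_assoc]
    refine (Submodule.span_le.2 ?_ : _ ≤ (D.JJ i lam).comap
      (LinearMap.mulRight S (D.e i lam.card * y))) hg'
    rintro _ ⟨tau, u, w, htc, hdom, hne, hu, hw, rfl⟩
    refine Submodule.subset_span ⟨tau, Or.inr ⟨htc, hdom, hne⟩, D.T u, D.T_mem_W hl hu,
      D.T w * y, mul_mem (D.T_mem_W hl hw) hy, ?_⟩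
    rw [LinearMap.mulRight_apply, cE, htc, mul_assoc _ (D.T w), ← mul_assoc (D.T w),
      (D.commute_T_e hi hl hw).eq]
    simp only [mul_assoc]
    rfl
  · rw [Submodule.mem_comap, LinearMap.mulLeft_apply]
    rcases Nat.eq_zero_or_pos lam.card with h0 | h0
    · have : D.NN i lam.card ≤ ⊥ := by
        refine Submodule.span_le.2 ?_
        rintro _ ⟨g, (⟨a, ha, _⟩ | ⟨a, b, ha, _⟩), _⟩ <;> omega
      rw [(Submodule.mem_bot S).1 (this hq), mul_zero]
      exact Submodule.zero_mem _
    obtain ⟨n, hn⟩ := Nat.exists_eq_add_of_le' h0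
    have hq' := D.NN_le_ideal hi (by omega) (hn ▸ hq)
    refine (Submodule.span_le.2 ?_ : _ ≤ (D.JJ i lam).comap (LinearMap.mulLeft S (D.cS lam))) hq'
    rintro _ ⟨u, hu, w, hw, rfl⟩
    refine Submodule.subset_span ⟨colD n, Or.inl (by rw [card_colD]; omega), D.cS lam * u,
      mul_mem (cS_mem_W hl) hu, w, hw, ?_⟩
    rw [LinearMap.mulLeft_apply, cE, cS_colD, one_mul, card_colD]
    simp only [mul_assoc]

lemma cE_mul_mem {i : ℕ} (hi : (i + 1) / 2 ≤ N) {lam : YoungDiagram} (hl : lam.card ≤ i / 2)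
    {w : A} (hw : w ∈ D.W i) :
    D.cE i lam * w ∈ Submodule.span S {x | ∃ t, D.DElt i lam t ∧ x = D.cE i lam * t}
      ⊔ D.JJ i lam :=
  (sup_le_sup_left (KK_le_JJ hi hl) _ : D.VV i lam ≤ _) (good i hi lam hl w hw)

namespace IsStar

variable {st : A →ₗ[S] A} (hs : D.IsStar st)

include hs

omit [NeZero N] in
lemma one : st 1 = 1 := by
  have := hs.T 1
  rwa [inv_one, map_one] at this

omit [NeZero N] in
lemma PS (U : Finset (Fin N)) : st (D.PS U) = D.PS U := by
  induction U using Finset.induction_on with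
  | empty => rw [PS_empty, hs.one]
  | insert a U ha ih => rw [D.PS_insert ha, hs.mul, ih, hs.P, ← D.PS_insert ha, D.PS_insert' ha]

omit [NeZero N] in
lemma Dst (z : Fin N) (U : Finset (Fin N)) : st (D.Dst z U) = D.Dst z U := by
  induction U using Finset.induction_on with
  | empty => rw [Dst_empty, hs.one]
  | insert a U ha ih =>
    rw [D.Dst_insert ha, hs.mul, ih, hs.M, ← D.Dst_insert ha, D.Dst_insert' ha]

lemma e (i n : ℕ) : st (D.e i n) = D.e i n := by
  unfold PData.e
  split_ifs
  · exact hs.PS _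
  · exact hs.Dst _ _

omit [NeZero N] in
lemma cS (lam : YoungDiagram) : st (D.cS lam) = D.cS lam := by
  conv_lhs => rw [← sum_T_inv_eq_cS, map_sum]
  exact Finset.sum_congr rfl fun w _ => by rw [hs.T, inv_inv]

lemma cE {i : ℕ} (hi : (i + 1) / 2 ≤ N) {lam : YoungDiagram} (hl : lam.card ≤ i / 2) :
    st (D.cE i lam) = D.cE i lam := by
  unfold PData.cE
  rw [hs.mul, hs.e, hs.cS, (commute_cS_e hi hl).eq]

omit [NeZero N] in
lemma mem_W {i : ℕ} {x : A} (hx : x ∈ D.W i) : st x ∈ D.W i := by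
  induction hx using Algebra.adjoin_induction with
  | mem x hx =>
    rcases hx with (⟨σ, hσ, rfl⟩ | ⟨a, ha, rfl⟩) | ⟨a, ha, b, hb, rfl⟩
    · rw [hs.T]
      exact T_mem_Alg (inv_mem hσ)
    · rw [hs.P]
      exact P_mem_Alg ha
    · rw [hs.M]
      exact M_mem_Alg ha hb
  | algebraMap r =>
    rw [Algebra.algebraMap_eq_smul_one, map_smul, hs.one]
    exact Subalgebra.smul_mem _ (one_mem _) r
  | add x y _ _ hx hy =>
    rw [map_add]
    exact add_mem hx hy
  | mul x y _ _ hx hy =>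
    rw [hs.mul]
    exact mul_mem hy hx

lemma mem_JJ {i : ℕ} (hi : (i + 1) / 2 ≤ N) {lam : YoungDiagram} (hl : lam.card ≤ i / 2)
    {x : A} (hx : x ∈ D.JJ i lam) : st x ∈ D.JJ i lam := by
  refine (Submodule.span_le.2 ?_ : _ ≤ (D.JJ i lam).comap st) hx
  rintro _ ⟨mu, hmu, u, hu, w, hw, rfl⟩
  rw [SetLike.mem_coe, Submodule.mem_comap, hs.mul, hs.mul, hs.cE hi (hmu.card_le.trans hl),
    ← mul_assoc]
  exact Submodule.subset_span ⟨mu, hmu, _, hs.mem_W hw, _, hs.mem_W hu, rfl⟩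

/-- The two-sided multiples of `c_x` are combinations of cellular basis elements. -/
lemma mul_cE_mul_mem {i : ℕ} (hi : (i + 1) / 2 ≤ N) {lam : YoungDiagram} (hl : lam.card ≤ i / 2)
    {u w : A} (hu : u ∈ D.W i) (hw : w ∈ D.W i) :
    u * D.cE i lam * w ∈ Submodule.span S {x | ∃ mu, (mu = lam ∨ Above mu lam) ∧
      ∃ s t, D.DElt i mu s ∧ D.DElt i mu t ∧ x = st s * D.cE i mu * t} := by
  revert u w
  refine above_induction (p := fun lam => ∀ {u w : A}, u ∈ D.W i → w ∈ D.W i →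
    u * D.cE i lam * w ∈ Submodule.span S {x | ∃ mu, (mu = lam ∨ Above mu lam) ∧
      ∃ s t, D.DElt i mu s ∧ D.DElt i mu t ∧ x = st s * D.cE i mu * t}) ?_ hl
  clear hl lam
  intro lam hl ih u w hu hw
  set Y := Submodule.span S {x | ∃ mu, (mu = lam ∨ Above mu lam) ∧
      ∃ s t, D.DElt i mu s ∧ D.DElt i mu t ∧ x = st s * D.cE i mu * t} with hY
  have hJ : D.JJ i lam ≤ Y := by
    refine Submodule.span_le.2 ?_
    rintro _ ⟨mu, hmu, u, hu, w, hw, rfl⟩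
    refine Submodule.span_mono ?_ (ih mu hmu hu hw)
    rintro _ ⟨nu, hnu, h⟩
    refine ⟨nu, Or.inr ?_, h⟩
    rcases hnu with rfl | hnu
    · exact hmu
    · exact hnu.trans hmu
  rw [mul_assoc]
  refine (sup_le (Submodule.span_le.2 ?_) (fun x hx => hJ ?_) :
    _ ≤ Y.comap (LinearMap.mulLeft S u)) (cE_mul_mem hi hl hw)
  swap
  · have := mul_JJ_mul hu hx (one_mem _)
    rwa [mul_one] at this
  rintro _ ⟨t, ht, rfl⟩
  have htW := DElt_mem_W hi ht
  have h1 := cE_mul_mem hi hl (hs.mem_W hu)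
  rw [SetLike.mem_coe, Submodule.mem_comap, LinearMap.mulLeft_apply]
  have h2 : u * (D.cE i lam * t) = st (D.cE i lam * st u) * t := by
    rw [hs.mul, hs.invol, hs.cE hi hl, mul_assoc]
  rw [h2]
  refine (sup_le (Submodule.span_le.2 ?_) (fun x hx => hJ ?_) :
    _ ≤ Y.comap ((LinearMap.mulRight S t).comp st)) h1
  · rintro _ ⟨s, hs', rfl⟩
    rw [SetLike.mem_coe, Submodule.mem_comap, LinearMap.comp_apply, LinearMap.mulRight_apply,
      hs.mul, hs.cE hi hl]
    exact Submodule.subset_span ⟨lam, Or.inl rfl, s, t, hs', ht, rfl⟩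
  · have := mul_JJ_mul (one_mem _) (hs.mem_JJ hi hl hx) htW
    rwa [one_mul] at this

lemma JJ_le_span {i : ℕ} (hi : (i + 1) / 2 ≤ N) {lam : YoungDiagram} (hl : lam.card ≤ i / 2) :
    D.JJ i lam ≤ Submodule.span S {x | ∃ mu, Above mu lam ∧
      ∃ s t, D.DElt i mu s ∧ D.DElt i mu t ∧ x = st s * D.cE i mu * t} := by
  refine Submodule.span_le.2 ?_
  rintro _ ⟨mu, hmu, u, hu, w, hw, rfl⟩
  refine Submodule.span_mono ?_ (hs.mul_cE_mul_mem hi (hmu.card_le.trans hl) hu hw)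
  rintro _ ⟨nu, hnu, h⟩
  refine ⟨nu, ?_, h⟩
  rcases hnu with rfl | hnu
  · exact hmu
  · exact hnu.trans hmu

/-- The cellular basis elements span the algebra. -/
theorem span_eq_W {i : ℕ} (hi : (i + 1) / 2 ≤ N) :
    Submodule.span S {x | ∃ mu : YoungDiagram, mu.card ≤ i / 2 ∧
      ∃ s t, D.DElt i mu s ∧ D.DElt i mu t ∧ x = st s * D.cE i mu * t}
      = Subalgebra.toSubmodule (D.W i) := by
  refine le_antisymm (Submodule.span_le.2 ?_) fun w hw => ?_
  · rintro _ ⟨mu, hmu, s, t, hs', ht, rfl⟩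
    show _ ∈ D.W i
    exact mul_mem (mul_mem (hs.mem_W (DElt_mem_W hi hs')) (cE_mem_W hi hmu)) (DElt_mem_W hi ht)
  have h1 : D.cE i (colD (i / 2)) = 1 := by
    have hseg : Seg N (i / 2) (i / 2) = ∅ := by
      ext a
      simp [mem_Seg]
    rw [PData.cE, cS_colD, card_colD, one_mul, PData.e, hseg]
    simp
  have h2 := hs.mul_cE_mul_mem hi (card_colD (i / 2)).le (one_mem _) hw
  rw [h1, one_mul, one_mul] at h2
  refine Submodule.span_mono ?_ h2
  rintro _ ⟨mu, hmu, h⟩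
  refine ⟨mu, ?_, h⟩
  rcases hmu with rfl | hmu
  · exact (card_colD _).le
  · exact hmu.card_le.trans (card_colD _).le

end IsStar

end PData

end

section Inversions

variable {n : ℕ}

lemma swN_of {j : ℕ} (h1 : 1 ≤ j) (h2 : j < n) :
    swN n j = Equiv.swap ⟨j - 1, by omega⟩ ⟨j, h2⟩ := dif_pos ⟨h1, h2⟩

lemma swN_mul_self (j : ℕ) : swN n j * swN n j = 1 := by
  unfold swN
  split_ifs
  · exact Equiv.swap_mul_self _ _
  · exact one_mul 1

lemma invCount_swN_mul {v : Equiv.Perm (Fin n)} {j : ℕ} (h1 : 1 ≤ j) (h2 : j < n)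
    (h : v⁻¹ ⟨j - 1, by omega⟩ < v⁻¹ ⟨j, h2⟩) : invCount (swN n j * v) = invCount v + 1 := by
  rw [swN_of h1 h2]
  set a : Fin n := ⟨j - 1, by omega⟩ with ha
  set b : Fin n := ⟨j, h2⟩ with hb
  have hswap : ∀ x y : Fin n, Equiv.swap a b y < Equiv.swap a b x ↔
      (y < x ∧ ¬ (y = a ∧ x = b)) ∨ (x = a ∧ y = b) := by
    intro x y
    have hav : a.val = j - 1 := rfl
    have hbv : b.val = j := rfl
    clear_value a b
    simp only [Equiv.swap_apply_def, Fin.lt_def, Fin.ext_iff]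
    split_ifs <;> omega
  unfold invCount
  rw [← Finset.card_insert_of_notMem (a := (v⁻¹ a, v⁻¹ b))]
  · congr 1
    ext ⟨x, y⟩
    simp only [Finset.mem_filter, Finset.mem_univ, true_and, Finset.mem_insert, Prod.mk.injEq,
      Equiv.Perm.mul_apply, hswap, Equiv.Perm.eq_inv_iff_eq]
    constructor
    · rintro ⟨hxy, ⟨hlt, -⟩ | ⟨h3, h4⟩⟩
      · exact Or.inr ⟨hxy, hlt⟩
      · exact Or.inl ⟨h3, h4⟩
    · rintro (⟨h3, h4⟩ | ⟨hxy, hlt⟩)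
      · refine ⟨?_, Or.inr ⟨h3, h4⟩⟩
        rwa [← h3, ← h4, Equiv.Perm.inv_def, Equiv.symm_apply_apply, Equiv.symm_apply_apply] at h
      · refine ⟨hxy, Or.inl ⟨hlt, fun ⟨h3, h4⟩ => ?_⟩⟩
        rw [← h3, ← h4, Equiv.Perm.inv_def, Equiv.symm_apply_apply, Equiv.symm_apply_apply] at h
        exact absurd h hxy.asymm
  · simp only [Finset.mem_filter, Equiv.Perm.inv_def, Equiv.apply_symm_apply, not_and, not_lt]
    intro _ _
    simp [ha, hb, Fin.le_def]

lemma exists_descent {v : Equiv.Perm (Fin n)} (hv : v ≠ 1) :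
    ∃ (j : ℕ) (_ : 1 ≤ j) (h2 : j < n), v⁻¹ ⟨j, h2⟩ < v⁻¹ ⟨j - 1, by omega⟩ := by
  by_contra! hno
  apply hv
  obtain _ | n := n
  · exact Subsingleton.elim _ _
  have hmono : StrictMono (v⁻¹ : Equiv.Perm (Fin (n + 1))) := by
    refine Fin.strictMono_iff_lt_succ.2 fun i => lt_of_le_of_ne ?_ ?_
    · exact hno (i.val + 1) (by omega) (by omega)
    · exact fun e => absurd (v⁻¹.injective e) (Fin.castSucc_lt_succ).ne
  have h1 : ⇑(v⁻¹ : Equiv.Perm (Fin (n + 1))) = id :=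
    (hmono.range_inj strictMono_id).1 (by simp)
  rw [← inv_eq_one]
  exact Equiv.ext fun x => congrFun h1 x

/-- A permutation moving only points in `[lo, hi)` is a product of the adjacent transpositions of
that interval. -/
lemma mem_of_swN_mem (G : Submonoid (Equiv.Perm (Fin n))) {lo hi : ℕ}
    (hG : ∀ j, lo < j → j < hi → j < n → swN n j ∈ G) (v : Equiv.Perm (Fin n))
    (hv : ∀ x : Fin n, x.val < lo ∨ hi ≤ x.val → v x = x) : v ∈ G := by
  induction hk : invCount v using Nat.strong_induction_on generalizing v with
  | _ k ih =>
  by_cases h1 : v = 1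
  · exact h1 ▸ one_mem G
  obtain ⟨j, hj1, hj2, hlt⟩ := exists_descent h1
  have hv' : ∀ x : Fin n, x.val < lo ∨ hi ≤ x.val → v⁻¹ x = x := fun x hx =>
    Equiv.Perm.inv_eq_iff_eq.2 (hv x hx).symm
  have hfix : ∀ x : Fin n, lo ≤ (v⁻¹ x).val ∨ (v⁻¹ x).val = x.val := fun x => by
    by_contra! hx
    have := hv (v⁻¹ x) (Or.inl hx.1)
    rw [Equiv.Perm.inv_def, Equiv.apply_symm_apply] at this
    exact hx.2 (congrArg Fin.val this).symm
  have hfix' : ∀ x : Fin n, (v⁻¹ x).val < hi ∨ (v⁻¹ x).val = x.val := fun x => by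
    by_contra! hx
    have := hv (v⁻¹ x) (Or.inr hx.1)
    rw [Equiv.Perm.inv_def, Equiv.apply_symm_apply] at this
    exact hx.2 (congrArg Fin.val this).symm
  have hlo : lo < j := by
    by_contra hc
    have h3 := hv' ⟨j - 1, by omega⟩ (Or.inl (by simp only []; omega))
    have h4 := hfix ⟨j, hj2⟩
    rw [h3, Fin.lt_def] at hlt
    simp only [] at hlt h4
    omega
  have hhi : j < hi := by
    by_contra hc
    have h3 := hv' ⟨j, hj2⟩ (Or.inr (by simp only []; omega))
    have h4 := hfix' ⟨j - 1, by omega⟩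
    rw [h3, Fin.lt_def] at hlt
    simp only [] at hlt h4
    omega
  have hs := hG j hlo hhi hj2
  have hcount : invCount v = invCount (swN n j * v) + 1 := by
    rw [← invCount_swN_mul (v := swN n j * v) hj1 hj2, ← mul_assoc, swN_mul_self, one_mul]
    rw [mul_inv_rev, Equiv.Perm.mul_apply, Equiv.Perm.mul_apply, swN_of hj1 hj2, Equiv.swap_inv,
      Equiv.swap_apply_left, Equiv.swap_apply_right]
    exact hlt
  have hrec : swN n j * v ∈ G := by
    refine ih _ (by omega) _ (fun x hx => ?_) rfl
    rw [Equiv.Perm.mul_apply, hv x hx, swN_of hj1 hj2]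
    refine Equiv.swap_apply_of_ne_of_ne ?_ ?_ <;>
    · rintro rfl
      simp only [] at hx
      omega
  have := G.mul_mem hs hrec
  rwa [← mul_assoc, swN_mul_self, one_mul] at this

lemma mem_of_forall_swN (G : Submonoid (Equiv.Perm (Fin n)))
    (hG : ∀ j, 1 ≤ j → j < n → swN n j ∈ G) (v : Equiv.Perm (Fin n)) : v ∈ G :=
  mem_of_swN_mem G (lo := 0) (hi := n) (fun j h _ h' => hG j h h') v fun x hx => by omega

/-- A map given on reduced words by right multiplication by involutions is an antihomomorphism. -/
lemma map_mul_of_reduced {A : Type} [Monoid A] {tw : Equiv.Perm (Fin n) → A} {t : ℕ → A}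
    (ht : ∀ j, 1 ≤ j → j < n → t j * t j = 1) (h1 : tw 1 = 1)
    (h : ∀ (v : Equiv.Perm (Fin n)) (j : ℕ), 1 ≤ j → j < n →
      invCount (swN n j * v) = invCount v + 1 → tw (swN n j * v) = tw v * t j) :
    (∀ v w, tw (w * v) = tw v * tw w) ∧ ∀ j, 1 ≤ j → j < n → tw (swN n j) = t j := by
  have hall : ∀ (v : Equiv.Perm (Fin n)) (j : ℕ), 1 ≤ j → j < n →
      tw (swN n j * v) = tw v * t j := by
    intro v j hj1 hj2
    rcases lt_or_ge (v⁻¹ ⟨j - 1, by omega⟩) (v⁻¹ ⟨j, hj2⟩) with hlt | hge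
    · exact h v j hj1 hj2 (invCount_swN_mul hj1 hj2 hlt)
    · have hlt : v⁻¹ ⟨j, hj2⟩ < v⁻¹ ⟨j - 1, by omega⟩ := by
        refine lt_of_le_of_ne hge fun e => ?_
        have := congrArg Fin.val (v⁻¹.injective e)
        simp only [] at this
        omega
      have hv : tw (swN n j * (swN n j * v)) = tw (swN n j * v) * t j := by
        refine h _ j hj1 hj2 (invCount_swN_mul hj1 hj2 ?_)
        rw [mul_inv_rev, Equiv.Perm.mul_apply, Equiv.Perm.mul_apply, swN_of hj1 hj2,
          Equiv.swap_inv, Equiv.swap_apply_left, Equiv.swap_apply_right]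
        exact hlt
      rw [← mul_assoc, swN_mul_self, one_mul] at hv
      rw [hv, mul_assoc, ht j hj1 hj2, mul_one]
  have hs : ∀ j, 1 ≤ j → j < n → tw (swN n j) = t j := fun j hj1 hj2 => by
    have := hall 1 j hj1 hj2
    rwa [mul_one, h1, one_mul] at this
  refine ⟨fun v w => ?_, hs⟩
  let G : Submonoid (Equiv.Perm (Fin n)) :=
    { carrier := {w | ∀ v, tw (w * v) = tw v * tw w}
      one_mem' := fun v => by rw [h1, one_mul, mul_one]
      mul_mem' := fun {x y} hx hy v => by
        rw [mul_assoc, hx, hy, hx y, mul_assoc] }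
  exact mem_of_forall_swN G (fun j hj1 hj2 v => by rw [hall v j hj1 hj2, hs j hj1 hj2]) w v

lemma exists_perm_pt {k : ℕ} [NeZero n] {f : Fin k → Fin n} (hf : Function.Injective f) :
    k ≤ n ∧ ∃ g : Equiv.Perm (Fin n), ∀ x : Fin k, g (pt n x) = f x := by
  have hk : k ≤ n := by simpa using Fintype.card_le_of_injective f hf
  refine ⟨hk, ?_⟩
  have hinj : Function.Injective fun x : Fin k => pt n x := fun x y e => by
    have := congrArg Fin.val e
    simp only [] at this
    rw [pt_val (by omega), pt_val (by omega)] at this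
    exact Fin.ext this
  have := Equiv.Perm.isMultiplyPretransitive (Fin n) k
  obtain ⟨g, hg⟩ := MulAction.exists_smul_eq (Equiv.Perm (Fin n))
    (⟨_, hinj⟩ : Fin k ↪ Fin n) ⟨f, hf⟩
  exact ⟨g, fun x => DFunLike.congr_fun hg x⟩

end Inversions

namespace PartAlg

variable {R : Type} [CommRing R] {δ : R} {m : ℕ}

lemma rel {x y : FreeAlgebra R (PGen m)} (h : PARel R δ m x y) :
    RingQuot.mkAlgHom R (PARel R δ m) x = RingQuot.mkAlgHom R (PARel R δ m) y :=
  RingQuot.mkAlgHom_rel R h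

lemma paT_of {j : ℕ} (h : 1 ≤ j ∧ j < m) :
    paT R δ m j = RingQuot.mkAlgHom R (PARel R δ m) (FreeAlgebra.ι R (PGen.ts ⟨j, h⟩)) :=
  dif_pos h

lemma paP_of {j : ℕ} (h : 1 ≤ j ∧ j ≤ m) :
    paP R δ m j = RingQuot.mkAlgHom R (PARel R δ m) (FreeAlgebra.ι R (PGen.p ⟨j, h⟩)) :=
  dif_pos h

lemma paPh_of {j : ℕ} (h : 1 ≤ j ∧ j < m) :
    paPh R δ m j = RingQuot.mkAlgHom R (PARel R δ m) (FreeAlgebra.ι R (PGen.ph ⟨j, h⟩)) :=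
  dif_pos h

lemma paT_of_not {j : ℕ} (h : ¬ (1 ≤ j ∧ j < m)) : paT R δ m j = 1 := dif_neg h

lemma paT_sq (j : ℕ) : paT R δ m j * paT R δ m j = 1 := by
  by_cases h : 1 ≤ j ∧ j < m
  · rw [paT_of h]
    simpa using rel (PARel.coxInv (R := R) (δ := δ) (⟨j, h⟩ : {i : ℕ // 1 ≤ i ∧ i < m}))
  · rw [paT_of_not h, one_mul]

lemma paP_sq {j : ℕ} (h : 1 ≤ j ∧ j ≤ m) :
    paP R δ m j * paP R δ m j = δ • paP R δ m j := by
  rw [paP_of h, Algebra.smul_def]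
  simpa using rel (PARel.pIdem (R := R) (δ := δ) (⟨j, h⟩ : {i : ℕ // 1 ≤ i ∧ i ≤ m}))

lemma paPh_sq {j : ℕ} (h : 1 ≤ j ∧ j < m) :
    paPh R δ m j * paPh R δ m j = paPh R δ m j := by
  rw [paPh_of h]
  simpa using rel (PARel.phIdem (R := R) (δ := δ) (⟨j, h⟩ : {i : ℕ // 1 ≤ i ∧ i < m}))

lemma paT_mul_paPh {j : ℕ} (h : 1 ≤ j ∧ j < m) :
    paT R δ m j * paPh R δ m j = paPh R δ m j := by
  rw [paPh_of h, paT_of h]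
  simpa using rel (PARel.tsPhL (R := R) (δ := δ) (m := m) ⟨j, h⟩ ⟨j, h⟩ rfl)

lemma paPh_mul_paT {j : ℕ} (h : 1 ≤ j ∧ j < m) :
    paPh R δ m j * paT R δ m j = paPh R δ m j := by
  rw [paPh_of h, paT_of h]
  simpa using rel (PARel.tsPhR (R := R) (δ := δ) (m := m) ⟨j, h⟩ ⟨j, h⟩ rfl)

lemma paT_mul_paP_paP {j : ℕ} (h : 1 ≤ j ∧ j < m) :
    paT R δ m j * (paP R δ m j * paP R δ m (j + 1)) = paP R δ m j * paP R δ m (j + 1) := by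
  rw [paT_of h, paP_of (j := j) ⟨h.1, h.2.le⟩, paP_of (j := j + 1) ⟨by omega, h.2⟩]
  simpa using rel (PARel.tsPPL (R := R) (δ := δ) (m := m) ⟨j, h⟩ ⟨j, h.1, h.2.le⟩
    ⟨j + 1, by omega, h.2⟩ ⟨rfl, rfl⟩)

lemma paP_comm {i j : ℕ} (hi : 1 ≤ i ∧ i ≤ m) (hj : 1 ≤ j ∧ j ≤ m) :
    Commute (paP R δ m i) (paP R δ m j) := by
  rw [paP_of hi, paP_of hj]
  show _ * _ = _ * _
  simpa using rel (PARel.ppComm (R := R) (δ := δ) (m := m) ⟨i, hi⟩ ⟨j, hj⟩)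

lemma paPh_comm {i j : ℕ} (hi : 1 ≤ i ∧ i < m) (hj : 1 ≤ j ∧ j < m) :
    Commute (paPh R δ m i) (paPh R δ m j) := by
  rw [paPh_of hi, paPh_of hj]
  show _ * _ = _ * _
  simpa using rel (PARel.phphComm (R := R) (δ := δ) (m := m) ⟨i, hi⟩ ⟨j, hj⟩)

lemma paP_paPh_comm {i j : ℕ} (hi : 1 ≤ i ∧ i ≤ m) (hj : 1 ≤ j ∧ j < m)
    (h : i ≠ j ∧ i ≠ j + 1) : Commute (paP R δ m i) (paPh R δ m j) := by
  rw [paP_of hi, paPh_of hj]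
  show _ * _ = _ * _
  simpa using rel (PARel.pPhComm (R := R) (δ := δ) (m := m) ⟨i, hi⟩ ⟨j, hj⟩ h)

lemma paT_paP_comm {i j : ℕ} (hi : 1 ≤ i ∧ i < m) (hj : 1 ≤ j ∧ j ≤ m)
    (h : j ≠ i ∧ j ≠ i + 1) : Commute (paT R δ m i) (paP R δ m j) := by
  rw [paT_of hi, paP_of hj]
  show _ * _ = _ * _
  simpa using rel (PARel.tsPComm (R := R) (δ := δ) (m := m) ⟨i, hi⟩ ⟨j, hj⟩ h)

lemma paT_paPh_comm {i j : ℕ} (hi : 1 ≤ i ∧ i < m) (hj : 1 ≤ j ∧ j < m)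
    (h : j + 1 ≠ i ∧ j ≠ i + 1) : Commute (paT R δ m i) (paPh R δ m j) := by
  rw [paT_of hi, paPh_of hj]
  show _ * _ = _ * _
  simpa using rel (PARel.tsPhComm (R := R) (δ := δ) (m := m) ⟨i, hi⟩ ⟨j, hj⟩ h)

lemma paT_paP_paT {j : ℕ} (h : 1 ≤ j ∧ j < m) :
    paT R δ m j * paP R δ m j * paT R δ m j = paP R δ m (j + 1) := by
  rw [paT_of h, paP_of (j := j) ⟨h.1, h.2.le⟩, paP_of (j := j + 1) ⟨by omega, h.2⟩]
  simpa using rel (PARel.tsPTs (R := R) (δ := δ) (m := m) ⟨j, h⟩ ⟨j, h.1, h.2.le⟩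
    ⟨j + 1, by omega, h.2⟩ ⟨rfl, rfl⟩)

lemma paT_paPh_paT {j : ℕ} (h : 1 ≤ j) (h' : j + 1 < m) :
    paT R δ m (j + 1) * paPh R δ m j * paT R δ m (j + 1) =
      paT R δ m j * paPh R δ m (j + 1) * paT R δ m j := by
  have h1 : 1 ≤ j ∧ j < m := by omega
  have h2 : 1 ≤ j + 1 ∧ j + 1 < m := by omega
  rw [paT_of h1, paT_of h2, paPh_of h1, paPh_of h2]
  simpa using rel (PARel.tsPhTs (R := R) (δ := δ) (m := m) ⟨j + 1, h2⟩ ⟨j, h1⟩ ⟨j, h1⟩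
    ⟨j + 1, h2⟩ ⟨rfl, rfl, rfl⟩)

lemma paPh_paP_paPh {j : ℕ} (h : 1 ≤ j ∧ j < m) :
    paPh R δ m j * paP R δ m j * paPh R δ m j = paPh R δ m j := by
  rw [paPh_of h, paP_of (j := j) ⟨h.1, h.2.le⟩]
  simpa using rel (PARel.phPPh (R := R) (δ := δ) (m := m) ⟨j, h⟩ ⟨j, h.1, h.2.le⟩ (Or.inl rfl))

lemma paP_paPh_paP {j : ℕ} (h : 1 ≤ j ∧ j < m) :
    paP R δ m j * paPh R δ m j * paP R δ m j = paP R δ m j := by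
  rw [paPh_of h, paP_of (j := j) ⟨h.1, h.2.le⟩]
  simpa using rel (PARel.pPhP (R := R) (δ := δ) (m := m) ⟨j, h.1, h.2.le⟩ ⟨j, h⟩ (Or.inl rfl))

/-- A homomorphism extending `s_j ↦ t_{s_j}`. -/
def IsT (T : Equiv.Perm (Fin m) →* PA R δ m) : Prop :=
  ∀ j, 1 ≤ j → j < m → T (swN m j) = paT R δ m j

/-- The element isolating the point `a`. -/
def pP (R : Type) [CommRing R] (δ : R) {m : ℕ} (a : Fin m) : PA R δ m := paP R δ m (a.val + 1)

variable (T : Equiv.Perm (Fin m) →* PA R δ m)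

/-- Conjugation by the image of a permutation. -/
def cj (g : Equiv.Perm (Fin m)) : PA R δ m →* PA R δ m where
  toFun x := T g * x * T g⁻¹
  map_one' := by rw [mul_one, ← map_mul, mul_inv_cancel, map_one]
  map_mul' x y := by
    have h : T g⁻¹ * T g = 1 := by rw [← map_mul, inv_mul_cancel, map_one]
    calc _ = T g * x * 1 * (y * T g⁻¹) := by noncomm_ring
      _ = T g * x * (T g⁻¹ * T g) * (y * T g⁻¹) := by rw [h]
      _ = _ := by noncomm_ring

/-- The element merging `a` and `b`. -/
def pM [NeZero m] (a b : Fin m) : PA R δ m :=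
  if a = b then 1 else
    cj T (Equiv.swap (pt m 0) a * Equiv.swap (pt m 1) (Equiv.swap (pt m 0) a b)) (paPh R δ m 1)

variable {T}

lemma T_mul_eq_cj_mul (g : Equiv.Perm (Fin m)) (x : PA R δ m) : T g * x = cj T g x * T g := by
  show _ = T g * x * T g⁻¹ * T g
  rw [mul_assoc, ← map_mul, inv_mul_cancel, map_one, mul_one]

lemma cj_eq_of_mul {g : Equiv.Perm (Fin m)} {x y : PA R δ m} (h : T g * x = y * T g) :
    cj T g x = y := by
  show T g * x * T g⁻¹ = y
  rw [h, mul_assoc, ← map_mul, mul_inv_cancel, map_one, mul_one]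

lemma cj_mul (g h : Equiv.Perm (Fin m)) (x : PA R δ m) : cj T (g * h) x = cj T g (cj T h x) := by
  show T (g * h) * x * T (g * h)⁻¹ = T g * (T h * x * T h⁻¹) * T g⁻¹
  rw [map_mul, mul_inv_rev, map_mul]
  noncomm_ring

lemma cj_T (g σ : Equiv.Perm (Fin m)) : cj T g (T σ) = T (g * σ * g⁻¹) := by
  show T g * T σ * T g⁻¹ = _
  rw [map_mul, map_mul]

lemma cj_T_swap (g : Equiv.Perm (Fin m)) (a b : Fin m) :
    cj T g (T (Equiv.swap a b)) = T (Equiv.swap (g a) (g b)) := by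
  rw [cj_T, Equiv.swap_apply_apply]

variable [NeZero m]

variable (hT : IsT T)
include hT

lemma T_swap {j : ℕ} (h1 : 1 ≤ j) (h2 : j < m) :
    T (Equiv.swap (pt m (j - 1)) (pt m j)) = paT R δ m j := by
  rw [← hT j h1 h2, swN_of h1 h2]
  congr 2 <;> exact Fin.ext (pt_val (by omega))

omit [NeZero m] in
lemma cj_pP (g : Equiv.Perm (Fin m)) (a : Fin m) : cj T g (pP R δ a) = pP R δ (g a) := by
  let G : Submonoid (Equiv.Perm (Fin m)) :=
    { carrier := {w | ∀ a, cj T w (pP R δ a) = pP R δ (w a)}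
      one_mem' := fun a => cj_eq_of_mul (by rw [map_one, one_mul, mul_one, Equiv.Perm.one_apply])
      mul_mem' := fun {x y} hx hy a => by rw [cj_mul, hy, hx, Equiv.Perm.mul_apply] }
  refine mem_of_forall_swN G (fun j h1 h2 a => cj_eq_of_mul ?_) g a
  rw [hT j h1 h2, swN_of h1 h2]
  unfold pP
  have key := paT_paP_paT (R := R) (δ := δ) (m := m) (j := j) ⟨h1, h2⟩
  by_cases e1 : a = ⟨j - 1, by omega⟩
  · rw [e1, Equiv.swap_apply_left]
    simp only []
    rw [Nat.sub_add_cancel h1, ← key, mul_assoc _ (paT R δ m j) (paT R δ m j), paT_sq, mul_one]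
  by_cases e2 : a = ⟨j, h2⟩
  · rw [e2, Equiv.swap_apply_right]
    simp only []
    rw [Nat.sub_add_cancel h1, ← key, ← mul_assoc, ← mul_assoc, paT_sq, one_mul]
  rw [Equiv.swap_apply_of_ne_of_ne e1 e2]
  simp only [Fin.ext_iff] at e1 e2
  exact (paT_paP_comm ⟨h1, h2⟩ ⟨by omega, a.isLt⟩ (by omega)).eq

omit hT [NeZero m] in
lemma cj_eq_self_iff {g : Equiv.Perm (Fin m)} {x : PA R δ m} : cj T g x = x ↔ Commute (T g) x :=
  ⟨fun h => by
    show T g * x = x * T g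
    rw [T_mul_eq_cj_mul, h], fun h => cj_eq_of_mul h.eq⟩

lemma cj_paPh_one (hm : 1 < m) {g : Equiv.Perm (Fin m)} (h0 : g (pt m 0) = pt m 0)
    (h1 : g (pt m 1) = pt m 1) : cj T g (paPh R δ m 1) = paPh R δ m 1 := by
  let G : Submonoid (Equiv.Perm (Fin m)) :=
    { carrier := {w | Commute (T w) (paPh R δ m 1)}
      one_mem' := by
        show Commute _ _
        rw [map_one]
        exact Commute.one_left _
      mul_mem' := fun {x y} hx hy => by
        show Commute _ _
        rw [map_mul]
        exact Commute.mul_left hx hy }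
  refine cj_eq_self_iff.2 (mem_of_swN_mem G (lo := 2) (hi := m) (fun j hj _ h2 => ?_) g fun x hx => ?_)
  · show Commute _ _
    rw [hT j (by omega) h2]
    exact paT_paPh_comm ⟨by omega, h2⟩ ⟨le_rfl, hm⟩ (by omega)
  · have hx : x.val = 0 ∨ x.val = 1 := by omega
    rcases hx with hx | hx
    · rwa [show x = pt m 0 from Fin.ext (hx.trans (pt_val (by omega)).symm)]
    · rwa [show x = pt m 1 from Fin.ext (hx.trans (pt_val (by omega)).symm)]

omit hT in
lemma pt_zero_ne_pt_one (hm : 1 < m) : pt m 0 ≠ pt m 1 := fun e => by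
  have := congrArg Fin.val e
  rw [pt_val hm, pt_val (by omega)] at this
  omega

lemma pM_eq {a b : Fin m} (hab : a ≠ b) {g : Equiv.Perm (Fin m)} (h0 : g (pt m 0) = a)
    (h1 : g (pt m 1) = b) : pM T a b = cj T g (paPh R δ m 1) := by
  have hm : 1 < m := by
    by_contra hc
    have := a.isLt
    have := b.isLt
    exact hab (Fin.ext (by omega))
  have h01 := pt_zero_ne_pt_one hm
  rw [pM, if_neg hab]
  set τ := Equiv.swap (pt m 0) a * Equiv.swap (pt m 1) (Equiv.swap (pt m 0) a b) with hτ
  have t0 : τ (pt m 0) = a := by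
    rw [hτ, Equiv.Perm.mul_apply, Equiv.swap_apply_of_ne_of_ne h01, Equiv.swap_apply_left]
    intro e
    rw [eq_comm, Equiv.swap_apply_eq_iff, Equiv.swap_apply_left] at e
    exact hab e.symm
  have t1 : τ (pt m 1) = b := by
    rw [hτ, Equiv.Perm.mul_apply, Equiv.swap_apply_left, Equiv.swap_apply_self]
  conv_rhs => rw [show g = τ * (τ⁻¹ * g) by group, cj_mul]
  rw [cj_paPh_one hT hm (g := τ⁻¹ * g)]
  · rw [Equiv.Perm.mul_apply, h0, Equiv.Perm.inv_eq_iff_eq, t0]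
  · rw [Equiv.Perm.mul_apply, h1, Equiv.Perm.inv_eq_iff_eq, t1]

lemma cj_pM (g : Equiv.Perm (Fin m)) (a b : Fin m) : cj T g (pM T a b) = pM T (g a) (g b) := by
  by_cases hab : a = b
  · subst hab
    rw [pM, if_pos rfl, pM, if_pos rfl, map_one]
  have hf : Function.Injective ![a, b] := by
    intro x y
    fin_cases x <;> fin_cases y <;> simp [hab, Ne.symm hab, eq_comm]
  obtain ⟨-, σ, hσ⟩ := exists_perm_pt hf
  rw [pM_eq hT hab (hσ 0) (hσ 1), ← cj_mul]
  symm
  refine pM_eq hT (g.injective.ne hab) ?_ ?_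
  · rw [Equiv.Perm.mul_apply]
    exact congrArg g (hσ 0)
  · rw [Equiv.Perm.mul_apply]
    exact congrArg g (hσ 1)

lemma pM_consecutive {j : ℕ} (h1 : 1 ≤ j) (h2 : j < m) :
    pM T (pt m (j - 1)) (pt m j) = paPh R δ m j := by
  induction j, h1 using Nat.le_induction with
  | base =>
    rw [pM_eq hT (pt_zero_ne_pt_one h2) (g := 1) rfl rfl]
    exact cj_eq_of_mul (by rw [map_one, one_mul, mul_one])
  | succ j h1 ih =>
    have hne : ∀ {x y : ℕ}, x < m → y < m → x ≠ y → pt m x ≠ pt m y := fun hx hy hxy e => hxy (by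
      rw [← pt_val hx, e, pt_val hy])
    have key := paT_paPh_paT (R := R) (δ := δ) (m := m) h1 h2
    have hph : paPh R δ m (j + 1) =
        cj T (Equiv.swap (pt m (j - 1)) (pt m j) * Equiv.swap (pt m j) (pt m (j + 1)))
          (paPh R δ m j) := by
      have ht1 := T_swap hT h1 (by omega)
      have ht2 := T_swap hT (j := j + 1) (by omega) h2
      rw [Nat.add_sub_cancel] at ht2
      show _ = T _ * paPh R δ m j * T _
      rw [map_mul, mul_inv_rev, map_mul, Equiv.swap_inv, Equiv.swap_inv, ht1, ht2]
      calc _ = (paT R δ m j * paT R δ m j) * paPh R δ m (j + 1) *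
          (paT R δ m j * paT R δ m j) := by rw [paT_sq, one_mul, mul_one]
        _ = paT R δ m j * (paT R δ m j * paPh R δ m (j + 1) * paT R δ m j) * paT R δ m j := by
          noncomm_ring
        _ = _ := by
          rw [← key]
          noncomm_ring
    rw [hph, ← ih (by omega), cj_pM hT, Equiv.Perm.mul_apply, Equiv.Perm.mul_apply,
      Equiv.swap_apply_of_ne_of_ne (hne (by omega) (by omega) (by omega))
        (hne (by omega) (by omega) (by omega)), Equiv.swap_apply_left, Equiv.swap_apply_left,
      Equiv.swap_apply_of_ne_of_ne (hne (by omega) (by omega) (by omega))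
        (hne (by omega) (by omega) (by omega)), Nat.add_sub_cancel]

lemma pM_symm (a b : Fin m) : pM T a b = pM T b a := by
  by_cases hab : a = b
  · rw [hab]
  have hf : Function.Injective ![a, b] := by
    intro x y
    fin_cases x <;> fin_cases y <;> simp [hab, Ne.symm hab, eq_comm]
  obtain ⟨hm, σ, hσ⟩ := exists_perm_pt hf
  rw [pM_eq hT hab (hσ 0) (hσ 1),
    pM_eq hT (Ne.symm hab) (g := σ * Equiv.swap (pt m 0) (pt m 1)), cj_mul]
  · have h := T_swap hT (j := 1) le_rfl hm
    rw [Nat.sub_self] at h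
    rw [cj_eq_of_mul (g := Equiv.swap _ _) (y := paPh R δ m 1)]
    rw [h, paT_mul_paPh ⟨le_rfl, hm⟩, paPh_mul_paT ⟨le_rfl, hm⟩]
  · rw [Equiv.Perm.mul_apply, Equiv.swap_apply_left]
    exact hσ 1
  · rw [Equiv.Perm.mul_apply, Equiv.swap_apply_right]
    exact hσ 0

/-- Two distinct points are conjugate to the first two. -/
lemma exists_conj_two {a b : Fin m} (hab : a ≠ b) : 2 ≤ m ∧ ∃ g : Equiv.Perm (Fin m),
    g (pt m 0) = a ∧ g (pt m 1) = b ∧ pM T a b = cj T g (paPh R δ m 1) ∧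
      pP R δ a = cj T g (paP R δ m 1) ∧ pP R δ b = cj T g (paP R δ m 2) ∧
      T (Equiv.swap a b) = cj T g (paT R δ m 1) := by
  have hf : Function.Injective ![a, b] := by
    intro x y
    fin_cases x <;> fin_cases y <;> simp [hab, Ne.symm hab, eq_comm]
  obtain ⟨hm, g, hg⟩ := exists_perm_pt hf
  have g0 : g (pt m 0) = a := hg 0
  have g1 : g (pt m 1) = b := hg 1
  have h := T_swap hT (j := 1) le_rfl hm
  rw [Nat.sub_self] at h
  refine ⟨hm, g, g0, g1, pM_eq hT hab g0 g1, ?_, ?_, ?_⟩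
  · rw [← g0, ← cj_pP hT, pP, pt_val (by omega)]
  · rw [← g1, ← cj_pP hT, pP, pt_val (by omega)]
  · rw [← h, cj_T_swap, g0, g1]

lemma pM_comm_three {a b x : Fin m} (hab : a ≠ b) (hax : a ≠ x) (hbx : b ≠ x) :
    Commute (pM T a b) (pM T b x) ∧ Commute (pP R δ x) (pM T a b) := by
  have hf : Function.Injective ![a, b, x] := by
    intro y z
    fin_cases y <;> fin_cases z <;> simp [hab, hax, hbx, Ne.symm hab, Ne.symm hax, Ne.symm hbx]
  obtain ⟨hm, g, hg⟩ := exists_perm_pt hf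
  have e1 : pM T a b = cj T g (paPh R δ m 1) := pM_eq hT hab (hg 0) (hg 1)
  have e2 : pM T b x = cj T g (paPh R δ m 2) := by
    rw [← pM_consecutive hT (j := 2) (by omega) (by omega), cj_pM hT]
    exact congrArg₂ (pM T) (hg 1).symm (hg 2).symm
  have e3 : pP R δ x = cj T g (paP R δ m 3) := by
    rw [show paP R δ m 3 = pP R δ (pt m 2) by rw [pP, pt_val (by omega)], cj_pP hT]
    exact congrArg (pP R δ) (hg 2).symm
  rw [e1, e2, e3]
  exact ⟨(paPh_comm ⟨le_rfl, by omega⟩ ⟨by omega, by omega⟩).map (cj T g),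
    (paP_paPh_comm ⟨by omega, hm⟩ ⟨le_rfl, by omega⟩ (by omega)).map (cj T g)⟩

lemma pM_comm_four {a b x y : Fin m} (hab : a ≠ b) (hax : a ≠ x) (hay : a ≠ y) (hbx : b ≠ x)
    (hby : b ≠ y) (hxy : x ≠ y) : Commute (pM T a b) (pM T x y) := by
  have hf : Function.Injective ![a, b, x, y] := by
    intro p q
    fin_cases p <;> fin_cases q <;> simp [hab, hax, hbx, hay, hby, hxy, Ne.symm hab, Ne.symm hax,
      Ne.symm hbx, Ne.symm hay, Ne.symm hby, Ne.symm hxy]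
  obtain ⟨hm, g, hg⟩ := exists_perm_pt hf
  have e1 : pM T a b = cj T g (paPh R δ m 1) := pM_eq hT hab (hg 0) (hg 1)
  have e2 : pM T x y = cj T g (paPh R δ m 3) := by
    rw [← pM_consecutive hT (j := 3) (by omega) (by omega), cj_pM hT]
    exact congrArg₂ (pM T) (hg 2).symm (hg 3).symm
  rw [e1, e2]
  exact (paPh_comm ⟨le_rfl, by omega⟩ ⟨by omega, by omega⟩).map (cj T g)

lemma pM_comm (a b x y : Fin m) : Commute (pM T a b) (pM T x y) := by
  have hone : ∀ a : Fin m, pM T a a = 1 := fun a => if_pos rfl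
  have h3 : ∀ {a b x : Fin m}, Commute (pM T a b) (pM T b x) := by
    intro a b x
    by_cases hab : a = b
    · rw [hab, hone]
      exact Commute.one_left _
    by_cases hbx : b = x
    · rw [hbx, hone]
      exact Commute.one_right _
    by_cases hax : a = x
    · rw [hax, pM_symm hT]
    exact (pM_comm_three hT hab hax hbx).1
  by_cases hab : a = b
  · rw [hab, hone]
    exact Commute.one_left _
  by_cases hxy : x = y
  · rw [hxy, hone]
    exact Commute.one_right _
  by_cases hbx : b = x
  · exact hbx ▸ h3
  by_cases hby : b = y
  · rw [pM_symm hT x y]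
    exact hby ▸ h3
  by_cases hax : a = x
  · rw [pM_symm hT a b]
    exact hax ▸ h3
  by_cases hay : a = y
  · rw [pM_symm hT a b, pM_symm hT x y]
    exact hay ▸ h3
  exact pM_comm_four hT hab hax hay hbx hby hxy

lemma T_swap_pM (a b : Fin m) : T (Equiv.swap a b) * pM T a b = pM T a b := by
  by_cases hab : a = b
  · rw [hab, Equiv.swap_self]
    exact (congrArg (· * _) (map_one T)).trans (one_mul _)
  obtain ⟨hm, g, -, -, e1, -, -, e2⟩ := exists_conj_two hT hab
  rw [e1, e2, ← map_mul, paT_mul_paPh ⟨le_rfl, hm⟩]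

lemma pM_idem (a b : Fin m) : pM T a b * pM T a b = pM T a b := by
  by_cases hab : a = b
  · rw [pM, if_pos hab, one_mul]
  obtain ⟨hm, g, -, -, e1, -⟩ := exists_conj_two hT hab
  rw [e1, ← map_mul, paPh_sq ⟨le_rfl, hm⟩]

lemma T_pM (σ : Equiv.Perm (Fin m)) (a b : Fin m) :
    T σ * pM T a b = pM T (σ a) (σ b) * T σ := by
  rw [T_mul_eq_cj_mul, cj_pM hT]

lemma pM_trans (a b x : Fin m) : pM T a b * pM T b x = pM T a b * pM T a x := by
  by_cases hxa : x = a
  · rw [hxa, pM_symm hT b a, pM_idem hT, show pM T a a = 1 from if_pos rfl, mul_one]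
  by_cases hxb : x = b
  · rw [hxb, pM_idem hT, show pM T b b = 1 from if_pos rfl, mul_one]
  have h : pM T a b = pM T a b * T (Equiv.swap a b) := by
    have := T_pM hT (Equiv.swap a b) a b
    rw [Equiv.swap_apply_left, Equiv.swap_apply_right, T_swap_pM hT, pM_symm hT b a] at this
    exact this
  calc pM T a b * pM T b x = pM T a b * (T (Equiv.swap a b) * pM T b x) := by
        rw [← mul_assoc, ← h]
    _ = pM T a b * pM T a x * T (Equiv.swap a b) := by
        rw [T_pM hT, Equiv.swap_apply_right, Equiv.swap_apply_of_ne_of_ne hxa hxb, mul_assoc]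
    _ = pM T a b * pM T a x := by
        rw [(pM_comm hT a b a x).eq, mul_assoc, ← h]

/-- The partition algebra as an algebra with point and block idempotents. -/
def pData : PData R δ (PA R δ m) (Fin m) where
  T := T
  P := pP R δ
  M := pM T
  T_P σ a := by rw [T_mul_eq_cj_mul, cj_pP hT]
  T_M := T_pM hT
  P_comm a b := paP_comm ⟨by omega, a.isLt⟩ ⟨by omega, b.isLt⟩
  P_sq a := paP_sq ⟨by omega, a.isLt⟩
  M_symm := pM_symm hT
  M_self a := if_pos rfl
  M_idem := pM_idem hT
  M_comm := pM_comm hT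
  M_trans := pM_trans hT
  P_M_comm a b x hab hax := by
    by_cases hbx : b = x
    · rw [pM, if_pos hbx]
      exact Commute.one_right _
    · exact (pM_comm_three hT hbx (Ne.symm hab) (Ne.symm hax)).2
  T_swap_M := T_swap_pM hT
  T_swap_P a b hab := by
    obtain ⟨hm, g, -, -, -, e1, e2, e3⟩ := exists_conj_two hT hab
    rw [e1, e2, e3, ← map_mul, ← map_mul, paT_mul_paP_paP ⟨le_rfl, hm⟩]
  PMP a b hab := by
    obtain ⟨hm, g, -, -, e1, e2, -⟩ := exists_conj_two hT hab
    rw [e1, e2, ← map_mul, ← map_mul, paP_paPh_paP ⟨le_rfl, hm⟩]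
  MPM a b hab := by
    obtain ⟨hm, g, -, -, e1, e2, -⟩ := exists_conj_two hT hab
    rw [e1, e2, ← map_mul, ← map_mul, paPh_paP_paPh ⟨le_rfl, hm⟩]
  PMP_swap a b hab := by
    obtain ⟨hm, g, -, -, e1, e2, e3, e4⟩ := exists_conj_two hT hab
    rw [e1, e2, e3, e4, ← map_mul, ← map_mul, ← map_mul]
    have h1 : 1 ≤ 1 ∧ 1 < m := ⟨le_rfl, hm⟩
    congr 1
    rw [← paT_paP_paT h1, mul_assoc _ _ (paPh R δ m 1), paT_mul_paPh h1, mul_assoc, mul_assoc,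
      ← mul_assoc (paP R δ m 1), paP_paPh_paP h1, mul_assoc _ _ (paT R δ m 1), paT_sq, mul_one]

end PartAlg

section

open Tab

namespace PartAlg

variable {R : Type} [CommRing R] {δ : R} {m : ℕ} {T : Equiv.Perm (Fin m) →* PA R δ m} [NeZero m]
  (hT : IsT T)

lemma paT_mem_W {i j : ℕ} (h1 : 1 ≤ j) (h2 : j < i / 2) (hm : (i + 1) / 2 ≤ m) :
    paT R δ m j ∈ (pData hT).W i := by
  rw [← T_swap hT h1 (by omega)]
  refine PData.T_mem_W (pData hT) le_rfl (PData.swap_mem_HN ?_ ?_) <;>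
    rw [pt_val (by omega)] <;> omega

lemma paP_mem_W {i j : ℕ} (h1 : 1 ≤ j) (h2 : j ≤ i / 2) (hm : (i + 1) / 2 ≤ m) :
    paP R δ m j ∈ (pData hT).W i := by
  have h : paP R δ m j = (pData hT).P (pt m (j - 1)) := by
    show _ = paP R δ m _
    rw [pt_val (by omega), Nat.sub_add_cancel h1]
  rw [h]
  refine PData.P_mem_Alg ?_
  rw [mem_Seg, pt_val (by omega)]
  omega

lemma paPh_mem_W {i j : ℕ} (h1 : 1 ≤ j) (h2 : j < (i + 1) / 2) (hm : (i + 1) / 2 ≤ m) :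
    paPh R δ m j ∈ (pData hT).W i := by
  rw [← pM_consecutive hT h1 (by omega)]
  refine PData.M_mem_Alg (D := pData hT) ?_ ?_ <;>
  · rw [mem_Seg, pt_val (by omega)]
    omega

lemma W_eq_top {i : ℕ} (hi : m = i / 2) (ho : (i + 1) / 2 ≤ m) : (pData hT).W i = ⊤ := by
  refine eq_top_iff.2 fun x _ => ?_
  obtain ⟨y, rfl⟩ := RingQuot.mkAlgHom_surjective R (PARel R δ m) x
  induction y using FreeAlgebra.induction with
  | grade0 r =>
    rw [AlgHom.commutes]
    exact Subalgebra.algebraMap_mem _ _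
  | grade1 g =>
    rcases g with ⟨j, h⟩ | ⟨j, h⟩ | ⟨j, h⟩
    · rw [← paT_of h]
      exact paT_mem_W hT h.1 (by omega) ho
    · rw [← paP_of h]
      exact paP_mem_W hT h.1 (by omega) ho
    · rw [← paPh_of h]
      exact paPh_mem_W hT h.1 (by omega) ho
  | mul a b ha hb =>
    rw [map_mul]
    exact mul_mem (ha trivial) (hb trivial)
  | add a b ha hb =>
    rw [map_add]
    exact add_mem (ha trivial) (hb trivial)

lemma W_le {i : ℕ} (hm : (i + 1) / 2 = m) (B : Subalgebra R (PA R δ m))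
    (hB1 : ∀ j, 1 ≤ j → j < i / 2 → paT R δ m j ∈ B)
    (hB2 : ∀ j, 1 ≤ j → j ≤ i / 2 → paP R δ m j ∈ B)
    (hB3 : ∀ j, 1 ≤ j → j < m → paPh R δ m j ∈ B) : (pData hT).W i ≤ B := by
  have hTB : ∀ σ ∈ PData.HN m (i / 2), T σ ∈ B := fun σ hσ => by
    refine mem_of_swN_mem (B.toSubmonoid.comap T) (lo := 0) (hi := i / 2) (fun j h1 h2 h3 => ?_) σ
      fun x hx => PData.mem_HN.1 hσ x (by omega)
    show T _ ∈ B
    rw [hT j h1 h3]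
    exact hB1 j h1 h2
  have hM : ∀ a b : Fin m, a < b → pM T a b ∈ B := fun a b hab => by
    have hb := b.isLt
    have hab' : a.val < b.val := hab
    have hlt : (pt m (b.val - 1)).val = b.val - 1 := pt_val (by omega)
    have hb' : pt m b.val = b := Fin.ext (pt_val hb)
    have key := cj_pM hT (Equiv.swap a (pt m (b.val - 1))) (pt m (b.val - 1)) b
    rw [Equiv.swap_apply_right, Equiv.swap_apply_of_ne_of_ne hab.ne'
      (fun e => by rw [e, hlt] at hab'; rw [← e] at hlt; omega)] at key
    have hmem : Equiv.swap a (pt m (b.val - 1)) ∈ PData.HN m (i / 2) :=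
      PData.swap_mem_HN (by omega) (by omega)
    rw [← key]
    refine mul_mem (mul_mem (hTB _ hmem) ?_) (hTB _ (inv_mem hmem))
    have h := hB3 b.val (by omega) hb
    rwa [← pM_consecutive hT (by omega) hb, hb'] at h
  refine Algebra.adjoin_le ?_
  rintro _ ((⟨σ, hσ, rfl⟩ | ⟨a, ha, rfl⟩) | ⟨a, -, b, -, rfl⟩)
  · exact hTB σ hσ
  · exact hB2 _ (by omega) (by have := (mem_Seg.1 ha).2; omega)
  · rcases lt_trichotomy a b with h | h | h
    · exact hM a b h
    · show pM T a b ∈ B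
      rw [pM, if_pos h]
      exact one_mem B
    · show pM T a b ∈ B
      rw [pM_symm hT]
      exact hM b a h

omit [NeZero m] in
lemma ASub_eq_W {i : ℕ} [NeZero ((i + 1) / 2)]
    {T : Equiv.Perm (Fin ((i + 1) / 2)) →* PA R δ ((i + 1) / 2)} (hT : IsT T) :
    ASub R δ i = (pData hT).W i := by
  by_cases h : i % 2 = 0
  · rw [ASub, if_pos h, W_eq_top hT (by omega) le_rfl]
  · rw [ASub, if_neg h]
    refine le_antisymm (Algebra.adjoin_le ?_) (W_le hT rfl _ ?_ ?_ ?_)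
    · rintro _ ((⟨j, h1, h2, rfl⟩ | ⟨j, h1, h2, rfl⟩) | ⟨j, h1, h2, rfl⟩)
      · exact paT_mem_W hT h1 (by omega) le_rfl
      · exact paP_mem_W hT h1 (by omega) le_rfl
      · exact paPh_mem_W hT h1 h2 le_rfl
    · exact fun j h1 h2 => Algebra.subset_adjoin (Or.inl (Or.inl ⟨j, h1, by omega, rfl⟩))
    · exact fun j h1 h2 => Algebra.subset_adjoin (Or.inl (Or.inr ⟨j, h1, by omega, rfl⟩))
    · exact fun j h1 h2 => Algebra.subset_adjoin (Or.inr ⟨j, h1, h2, rfl⟩)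

lemma isStar {st : PA R δ m →ₗ[R] PA R δ m} (mul : ∀ x y, st (x * y) = st y * st x)
    (invol : ∀ x, st (st x) = x) (ht : ∀ j, st (paT R δ m j) = paT R δ m j)
    (hp : ∀ j, st (paP R δ m j) = paP R δ m j) (hph : ∀ j, st (paPh R δ m j) = paPh R δ m j) :
    (pData hT).IsStar st := by
  have hone : st 1 = 1 := by
    have := mul (st 1) 1
    rwa [mul_one, invol, mul_one, eq_comm] at this
  have hstT : ∀ σ, st (T σ) = T σ⁻¹ := fun σ => by
    let G : Submonoid (Equiv.Perm (Fin m)) :=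
      { carrier := {w | st (T w) = T w⁻¹}
        one_mem' := by
          show st (T 1) = T 1⁻¹
          rw [inv_one, map_one, hone]
        mul_mem' := fun {x y} hx hy => by
          show st (T (x * y)) = T (x * y)⁻¹
          rw [map_mul, mul, mul_inv_rev, map_mul]
          exact congrArg₂ _ hy hx }
    refine mem_of_forall_swN G (fun j h1 h2 => ?_) σ
    show st (T _) = T _
    rw [swN_of h1 h2, Equiv.swap_inv, ← swN_of h1 h2, hT j h1 h2, ht]
  refine ⟨mul, invol, hstT, fun a => hp _, fun a b => ?_⟩
  show st (pM T a b) = pM T a b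
  by_cases hab : a = b
  · rw [pM, if_pos hab, hone]
  · rw [pM, if_neg hab]
    show st (T _ * _ * T _) = T _ * _ * T _
    rw [mul, mul, hph, hstT, hstT, inv_inv, mul_assoc]

omit [NeZero m] in
lemma Dst_eq (D : PData R δ (PA R δ m) (Fin m)) (z z' : Fin m) (U : Finset (Fin m)) :
    D.Dst z U * D.M z z' = D.M z z' * D.Dst z' U := by
  induction U using Finset.induction_on with
  | empty => rw [D.Dst_empty, D.Dst_empty, mul_one, one_mul]
  | insert a U ha ih =>
    have h : D.M z z' * D.M a z' = D.M a z * D.M z z' := by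
      rw [D.M_symm a z', D.M_trans, D.M_symm z a, (D.M_comm z z' a z).eq]
    rw [D.Dst_insert ha, D.Dst_insert ha, mul_assoc, ih, ← mul_assoc, ← mul_assoc, h]

lemma eStairP_even {k l : ℕ} (hl : l ≤ k) (hm : k ≤ m) :
    eStairP R δ m (2 * k) l = (pData hT).PS (Seg m (k - l) k) := by
  have key : ∀ n t, n + t ≤ m → ((List.range t).map fun s => paP R δ m (n + s + 1)).prod =
      (pData hT).PS (Seg m n (n + t)) := by
    intro n t ht
    induction t with
    | zero =>
      rw [show Seg m n (n + 0) = ∅ by ext; simp]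
      simp
    | succ t ih =>
      rw [List.range_succ, List.map_append, List.prod_append, ih (by omega), ← Nat.add_assoc,
        Seg_succ_right (by omega) (by omega), PData.PS_insert']
      · congr 1
        show _ = paP R δ m _
        rw [pt_val (by omega)]
        simp
      · rw [mem_Seg, pt_val (by omega)]
        omega
  have := key (k - l) l (by omega)
  rw [Nat.sub_add_cancel hl] at this
  rw [← this, eStairP]
  congr 1
  refine List.map_congr_left fun t _ => ?_
  rw [paE, if_pos (by omega)]
  congr 1
  omega

lemma eStairP_odd {k l : ℕ} (hl : l ≤ k) (hm : k < m) :
    eStairP R δ m (2 * k + 1) l = (pData hT).Dst (pt m k) (Seg m (k - l) k) := by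
  have key : ∀ n t, n + t < m → ((List.range t).map fun s => paPh R δ m (n + s + 1)).prod =
      (pData hT).Dst (pt m (n + t)) (Seg m n (n + t)) := by
    intro n t ht
    induction t with
    | zero =>
      rw [show Seg m n (n + 0) = ∅ by ext; simp]
      simp
    | succ t ih =>
      rw [List.range_succ, List.map_append, List.prod_append, ih (by omega), ← Nat.add_assoc,
        Seg_succ_right (by omega) (by omega), PData.Dst_insert, ← Dst_eq]
      · congr 1
        simp only [List.map_cons, List.map_nil, List.prod_cons, List.prod_nil, mul_one]
        rw [← pM_consecutive hT (by omega) (by omega)]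
        rfl
      · rw [mem_Seg, pt_val (by omega)]
        omega
  have := key (k - l) l (by omega)
  rw [Nat.sub_add_cancel hl] at this
  rw [← this, eStairP]
  congr 1
  refine List.map_congr_left fun t _ => ?_
  rw [paE, if_neg (by omega)]
  congr 1
  omega

lemma eStairP_eq {i l : ℕ} (hl : 2 * l ≤ i) (hm : (i + 1) / 2 ≤ m) :
    eStairP R δ m i l = (pData hT).e i (i / 2 - l) := by
  rcases Nat.even_or_odd' i with ⟨k, rfl | rfl⟩
  · rw [eStairP_even hT (by omega) (by omega), PData.e_even, Nat.mul_div_cancel_left k two_pos]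
  · rw [eStairP_odd hT (by omega) (by omega), PData.e_odd, show (2 * k + 1) / 2 = k by omega]

include hT

omit [NeZero m] in
lemma tAsc_eq {a b : ℕ} (ha : 1 ≤ a) (hb : b ≤ m) : tAsc R δ m a b = T (asc m a b) := by
  rw [tAsc, asc, map_list_prod, List.map_map]
  congr 1
  refine List.map_congr_left fun k hk => ?_
  rw [List.mem_range] at hk
  exact (hT _ (by omega) (by omega)).symm

omit [NeZero m] in
lemma tDesc_eq {a b : ℕ} (ha : 1 ≤ a) (hab : a ≤ b) (hb : b ≤ m) :
    tDesc R δ m b a = T (asc m a b)⁻¹ := by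
  induction b, hab using Nat.le_induction with
  | base => simp [tDesc, asc_self]
  | succ b hab ih =>
    have h : tDesc R δ m (b + 1) a = paT R δ m b * tDesc R δ m b a := by
      rw [tDesc, tDesc, show b + 1 - a = b - a + 1 by omega, List.range_succ_eq_map,
        List.map_cons, List.prod_cons, List.map_map]
      congr 2
      refine List.map_congr_left fun k _ => ?_
      show paT R δ m _ = paT R δ m _
      congr 1
      omega
    have hinv : (swN m b)⁻¹ = swN m b := inv_eq_of_mul_eq_one_right (swN_mul_self b)
    rw [h, ih (by omega), asc_succ hab, mul_inv_rev, map_mul, hinv, hT b (by omega) (by omega)]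

lemma dBarPA_eq {mu lam : YoungDiagram} {j : ℕ} (hb : Box mu lam j) (hm : lam.card ≤ m) :
    dBarPA R δ m lam.card mu lam = T (cyc mu.card (pt m (psum lam (j + 1) - 1))) := by
  have h1 : psum lam (j + 1) ≤ lam.card := psum_le_card _ _
  have h2 : psum lam (j + 1) = psum lam j + lam.rowLen j := psum_succ _ _
  have h3 := hb j
  rw [if_pos rfl] at h3
  rw [dBarPA, aVal_eq hb, tAsc_eq hT (by omega) hm, cyc, pt_val (by omega), hb.card,
    Nat.sub_add_cancel (by omega)]

lemma uBarPA_eq {lam nu : YoungDiagram} {j : ℕ} (hb : Box lam nu j) (hm : nu.card ≤ m) :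
    uBarPA R δ m nu.card lam nu = ∑ y ∈ fib (rl m nu) j, T (cyc lam.card y)⁻¹ := by
  have h1 : psum nu (j + 1) ≤ nu.card := psum_le_card _ _
  have h2 : psum nu (j + 1) = psum nu j + nu.rowLen j := psum_succ _ _
  have h3 := hb j
  have h4 := hb.card
  have h5 := hb.row_le
  rw [if_pos rfl] at h3
  have hfib : ∀ y : Fin m, y ∈ fib (rl m nu) j ↔ psum nu j ≤ y.val ∧ y.val < psum nu (j + 1) :=
    fun y => by rw [mem_fib, rl_eq_iff (by omega)]
  rw [uBarPA, aVal_eq hb, addedRow_eq hb, Finset.mul_sum]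
  refine Finset.sum_bij' (fun r _ => pt m (psum nu (j + 1) - 1 - r))
    (fun y _ => psum nu (j + 1) - 1 - y.val) ?_ ?_ ?_ ?_ ?_
  · intro r hr
    rw [Finset.mem_range] at hr
    rw [hfib, pt_val (by omega)]
    omega
  · intro y hy
    rw [hfib] at hy
    rw [Finset.mem_range]
    omega
  · intro r hr
    rw [Finset.mem_range] at hr
    show psum nu (j + 1) - 1 - (pt m (psum nu (j + 1) - 1 - r)).val = r
    rw [pt_val (by omega)]
    omega
  · intro y hy
    rw [hfib] at hy
    refine Fin.ext ?_
    rw [pt_val (by omega)]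
    omega
  · intro r hr
    rw [Finset.mem_range] at hr
    rw [tDesc_eq hT (by omega) h1 hm, tDesc_eq hT (by omega) (by omega) (by omega), ← map_mul,
      ← mul_inv_rev, asc_mul_asc (by omega) h1, cyc, pt_val (by omega), h4,
      show psum nu (j + 1) - 1 - r + 1 = psum nu (j + 1) - r by omega]

omit hT [NeZero m] in
lemma mem_RowStab {mu : YoungDiagram} {v : Equiv.Perm (Fin m)} :
    v ∈ RowStab m mu ↔ rl m mu ∘ v = rl m mu := by
  have h : ∀ k : Fin m, applyPerm m v (k.val + 1) = (v k).val + 1 := fun k => by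
    rw [applyPerm, dif_pos (by omega)]
    rfl
  rw [RowStab, Finset.mem_filter, funext_iff]
  simp only [Finset.mem_univ, true_and, h]
  rfl

lemma cPA_eq {tw : Equiv.Perm (Fin m) → PA R δ m} (htw : ∀ v, tw v = T v⁻¹) {i l : ℕ}
    {lam : YoungDiagram} (hl : 2 * l ≤ i) (hlam : lam.card = (i - 2 * l) / 2)
    (hm : (i + 1) / 2 ≤ m) : cPA R δ m tw i lam l = (pData hT).cE i lam := by
  rw [cPA, eStairP_eq hT hl hm, PData.cE, ← PData.sum_T_inv_eq_cS]
  congr 1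
  · refine Finset.sum_congr ?_ fun v _ => htw v
    ext v
    rw [mem_RowStab, Finset.mem_filter]
    simp
  · congr 1
    omega

end PartAlg

end

section

open Tab

namespace PartAlg

variable {R : Type} [CommRing R] {δ : R} {m : ℕ} {T : Equiv.Perm (Fin m) →* PA R δ m} [NeZero m]
  (hT : IsT T)

/-- The vertices of the branching diagram at level `i`. -/
def IsVertex (i : ℕ) (x : YoungDiagram × ℕ) : Prop := x.1.card + x.2 = i / 2

lemma isVertex_iff {i : ℕ} {x : YoungDiagram × ℕ} :
    IsVertex i x ↔ 2 * x.2 ≤ i ∧ x.1.card = (i - 2 * x.2) / 2 := by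
  unfold IsVertex
  omega

lemma wGT_iff_above {i : ℕ} {x y : YoungDiagram × ℕ} (hx : IsVertex i x) (hy : IsVertex i y) :
    wGT x y ↔ Above x.1 y.1 := by
  unfold IsVertex at *
  unfold wGT Above
  rw [show y.2 < x.2 ↔ x.1.card < y.1.card by omega,
    show x.2 = y.2 ↔ x.1.card = y.1.card by omega]

lemma IsVertex.step {i : ℕ} {x y : YoungDiagram × ℕ} (hx : IsVertex i x) (h : PEdge i x y) :
    IsVertex (i + 1) y := by
  unfold IsVertex at *
  unfold PEdge at h
  split_ifs at h
  · rcases h with ⟨h1, -, h2⟩ | ⟨h1, h2⟩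
    · omega
    · rw [h2]
      omega
  · rcases h with ⟨h1, h2⟩ | ⟨h1, -, h2⟩
    · rw [h2]
      omega
    · omega

/-- Remove the last vertex of a path. -/
def initPath {i : ℕ} {x : YoungDiagram × ℕ} (t : PPath (i + 1) x) :
    PPath i (t.1 (Fin.last i).castSucc) :=
  ⟨fun k => t.1 k.castSucc, t.2.1, rfl, fun k => t.2.2.2 k.castSucc⟩

lemma initPath_edge {i : ℕ} {x : YoungDiagram × ℕ} (t : PPath (i + 1) x) :
    PEdge i (t.1 (Fin.last i).castSucc) x := by
  have h := t.2.2.2 (Fin.last i)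
  rwa [Fin.succ_last, t.2.2.1] at h

/-- Append a vertex to a path. -/
def snocPath {i : ℕ} {x y : YoungDiagram × ℕ} (t : PPath i x) (h : PEdge i x y) :
    PPath (i + 1) y :=
  ⟨Fin.snoc (α := fun _ => YoungDiagram × ℕ) t.1 y, by
    rw [show (0 : Fin (i + 1 + 1)) = Fin.castSucc 0 from rfl, Fin.snoc_castSucc]
    exact t.2.1, Fin.snoc_last _ _, fun k => by
    rw [Fin.snoc_castSucc]
    refine Fin.lastCases ?_ (fun k => ?_) k
    · rw [Fin.succ_last, Fin.snoc_last, t.2.2.1]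
      exact h
    · rw [Fin.succ_castSucc, Fin.snoc_castSucc]
      exact t.2.2.2 k⟩

lemma snocPath_castSucc {i : ℕ} {x y : YoungDiagram × ℕ} (t : PPath i x) (h : PEdge i x y)
    (k : Fin (i + 1)) : (snocPath t h).1 k.castSucc = t.1 k :=
  Fin.snoc_castSucc (α := fun _ => YoungDiagram × ℕ) _ _ _

lemma snocPath_initPath {i : ℕ} {x : YoungDiagram × ℕ} (t : PPath (i + 1) x) :
    snocPath (initPath t) (initPath_edge t) = t := by
  refine Subtype.ext (funext fun k => ?_)
  refine Fin.lastCases ?_ (fun k => ?_) k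
  · exact (snocPath _ _).2.2.1.trans t.2.2.1.symm
  · exact snocPath_castSucc _ _ _

lemma isVertex_of_path {i : ℕ} {x : YoungDiagram × ℕ} (t : PPath i x) : IsVertex i x := by
  induction i generalizing x with
  | zero =>
    rw [← t.2.1.symm.trans t.2.2.1]
    simp [IsVertex]
  | succ i ih => exact (ih (initPath t)).step (initPath_edge t)

instance finite_vertex (i : ℕ) : Finite {x // IsVertex i x} := by
  have := finite_card_le i
  refine Finite.of_injective (β := {lam : YoungDiagram // lam.card ≤ i} × Fin (i + 1))
    (fun x => (⟨x.1.1, ?_⟩, ⟨x.1.2, ?_⟩)) fun x y h => ?_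
  · have : x.1.1.card + x.1.2 = i / 2 := x.2
    omega
  · have : x.1.1.card + x.1.2 = i / 2 := x.2
    omega
  · rw [Prod.ext_iff, Subtype.ext_iff, Fin.ext_iff] at h
    exact Subtype.ext (Prod.ext h.1 h.2)

instance finite_path (i : ℕ) (x : YoungDiagram × ℕ) : Finite (PPath i x) := by
  induction i generalizing x with
  | zero =>
    refine Finite.of_injective (fun _ => ()) fun t t' _ => Subtype.ext (funext fun k => ?_)
    rw [show k = 0 from Fin.fin_one_eq_zero k, t.2.1, t'.2.1]
  | succ i ih =>
    refine Finite.of_injective (β := Σ y : {y // IsVertex i y}, PPath i y.1)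
      (fun t => ⟨⟨_, isVertex_of_path (initPath t)⟩, initPath t⟩) fun t t' h => ?_
    have key : ∀ k, (initPath t).1 k = (initPath t').1 k := fun k =>
      congrArg (fun z : Σ y : {y // IsVertex i y}, PPath i y.1 => z.2.1 k) h
    refine Subtype.ext (funext fun k => ?_)
    refine Fin.lastCases ?_ (fun k => ?_) k
    · exact t.2.2.1.trans t'.2.2.1.symm
    · exact key k

instance finite_PLam (i : ℕ) : Finite (PLam i) :=
  Finite.of_injective (fun x => (⟨x.1, isVertex_iff.2 x.2⟩ : {x // IsVertex i x}))
    fun _ _ h => Subtype.ext (congrArg (fun z => z.1) h)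

omit [NeZero m] in
lemma dPathPA_snoc {i : ℕ} {x y : YoungDiagram × ℕ} (t : PPath i x) (h : PEdge i x y) :
    dPathPA R δ m (i + 1) (snocPath t h) = dStepPA R δ m i x y * dPathPA R δ m i t := by
  have h1 : (snocPath t h).1 (Fin.last i).succ = y := (snocPath t h).2.2.1
  unfold dPathPA
  rw [List.ofFn_succ', List.concat_eq_append, List.reverse_append, List.prod_append,
    List.reverse_singleton, List.prod_singleton, h1, snocPath_castSucc, t.2.2.1]
  simp only [snocPath_castSucc, Fin.succ_castSucc]
  rfl

include hT in
lemma dElt_step {i : ℕ} {x y : YoungDiagram × ℕ} (hm : (i + 1 + 1) / 2 ≤ m) (hx : IsVertex i x)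
    (h : PEdge i x y) {d : PA R δ m} (hd : (pData hT).DElt i x.1 d) :
    IsVertex (i + 1) y ∧ (pData hT).DElt (i + 1) y.1 (dStepPA R δ m i x y * d) := by
  obtain ⟨lam, l⟩ := x
  obtain ⟨mu, l'⟩ := y
  unfold IsVertex at *
  unfold PEdge at h
  unfold dStepPA
  simp only [] at *
  have he : eStairP R δ m i l = (pData hT).e i lam.card := by
    rw [eStairP_eq hT (by omega) (by omega)]
    congr 1
    omega
  rw [he]
  rcases Nat.even_or_odd' i with ⟨k, rfl | rfl⟩
  · rw [if_neg (by omega)] at h ⊢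
    rcases h with ⟨rfl, rfl⟩ | ⟨rfl, h1, h2⟩
    · rw [if_pos rfl]
      exact ⟨by omega, PData.DElt.odd_same (by omega) hd⟩
    · obtain ⟨j, -, hb⟩ := exists_box h1 h2
      rw [if_neg (by omega), show (2 * k - 2 * l) / 2 = lam.card by omega,
        uBarPA_eq hT hb (by omega)]
      exact ⟨by omega, PData.DElt.odd_box (by omega) hb hd⟩
  · rw [if_pos (by omega)] at h ⊢
    rcases h with ⟨rfl, h1, h2⟩ | ⟨rfl, rfl⟩
    · obtain ⟨j, -, hb⟩ := exists_box h1 h2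
      rw [if_pos rfl, show (2 * k + 1 + 1 - 2 * l') / 2 = mu.card by omega,
        dBarPA_eq hT hb (by omega)]
      exact ⟨by omega, PData.DElt.even_box (by omega) hb hd⟩
    · rw [if_neg (by omega)]
      exact ⟨by omega, PData.DElt.even_same (by omega) hd⟩

include hT in
lemma dElt_dPathPA {i : ℕ} (hm : (i + 1) / 2 ≤ m) {x : YoungDiagram × ℕ} (t : PPath i x) :
    IsVertex i x ∧ (pData hT).DElt i x.1 (dPathPA R δ m i t) := by
  induction i generalizing x with
  | zero =>
    have hx : (⊥, 0) = x := t.2.1.symm.trans t.2.2.1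
    subst hx
    refine ⟨by simp [IsVertex], ?_⟩
    have : dPathPA R δ m 0 t = 1 := by simp [dPathPA]
    rw [this]
    exact PData.DElt.zero
  | succ i ih =>
    rw [← snocPath_initPath t, dPathPA_snoc]
    obtain ⟨h1, h2⟩ := ih (by omega) (initPath t)
    exact dElt_step hT hm h1 (initPath_edge t) h2

lemma exists_path {i : ℕ} (hm : (i + 1) / 2 ≤ m) {lam : YoungDiagram} {d : PA R δ m}
    (hd : (pData hT).DElt i lam d) : lam.card ≤ i / 2 ∧
      ∃ t : PPath i (lam, i / 2 - lam.card), dPathPA R δ m i t = d := by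
  have step : ∀ {i : ℕ} {x y : YoungDiagram × ℕ} {d : PA R δ m}, PEdge i x y →
      (∃ t : PPath i x, dPathPA R δ m i t = d) →
      ∃ t : PPath (i + 1) y, dPathPA R δ m (i + 1) t = dStepPA R δ m i x y * d := by
    rintro i x y _ h ⟨t, rfl⟩
    exact ⟨snocPath t h, dPathPA_snoc t h⟩
  induction hd with
  | zero =>
    refine ⟨by simp, ⟨fun _ => (⊥, 0), rfl, by simp, fun k => k.elim0⟩, by simp [dPathPA]⟩
  | @even_same k lam d hk hd ih =>
    obtain ⟨h1, h2⟩ := ih (by omega)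
    refine ⟨by omega, ?_⟩
    have he : PEdge (2 * k + 1) (lam, (2 * k + 1) / 2 - lam.card)
        (lam, 2 * (k + 1) / 2 - lam.card) := by
      rw [PEdge, if_pos (by omega)]
      exact Or.inr ⟨by simp only []; omega, rfl⟩
    refine (step he h2).imp fun t ht => ht.trans (congrArg (· * d) ?_)
    rw [dStepPA, if_pos (by omega), if_neg (by simp only []; omega), eStairP_eq hT
      (by simp only []; omega) (by omega)]
    congr 1
    simp only []
    omega
  | @even_box k j mu lam d hk hb hd ih =>
    obtain ⟨h1, h2⟩ := ih (by omega)
    have hc := hb.card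
    refine ⟨by omega, ?_⟩
    have he : PEdge (2 * k + 1) (mu, (2 * k + 1) / 2 - mu.card)
        (lam, 2 * (k + 1) / 2 - lam.card) := by
      rw [PEdge, if_pos (by omega)]
      exact Or.inl ⟨by simp only []; omega, hb.le, hc⟩
    refine (step he h2).imp fun t ht => ht.trans (congrArg (· * d) ?_)
    rw [dStepPA, if_pos (by omega), if_pos (by simp only []; omega), eStairP_eq hT
      (by simp only []; omega) (by omega)]
    congr 1
    · refine Eq.trans ?_ (dBarPA_eq hT hb (by omega))
      congr 1
      simp only []
      omega
    · congr 1
      simp only []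
      omega
  | @odd_same k lam d hk hd ih =>
    obtain ⟨h1, h2⟩ := ih (by omega)
    refine ⟨by omega, ?_⟩
    have he : PEdge (2 * k) (lam, 2 * k / 2 - lam.card)
        (lam, (2 * k + 1) / 2 - lam.card) := by
      rw [PEdge, if_neg (by omega)]
      exact Or.inl ⟨by simp only []; omega, rfl⟩
    refine (step he h2).imp fun t ht => ht.trans (congrArg (· * d) ?_)
    rw [dStepPA, if_neg (by omega), if_pos (by simp only []; omega), eStairP_eq hT
      (by simp only []; omega) (by omega)]
    congr 1
    simp only []
    omega
  | @odd_box k j lam nu d hk hb hd ih =>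
    obtain ⟨h1, h2⟩ := ih (by omega)
    have hc := hb.card
    refine ⟨by omega, ?_⟩
    have he : PEdge (2 * k) (nu, 2 * k / 2 - nu.card)
        (lam, (2 * k + 1) / 2 - lam.card) := by
      rw [PEdge, if_neg (by omega)]
      exact Or.inr ⟨by simp only []; omega, hb.le, hc⟩
    refine (step he h2).imp fun t ht => ht.trans (congrArg (· * d) ?_)
    rw [dStepPA, if_neg (by omega), if_neg (by simp only []; omega), eStairP_eq hT
      (by simp only []; omega) (by omega)]
    congr 1
    · refine Eq.trans ?_ (uBarPA_eq hT hb (by omega))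
      congr 1
      simp only []
      omega
    · congr 1
      simp only []
      omega

/-- At a vertex, path elements are exactly the elements described by `DElt`. -/
lemma dElt_iff {i : ℕ} (hm : (i + 1) / 2 ≤ m) (x : PLam i) (d : PA R δ m) :
    (pData hT).DElt i x.1.1 d ↔ ∃ t : PPath i x.1, dPathPA R δ m i t = d := by
  constructor
  · intro h
    obtain ⟨-, t, ht⟩ := exists_path hT hm h
    have hx := isVertex_iff.2 x.2
    have : (x.1.1, i / 2 - x.1.1.card) = x.1 := by
      unfold IsVertex at hx
      exact Prod.ext rfl (by simp only []; omega)
    rw [← this]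
    exact ⟨t, ht⟩
  · rintro ⟨t, rfl⟩
    exact (dElt_dPathPA hT hm t).2

end PartAlg

end

section

open Tab

namespace Young

lemma finite_setOf_card_le (n : ℕ) : {lam : YoungDiagram | lam.card ≤ n}.Finite :=
  letI := finite_card_le n
  Set.finite_coe_iff.1 (Finite.of_injective
    (fun x : ({lam : YoungDiagram | lam.card ≤ n} : Set YoungDiagram) =>
      (⟨x.1, x.2⟩ : {lam : YoungDiagram // lam.card ≤ n}))
    fun _ _ h => Subtype.ext (congrArg (fun z => z.1) h))

lemma finite_covBy (lam : YoungDiagram) :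
    {nu : YoungDiagram | lam ≤ nu ∧ nu.card = lam.card + 1}.Finite :=
  (finite_setOf_card_le (lam.card + 1)).subset fun _ h => h.2.le

lemma finite_covered (nu : YoungDiagram) :
    {lam : YoungDiagram | lam ≤ nu ∧ nu.card = lam.card + 1}.Finite :=
  (finite_setOf_card_le nu.card).subset fun _ h => h.2 ▸ Nat.le_succ _

/-- The diagrams obtained by adding a node. -/
def up (lam : YoungDiagram) : Finset YoungDiagram := (finite_covBy lam).toFinset

/-- The diagrams obtained by removing a node. -/
def down (nu : YoungDiagram) : Finset YoungDiagram := (finite_covered nu).toFinset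

lemma mem_up {lam nu : YoungDiagram} : nu ∈ up lam ↔ lam ≤ nu ∧ nu.card = lam.card + 1 := by
  simp [up]

lemma mem_down {lam nu : YoungDiagram} : lam ∈ down nu ↔ lam ≤ nu ∧ nu.card = lam.card + 1 := by
  simp [down]

lemma card_sup_add_card_inf (a b : YoungDiagram) :
    (a ⊔ b).card + (a ⊓ b).card = a.card + b.card := by
  unfold YoungDiagram.card
  rw [YoungDiagram.cells_sup, YoungDiagram.cells_inf, Finset.card_union_add_card_inter]

lemma card_le_card {a b : YoungDiagram} (h : a ≤ b) : a.card ≤ b.card :=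
  Finset.card_le_card (YoungDiagram.cells_subset_iff.2 h)

lemma eq_of_le_of_card {a b : YoungDiagram} (h : a ≤ b) (hc : b.card ≤ a.card) : a = b :=
  YoungDiagram.ext (Finset.eq_of_subset_of_card_le (YoungDiagram.cells_subset_iff.2 h) hc)

lemma sup_eq_of_covered {a b nu : YoungDiagram} (ha : a ≤ nu) (hb : b ≤ nu)
    (hac : nu.card = a.card + 1) (hbc : nu.card = b.card + 1) (hab : a ≠ b) : a ⊔ b = nu := by
  refine eq_of_le_of_card (sup_le ha hb) ?_
  by_contra hlt
  have h1 : a = a ⊔ b := eq_of_le_of_card le_sup_left (by omega)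
  exact hab (eq_of_le_of_card (sup_eq_left.1 h1.symm) (by omega)).symm

lemma inf_eq_of_covBy {a b k : YoungDiagram} (ha : k ≤ a) (hb : k ≤ b)
    (hac : a.card = k.card + 1) (hbc : b.card = k.card + 1) (hab : a ≠ b) : a ⊓ b = k := by
  refine (eq_of_le_of_card (le_inf ha hb) ?_).symm
  by_contra hlt
  have h1 : a ⊓ b = a := eq_of_le_of_card inf_le_left (by omega)
  exact hab (eq_of_le_of_card (inf_eq_left.1 h1) (by omega))

lemma box_unique {lam nu nu' : YoungDiagram} {j : ℕ} (h : Box lam nu j) (h' : Box lam nu' j) :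
    nu = nu' :=
  le_antisymm (le_of_rowLen_le fun i => by rw [h i, h' i])
    (le_of_rowLen_le fun i => by rw [h i, h' i])

lemma box_unique_left {lam lam' nu : YoungDiagram} {j : ℕ} (h : Box lam nu j)
    (h' : Box lam' nu j) : lam = lam' := by
  have key : ∀ i, lam.rowLen i = lam'.rowLen i := fun i => by
    have := h i
    have := h' i
    omega
  exact le_antisymm (le_of_rowLen_le fun i => (key i).le)
    (le_of_rowLen_le fun i => (key i).ge)

lemma box_lt {lam nu : YoungDiagram} {j : ℕ} (h : Box lam nu j) :
    nu.rowLen (j + 1) < nu.rowLen j := by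
  rw [h, h, if_neg (by omega), if_pos rfl]
  have := lam.rowLen_anti j (j + 1) (by omega)
  omega

lemma box_addable {lam nu : YoungDiagram} {j : ℕ} (h : Box lam nu j) (i : ℕ) (hi : i + 1 = j) :
    lam.rowLen j < lam.rowLen i := by
  have h1 := nu.rowLen_anti i j (by omega)
  rw [h, h, if_pos rfl, if_neg (by omega)] at h1
  omega

lemma card_up (lam : YoungDiagram) : (up lam).card = (down lam).card + 1 := by
  classical
  let Rm := (Finset.range lam.card).filter fun j => lam.rowLen (j + 1) < lam.rowLen j
  have h1 : (down lam).card = Rm.card := by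
    symm
    refine Finset.card_bij (fun j h => (exists_box_of_lt (Finset.mem_filter.1 h).2).choose)
      (fun j h => ?_) (fun j h j' h' he => ?_) fun mu hmu => ?_
    · have := (exists_box_of_lt (Finset.mem_filter.1 h).2).choose_spec
      exact mem_down.2 ⟨this.le, this.card⟩
    · have h1 := (exists_box_of_lt (Finset.mem_filter.1 h).2).choose_spec
      have h2 := (exists_box_of_lt (Finset.mem_filter.1 h').2).choose_spec
      rw [← he] at h2
      have h3 := h1 j
      have h4 := h2 j
      by_contra hne
      rw [if_pos rfl] at h3
      rw [if_neg hne] at h4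
      omega
    · obtain ⟨hle, hc⟩ := mem_down.1 hmu
      obtain ⟨j, hj, hb⟩ := exists_box hle hc
      have hj' : j ∈ Rm := Finset.mem_filter.2 ⟨Finset.mem_range.2 (by omega), box_lt hb⟩
      exact ⟨j, hj', box_unique_left
        (exists_box_of_lt (Finset.mem_filter.1 hj').2).choose_spec hb⟩
  have h2 : ∀ o : Option Rm, ∃ nu, Box lam nu (o.elim 0 fun j => j.1 + 1) := by
    rintro (_ | ⟨j, hj⟩)
    · exact exists_box_of_addable fun i hi => by simp at hi
    · refine exists_box_of_addable fun i hi => ?_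
      simp only [Option.elim] at hi ⊢
      obtain rfl : i = j := by omega
      exact (Finset.mem_filter.1 hj).2
  choose f hf using h2
  rw [h1, ← Fintype.card_coe Rm, ← Fintype.card_option, ← Finset.card_univ]
  symm
  refine Finset.card_bij (fun o _ => f o) (fun o _ => ?_) (fun o _ o' _ he => ?_) fun nu hnu => ?_
  · exact mem_up.2 ⟨(hf o).le, (hf o).card⟩
  · have h3 := hf o
    have h4 := hf o'
    rw [← he] at h4
    have h5 : (o.elim 0 fun j => j.1 + 1) = (o'.elim 0 fun j => j.1 + 1) := by
      by_contra hne
      have h6 := h3 (o.elim 0 fun j => j.1 + 1)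
      have h7 := h4 (o.elim 0 fun j => j.1 + 1)
      rw [if_pos rfl] at h6
      rw [if_neg hne] at h7
      omega
    rcases o with _ | ⟨j, hj⟩ <;> rcases o' with _ | ⟨j', hj'⟩ <;> simp at h5 ⊢
    exact h5
  · obtain ⟨hle, hc⟩ := mem_up.1 hnu
    obtain ⟨j, hj, hb⟩ := exists_box hle hc
    rcases j with _ | j
    · exact ⟨none, Finset.mem_univ _, box_unique (hf none) hb⟩
    · exact ⟨some ⟨j, Finset.mem_filter.2 ⟨Finset.mem_range.2 (by omega), box_addable hb j rfl⟩⟩,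
        Finset.mem_univ _, box_unique (hf (some _)) hb⟩

/-- The raising operator of Young's lattice. -/
def U : Module.End ℤ (YoungDiagram → ℤ) where
  toFun f nu := ∑ lam ∈ down nu, f lam
  map_add' _ _ := funext fun _ => Finset.sum_add_distrib
  map_smul' _ _ := funext fun _ => (Finset.mul_sum _ _ _).symm

/-- The lowering operator of Young's lattice. -/
def D : Module.End ℤ (YoungDiagram → ℤ) where
  toFun f lam := ∑ nu ∈ up lam, f nu
  map_add' _ _ := funext fun _ => Finset.sum_add_distrib
  map_smul' _ _ := funext fun _ => (Finset.mul_sum _ _ _).symm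

lemma U_apply (f : YoungDiagram → ℤ) (nu : YoungDiagram) : U f nu = ∑ lam ∈ down nu, f lam := rfl

lemma D_apply (f : YoungDiagram → ℤ) (lam : YoungDiagram) : D f lam = ∑ nu ∈ up lam, f nu := rfl

/-- Young's lattice is differential. -/
lemma D_mul_U : D * U = U * D + 1 := by
  classical
  refine LinearMap.ext fun f => funext fun lam => ?_
  simp only [LinearMap.add_apply, Module.End.mul_apply, Module.End.one_apply, Pi.add_apply]
  rw [D_apply, U_apply]
  simp only [U_apply, D_apply]
  have h1 : ∀ nu ∈ up lam, ∑ mu ∈ down nu, f mu = f lam + ∑ mu ∈ (down nu).erase lam, f mu :=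
    fun nu h => (Finset.add_sum_erase _ _ (mem_down.2 (mem_up.1 h))).symm
  have h2 : ∀ k ∈ down lam, ∑ mu ∈ up k, f mu = f lam + ∑ mu ∈ (up k).erase lam, f mu :=
    fun k h => (Finset.add_sum_erase _ _ (mem_up.2 (mem_down.1 h))).symm
  rw [Finset.sum_congr rfl h1, Finset.sum_congr rfl h2, Finset.sum_add_distrib,
    Finset.sum_add_distrib, Finset.sum_const, Finset.sum_const, card_up]
  have h3 : ∑ nu ∈ up lam, ∑ mu ∈ (down nu).erase lam, f mu
      = ∑ k ∈ down lam, ∑ mu ∈ (up k).erase lam, f mu := by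
    rw [Finset.sum_sigma', Finset.sum_sigma']
    refine Finset.sum_nbij' (fun p => ⟨lam ⊓ p.2, p.2⟩) (fun p => ⟨lam ⊔ p.2, p.2⟩) ?_ ?_ ?_ ?_ ?_
    · rintro ⟨nu, mu⟩ h
      simp only [Finset.mem_sigma, Finset.mem_erase, mem_up, mem_down] at h ⊢
      obtain ⟨⟨h1, h2⟩, h3, h4, h5⟩ := h
      have h6 := card_sup_add_card_inf lam mu
      rw [sup_eq_of_covered h1 h4 h2 h5 h3.symm] at h6
      exact ⟨⟨inf_le_left, by omega⟩, h3, inf_le_right, by omega⟩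
    · rintro ⟨k, mu⟩ h
      simp only [Finset.mem_sigma, Finset.mem_erase, mem_up, mem_down] at h ⊢
      obtain ⟨⟨h1, h2⟩, h3, h4, h5⟩ := h
      have h6 := card_sup_add_card_inf lam mu
      rw [inf_eq_of_covBy h1 h4 h2 h5 h3.symm] at h6
      exact ⟨⟨le_sup_left, by omega⟩, h3, le_sup_right, by omega⟩
    · rintro ⟨nu, mu⟩ h
      simp only [Finset.mem_sigma, Finset.mem_erase, mem_up, mem_down] at h
      obtain ⟨⟨h1, h2⟩, h3, h4, h5⟩ := h
      simp only [sup_eq_of_covered h1 h4 h2 h5 h3.symm]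
    · rintro ⟨k, mu⟩ h
      simp only [Finset.mem_sigma, Finset.mem_erase, mem_up, mem_down] at h
      obtain ⟨⟨h1, h2⟩, h3, h4, h5⟩ := h
      simp only [inf_eq_of_covBy h1 h4 h2 h5 h3.symm]
    · exact fun _ _ => rfl
  rw [h3, add_smul, one_smul]
  ring

/-- The operator counting paths of length two. -/
def TT : Module.End ℤ (YoungDiagram → ℤ) := (1 + U) * (1 + D)

lemma E_mul_TT : (1 + D) * TT = (TT + 1) * (1 + D) := by
  unfold TT
  rw [← mul_assoc]
  congr 1
  have := D_mul_U
  rw [add_mul, mul_add, mul_add, add_mul, this]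
  simp only [one_mul, mul_one, mul_add]
  abel

lemma E_mul_TT_pow (n : ℕ) : (1 + D) * TT ^ n = (TT + 1) ^ n * (1 + D) := by
  induction n with
  | zero => simp
  | succ n ih => rw [pow_succ, ← mul_assoc, ih, mul_assoc, E_mul_TT, ← mul_assoc, ← pow_succ]

/-- The indicator of the empty diagram. -/
def vac : YoungDiagram → ℤ := fun lam => if lam.card = 0 then 1 else 0

/-- The number of closed walks of length `2 * n` at the empty diagram. -/
def loops (n : ℕ) : ℤ := (TT ^ n) vac ⊥

lemma card_bot : (⊥ : YoungDiagram).card = 0 := rfl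

lemma loops_zero : loops 0 = 1 := by
  simp [loops, vac]

lemma D_vac : D vac = 0 := by
  refine funext fun lam => Finset.sum_eq_zero fun nu h => ?_
  have := (mem_up.1 h).2
  exact if_neg (by omega)

lemma U_bot (f : YoungDiagram → ℤ) : U f ⊥ = 0 := by
  refine Finset.sum_eq_zero fun nu h => ?_
  have := (mem_down.1 h).2
  rw [card_bot] at this
  omega

lemma loops_succ (n : ℕ) : loops (n + 1) = ∑ j ∈ Finset.range (n + 1), n.choose j * loops j := by
  unfold loops
  have h1 : (TT ^ (n + 1)) vac ⊥ = ((1 + D) * TT ^ n) vac ⊥ := by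
    rw [pow_succ']
    conv_lhs => rw [TT, mul_assoc]
    rw [Module.End.mul_apply, LinearMap.add_apply, Pi.add_apply, U_bot, add_zero]
    rfl
  rw [h1, E_mul_TT_pow, Module.End.mul_apply, LinearMap.add_apply, D_vac, Module.End.one_apply,
    add_zero, (Commute.one_right TT).add_pow]
  simp only [one_pow, mul_one, LinearMap.sum_apply, Finset.sum_apply]
  refine Finset.sum_congr rfl fun j _ => ?_
  rw [(Nat.cast_commute (n.choose j) (TT ^ j)).symm.eq, Module.End.mul_apply]
  simp [Module.End.natCast_apply]

/-- The number of walks of length `i` from the empty diagram. -/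
def walks : ℕ → YoungDiagram → ℤ
  | 0 => vac
  | i + 1 => if i % 2 = 1 then (1 + U) (walks i) else (1 + D) (walks i)

lemma walks_odd {i : ℕ} (h : i % 2 = 1) : walks (i + 1) = (1 + U) (walks i) := by
  rw [walks, if_pos h]

lemma walks_even {i : ℕ} (h : i % 2 = 0) : walks (i + 1) = (1 + D) (walks i) := by
  rw [walks, if_neg (by omega)]

lemma walks_two_mul (k : ℕ) : walks (2 * k) = (TT ^ k) vac := by
  induction k with
  | zero => rfl
  | succ k ih =>
    rw [show 2 * (k + 1) = 2 * k + 1 + 1 by ring, walks_odd (by omega), walks_even (by omega), ih,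
      pow_succ']
    rfl

lemma walks_eq_zero {i : ℕ} {lam : YoungDiagram} (h : i / 2 < lam.card) : walks i lam = 0 := by
  induction i generalizing lam with
  | zero => exact if_neg (by omega)
  | succ i ih =>
    rcases Nat.mod_two_eq_zero_or_one i with hi | hi
    · rw [walks_even hi, LinearMap.add_apply, Pi.add_apply, Module.End.one_apply, ih (by omega),
        D_apply, zero_add]
      refine Finset.sum_eq_zero fun nu h' => ih ?_
      have := (mem_up.1 h').2
      omega
    · rw [walks_odd hi, LinearMap.add_apply, Pi.add_apply, Module.End.one_apply, ih (by omega),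
        U_apply, zero_add]
      refine Finset.sum_eq_zero fun nu h' => ih ?_
      have := (mem_down.1 h').2
      omega

/-- The diagrams with at most `n` nodes. -/
def ball (n : ℕ) : Finset YoungDiagram :=
  (finite_setOf_card_le n).toFinset

lemma mem_ball {n : ℕ} {lam : YoungDiagram} : lam ∈ ball n ↔ lam.card ≤ n := by
  simp [ball]

lemma sum_U_mul {n : ℕ} {f g : YoungDiagram → ℤ} (hf : ∀ lam, n ≤ lam.card → f lam = 0) :
    ∑ lam ∈ ball n, (1 + U) f lam * g lam = ∑ lam ∈ ball n, f lam * (1 + D) g lam := by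
  simp only [LinearMap.add_apply, Pi.add_apply, Module.End.one_apply, U_apply, D_apply, add_mul,
    mul_add, Finset.sum_add_distrib, Finset.sum_mul, Finset.mul_sum]
  congr 1
  rw [Finset.sum_sigma', Finset.sum_sigma']
  refine Finset.sum_bij_ne_zero (fun p _ _ => ⟨p.2, p.1⟩) ?_ ?_ ?_ ?_
  · rintro ⟨nu, mu⟩ h -
    simp only [Finset.mem_sigma, mem_up, mem_down, mem_ball] at h ⊢
    exact ⟨by omega, h.2⟩
  · rintro ⟨a, b⟩ - - ⟨c, d⟩ - - h
    simp only [Sigma.mk.injEq, heq_eq_eq] at h ⊢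
    exact h.symm
  · rintro ⟨mu, nu⟩ h h0
    simp only [Finset.mem_sigma, mem_up, mem_ball] at h
    have : mu.card < n := by
      by_contra hlt
      exact h0 (by simp [hf mu (by omega)])
    refine ⟨⟨nu, mu⟩, ?_, h0, rfl⟩
    simp only [Finset.mem_sigma, mem_down, mem_ball]
    exact ⟨by omega, h.2⟩
  · exact fun _ _ _ => rfl

lemma sum_walks_mul {n i j : ℕ} (h : i + j < n) (hp : i % 2 = j % 2) :
    ∑ lam ∈ ball n, walks i lam * walks j lam = loops ((i + j) / 2) := by
  induction i generalizing j with
  | zero =>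
    rw [zero_add, loops, ← walks_two_mul, show 2 * (j / 2) = j by omega,
      Finset.sum_eq_single_of_mem ⊥ (mem_ball.2 (Nat.zero_le _))]
    · simp [walks, vac]
    · intro lam _ h0
      have : lam.card ≠ 0 := fun hc => h0 (eq_of_le_of_card bot_le hc.le).symm
      simp [walks, vac, this]
  | succ i ih =>
    rw [show (i + 1 + j) / 2 = (i + (j + 1)) / 2 by congr 1; ring, ← ih (by omega) (by omega)]
    rcases Nat.mod_two_eq_zero_or_one i with hi | hi
    · rw [walks_even hi, walks_odd (i := j) (by omega)]
      have := sum_U_mul (n := n) (f := walks j) (g := walks i)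
        fun lam h => walks_eq_zero (by omega)
      simp only [mul_comm] at this ⊢
      exact this.symm
    · rw [walks_odd hi, walks_even (i := j) (by omega)]
      exact sum_U_mul fun lam h => walks_eq_zero (by omega)

end Young

section Setoids

instance finite_setoid {α : Type*} [Finite α] : Finite (Setoid α) :=
  Finite.of_injective (β := α → α → Prop) (fun r => r.r) fun r s h => Setoid.ext fun a b => by
    have := congrFun (congrFun h a) b
    exact this.to_iff

/-- Extend an equivalence relation on a subset by one further class. -/
def extendSetoid {α : Type*} (s : Finset α) (r : Setoid s) : Setoid α where
  r x y := (x ∉ s ∧ y ∉ s) ∨ ∃ (hx : x ∈ s) (hy : y ∈ s), r ⟨x, hx⟩ ⟨y, hy⟩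
  iseqv :=
    { refl := fun x => by
        by_cases h : x ∈ s
        · exact Or.inr ⟨h, h, r.refl' _⟩
        · exact Or.inl ⟨h, h⟩
      symm := by
        rintro x y (h | ⟨hx, hy, h⟩)
        · exact Or.inl h.symm
        · exact Or.inr ⟨hy, hx, r.symm' h⟩
      trans := by
        rintro x y z (h | ⟨hx, hy, h⟩) (h' | ⟨hy', hz, h'⟩)
        · exact Or.inl ⟨h.1, h'.2⟩
        · exact absurd hy' h.2
        · exact absurd hy h'.1
        · exact Or.inr ⟨hx, hz, r.trans' h h'⟩ }

lemma extendSetoid_injective {α : Type*} (z : α) :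
    Function.Injective fun p : Σ s : {s : Finset α // z ∉ s}, Setoid s.1 =>
      extendSetoid p.1.1 p.2 := by
  rintro ⟨⟨s, hs⟩, r⟩ ⟨⟨s', hs'⟩, r'⟩ h
  have key : ∀ x y, ((x ∉ s ∧ y ∉ s) ∨ ∃ (hx : x ∈ s) (hy : y ∈ s), r ⟨x, hx⟩ ⟨y, hy⟩) ↔
      ((x ∉ s' ∧ y ∉ s') ∨ ∃ (hx : x ∈ s') (hy : y ∈ s'), r' ⟨x, hx⟩ ⟨y, hy⟩) :=
    fun x y => Setoid.ext_iff.1 h x y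
  obtain rfl : s = s' := by
    refine Finset.ext fun x => ?_
    have := key x z
    simp only [hs, hs', not_false_eq_true, and_true, IsEmpty.exists_iff, exists_false,
      or_false] at this
    exact not_iff_not.1 this
  have : r = r' := Setoid.ext fun x y => by
    have := key x y
    simpa [x.2, y.2] using this
  rw [this]

lemma loops_le_card_setoid (n : ℕ) : ∀ (α : Type) [Fintype α], Fintype.card α = n →
    Young.loops n ≤ Nat.card (Setoid α) := by
  classical
  induction n using Nat.strong_induction_on with
  | _ n ih =>
    intro α _ hα
    rcases n with _ | n
    · rw [Young.loops_zero]
      have : 0 < Nat.card (Setoid α) := Nat.card_pos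
      omega
    · obtain ⟨z⟩ : Nonempty α := Fintype.card_pos_iff.1 (by omega)
      have h1 := Nat.card_le_card_of_injective _ (extendSetoid_injective z)
      have hc : (Finset.univ.erase z).card = n := by
        rw [Finset.card_erase_of_mem (Finset.mem_univ _), Finset.card_univ]
        omega
      rw [Nat.card_sigma] at h1
      refine le_trans ?_ (Nat.cast_le.2 h1)
      rw [Young.loops_succ, Nat.cast_sum]
      have h2 := Finset.sum_powerset_apply_card (x := Finset.univ.erase z) Young.loops
      rw [hc] at h2
      simp only [nsmul_eq_mul] at h2
      rw [← h2]
      have h3 : (Finset.univ.erase z).powerset = Finset.univ.filter fun s : Finset α => z ∉ s := by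
        ext s
        simp [Finset.subset_erase]
      rw [h3, Finset.sum_subtype (p := fun s : Finset α => z ∉ s) _ (by simp)]
      refine Finset.sum_le_sum fun s _ => ?_
      refine ih s.1.card ?_ s.1 (Fintype.card_coe _)
      have := Finset.card_le_card (show s.1 ⊆ Finset.univ.erase z from fun x hx =>
        Finset.mem_erase.2 ⟨fun h => s.2 (h ▸ hx), Finset.mem_univ _⟩)
      omega

end Setoids

namespace PartAlg

open Young

lemma card_path_succ_le {i : ℕ} {y : YoungDiagram × ℕ} {s : Finset YoungDiagram}
    (hs : ∀ x, PEdge i x y → x.1 ∈ s) :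
    Nat.card (PPath (i + 1) y) ≤ ∑ lam ∈ s, Nat.card (PPath i (lam, i / 2 - lam.card)) := by
  rw [← Finset.sum_coe_sort, ← Nat.card_sigma]
  refine Nat.card_le_card_of_injective (fun t => ⟨⟨(t.1 (Fin.last i).castSucc).1,
    hs _ (initPath_edge t)⟩, (initPath t).1, (initPath t).2.1, ?_, (initPath t).2.2.2⟩)
    fun t t' h => ?_
  · refine Prod.ext rfl ?_
    have : (t.1 (Fin.last i).castSucc).1.card + (t.1 (Fin.last i).castSucc).2 = i / 2 :=
      isVertex_of_path (initPath t)
    show (t.1 (Fin.last i).castSucc).2 = _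
    simp only []
    omega
  · have key : ∀ k, (initPath t).1 k = (initPath t').1 k := fun k =>
      congrArg (fun z : Σ lam : s, PPath i (lam.1, i / 2 - lam.1.card) => z.2.1 k) h
    refine Subtype.ext (funext fun k => ?_)
    refine Fin.lastCases ?_ (fun k => ?_) k
    · exact t.2.2.1.trans t'.2.2.1.symm
    · exact key k

lemma card_path_le {i : ℕ} {y : YoungDiagram × ℕ} :
    (Nat.card (PPath i y) : ℤ) ≤ walks i y.1 := by
  classical
  induction i generalizing y with
  | zero =>
    by_cases hy : y.1.card = 0
    · have : Subsingleton (PPath 0 y) := ⟨fun t t' => Subtype.ext (funext fun k => by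
        rw [show k = 0 from Fin.fin_one_eq_zero k, t.2.1, t'.2.1])⟩
      rw [walks, vac, if_pos hy]
      exact_mod_cast Finite.card_le_one_iff_subsingleton.2 this
    · have : IsEmpty (PPath 0 y) := ⟨fun t => hy (by
        have : y.1.card + y.2 = 0 / 2 := isVertex_of_path t
        omega)⟩
      rw [walks, vac, if_neg hy, Nat.card_of_isEmpty]
      rfl
  | succ i ih =>
    have key : ∀ s : Finset YoungDiagram, y.1 ∉ s → (∀ x, PEdge i x y → x.1 ∈ insert y.1 s) →
        (Nat.card (PPath (i + 1) y) : ℤ) ≤ walks i y.1 + ∑ lam ∈ s, walks i lam := fun s h1 h2 => by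
      rw [← Finset.sum_insert h1]
      refine (Nat.cast_le.2 (card_path_succ_le h2)).trans ?_
      rw [Nat.cast_sum]
      exact Finset.sum_le_sum fun lam _ => ih
    rcases Nat.mod_two_eq_zero_or_one i with hi | hi
    · rw [walks_even hi]
      refine key (up y.1) (fun h => ?_) fun x h => ?_
      · have := (mem_up.1 h).2
        omega
      · unfold PEdge at h
        rw [if_neg (by omega)] at h
        rcases h with ⟨-, h⟩ | ⟨-, h⟩
        · exact Finset.mem_insert.2 (Or.inl h.symm)
        · exact Finset.mem_insert_of_mem (mem_up.2 h)
    · rw [walks_odd hi]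
      refine key (down y.1) (fun h => ?_) fun x h => ?_
      · have := (mem_down.1 h).2
        omega
      · unfold PEdge at h
        rw [if_pos hi] at h
        rcases h with ⟨-, h⟩ | ⟨-, h⟩
        · exact Finset.mem_insert_of_mem (mem_down.2 h)
        · exact Finset.mem_insert.2 (Or.inl h.symm)

/-- There are at most as many pairs of paths as equivalence relations on `i` points. -/
theorem card_path_pairs_le (i : ℕ) :
    Nat.card ((x : PLam i) × (PPath i x.1 × PPath i x.1)) ≤ Nat.card (Setoid (Fin i)) := by
  classical
  have := Fintype.ofFinite (PLam i)
  rw [← Nat.cast_le (α := ℤ)]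
  refine le_trans ?_ (loops_le_card_setoid i (Fin i) (Fintype.card_fin i))
  have h1 := sum_walks_mul (n := i + i + 1) (i := i) (j := i) (by omega) rfl
  rw [show (i + i) / 2 = i by omega] at h1
  rw [← h1, Nat.card_sigma, Nat.cast_sum]
  have hinj : Set.InjOn (fun x : PLam i => x.1.1) (Finset.univ : Finset (PLam i)) := by
    intro x _ y _ h
    have hx : x.1.1.card + x.1.2 = i / 2 := isVertex_iff.2 x.2
    have hy : y.1.1.card + y.1.2 = i / 2 := isVertex_iff.2 y.2
    simp only [] at h
    rw [h] at hx
    exact Subtype.ext (Prod.ext h (by omega))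
  have h2 : ∑ lam ∈ Finset.univ.image (fun x : PLam i => x.1.1), walks i lam * walks i lam
      = ∑ x : PLam i, walks i x.1.1 * walks i x.1.1 := Finset.sum_image hinj
  refine le_trans ?_ (Finset.sum_le_sum_of_subset_of_nonneg
    (s := Finset.univ.image (fun x : PLam i => x.1.1)) ?_ fun _ _ _ => mul_self_nonneg _)
  · rw [h2]
    refine Finset.sum_le_sum fun x _ => ?_
    rw [Nat.card_prod, Nat.cast_mul]
    exact mul_le_mul card_path_le card_path_le (Nat.cast_nonneg _)
      ((Nat.cast_nonneg _).trans card_path_le)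
  · intro lam h
    obtain ⟨x, -, rfl⟩ := Finset.mem_image.1 h
    have hx : x.1.1.card + x.1.2 = i / 2 := isVertex_iff.2 x.2
    exact mem_ball.2 (by omega)

end PartAlg

end

/-! ### The action on functions of `m` letters -/

namespace Letters

variable {R : Type} [CommRing R] {K : Type} [AddCommGroup K] [Module R K] {m Q : ℕ}

variable (R K Q) in
/-- Permutation of the letters. -/
def opT : Equiv.Perm (Fin m) →* Module.End R ((Fin m → Fin Q) → K) where
  toFun σ :=
    { toFun := fun f x => f (x ∘ σ)
      map_add' := fun _ _ => rfl
      map_smul' := fun _ _ => rfl }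
  map_one' := rfl
  map_mul' _ _ := rfl

variable (R K Q) in
/-- Summation over one letter. -/
def opP (a : Fin m) : Module.End R ((Fin m → Fin Q) → K) where
  toFun f x := ∑ c, f (Function.update x a c)
  map_add' _ _ := funext fun _ => Finset.sum_add_distrib
  map_smul' c f := funext fun x =>
    (Finset.smul_sum (r := c) (f := fun d => f (Function.update x a d)) (s := Finset.univ)).symm

variable (R K Q) in
/-- Restriction to the words with two equal letters. -/
def opM (a b : Fin m) : Module.End R ((Fin m → Fin Q) → K) where
  toFun f x := if x a = x b then f x else 0
  map_add' f g := funext fun x => by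
    by_cases h : x a = x b <;> simp [h]
  map_smul' c f := funext fun x => by
    by_cases h : x a = x b <;> simp [h]

lemma opT_apply (σ : Equiv.Perm (Fin m)) (f : (Fin m → Fin Q) → K) (x : Fin m → Fin Q) :
    opT R K Q σ f x = f (x ∘ σ) := rfl

lemma opP_apply (a : Fin m) (f : (Fin m → Fin Q) → K) (x : Fin m → Fin Q) :
    opP R K Q a f x = ∑ c, f (Function.update x a c) := rfl

lemma opM_apply (a b : Fin m) (f : (Fin m → Fin Q) → K) (x : Fin m → Fin Q) :
    opM R K Q a b f x = if x a = x b then f x else 0 := rfl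

lemma opT_opP (σ : Equiv.Perm (Fin m)) (a : Fin m) :
    opT R K Q σ * opP R K Q a = opP R K Q (σ a) * opT R K Q σ := by
  refine LinearMap.ext fun f => funext fun x => ?_
  simp only [Module.End.mul_apply, opT_apply, opP_apply]
  refine Finset.sum_congr rfl fun c _ => ?_
  rw [Function.update_comp_equiv, Equiv.symm_apply_apply]

lemma opT_opM (σ : Equiv.Perm (Fin m)) (a b : Fin m) :
    opT R K Q σ * opM R K Q a b = opM R K Q (σ a) (σ b) * opT R K Q σ := rfl

lemma opP_comm (a b : Fin m) : opP R K Q a * opP R K Q b = opP R K Q b * opP R K Q a := by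
  by_cases hab : a = b
  · rw [hab]
  refine LinearMap.ext fun f => funext fun x => ?_
  simp only [Module.End.mul_apply, opP_apply]
  rw [Finset.sum_comm]
  refine Finset.sum_congr rfl fun c _ => Finset.sum_congr rfl fun d _ => ?_
  rw [Function.update_comm hab]

lemma opP_sq {δ : R} (hδ : ∀ k : K, δ • k = Q • k) (a : Fin m) :
    opP R K Q a * opP R K Q a = δ • opP R K Q a := by
  refine LinearMap.ext fun f => funext fun x => ?_
  simp only [Module.End.mul_apply, opP_apply, Function.update_idem, LinearMap.smul_apply,
    Pi.smul_apply, hδ, Finset.sum_const, Finset.card_univ, Fintype.card_fin]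

lemma opM_comm (a b c d : Fin m) :
    opM R K Q a b * opM R K Q c d = opM R K Q c d * opM R K Q a b := by
  refine LinearMap.ext fun f => funext fun x => ?_
  simp only [Module.End.mul_apply, opM_apply]
  split_ifs <;> rfl

lemma opM_symm (a b : Fin m) : opM R K Q a b = opM R K Q b a := by
  refine LinearMap.ext fun f => funext fun x => ?_
  simp only [opM_apply, eq_comm]

lemma opM_idem (a b : Fin m) : opM R K Q a b * opM R K Q a b = opM R K Q a b := by
  refine LinearMap.ext fun f => funext fun x => ?_
  simp only [Module.End.mul_apply, opM_apply]
  split_ifs <;> rfl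

lemma opM_self (a : Fin m) : opM R K Q a a = 1 := by
  refine LinearMap.ext fun f => funext fun x => if_pos rfl

lemma opP_opM {a b c : Fin m} (hb : a ≠ b) (hc : a ≠ c) :
    opP R K Q a * opM R K Q b c = opM R K Q b c * opP R K Q a := by
  refine LinearMap.ext fun f => funext fun x => ?_
  simp only [Module.End.mul_apply, opM_apply, opP_apply, Function.update_of_ne hb.symm,
    Function.update_of_ne hc.symm]
  split_ifs
  · rfl
  · exact Finset.sum_const_zero

lemma comp_swap_of_eq {x : Fin m → Fin Q} {a b : Fin m} (h : x a = x b) :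
    x ∘ Equiv.swap a b = x := by
  funext c
  rw [Function.comp_apply, Equiv.swap_apply_def]
  split_ifs with h1 h2
  · rw [h1, h]
  · rw [h2, h]
  · rfl

lemma opT_swap_opM (a b : Fin m) : opT R K Q (Equiv.swap a b) * opM R K Q a b = opM R K Q a b := by
  refine LinearMap.ext fun f => funext fun x => ?_
  rw [Module.End.mul_apply, opT_apply, opM_apply, opM_apply, Function.comp_apply,
    Function.comp_apply, Equiv.swap_apply_left, Equiv.swap_apply_right]
  by_cases h : x a = x b
  · rw [if_pos h, if_pos h.symm, comp_swap_of_eq h]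
  · rw [if_neg h, if_neg (Ne.symm h)]

lemma opM_opT_swap (a b : Fin m) : opM R K Q a b * opT R K Q (Equiv.swap a b) = opM R K Q a b := by
  have h := opT_opM (R := R) (K := K) (Q := Q) (Equiv.swap a b) a b
  rw [opT_swap_opM, Equiv.swap_apply_left, Equiv.swap_apply_right, opM_symm b a] at h
  exact h.symm

lemma opT_swap_opP {a b : Fin m} (hab : a ≠ b) :
    opT R K Q (Equiv.swap a b) * (opP R K Q a * opP R K Q b) = opP R K Q a * opP R K Q b := by
  refine LinearMap.ext fun f => funext fun x => ?_
  simp only [Module.End.mul_apply, opT_apply, opP_apply]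
  refine Finset.sum_congr rfl fun c _ => Finset.sum_congr rfl fun d _ => congrArg f ?_
  funext k
  by_cases hb : k = b
  · rw [hb, Function.update_self, Function.update_self]
  by_cases ha : k = a
  · rw [ha, Function.update_of_ne hab, Function.update_self, Function.update_of_ne hab,
      Function.update_self]
  · rw [Function.update_of_ne hb, Function.update_of_ne ha, Function.update_of_ne hb,
      Function.update_of_ne ha, Function.comp_apply, Equiv.swap_apply_of_ne_of_ne ha hb]

lemma opP_opT_swap {a b : Fin m} (hab : a ≠ b) :
    opP R K Q a * opP R K Q b * opT R K Q (Equiv.swap a b) = opP R K Q a * opP R K Q b := by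
  have h := opT_swap_opP (R := R) (K := K) (Q := Q) hab
  rw [← mul_assoc, opT_opP, mul_assoc, opT_opP, Equiv.swap_apply_left, Equiv.swap_apply_right,
    ← mul_assoc, opP_comm b a] at h
  exact h

lemma opP_opM_opP {a b : Fin m} (hab : a ≠ b) :
    opP R K Q a * opM R K Q a b * opP R K Q a = opP R K Q a := by
  refine LinearMap.ext fun f => funext fun x => ?_
  simp only [Module.End.mul_apply, opM_apply, opP_apply, Function.update_self,
    Function.update_of_ne hab.symm, Function.update_idem]
  rw [Finset.sum_ite_eq' Finset.univ (x b), if_pos (Finset.mem_univ _)]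

lemma opM_opP_opM {a b : Fin m} (hab : a ≠ b) :
    opM R K Q a b * opP R K Q a * opM R K Q a b = opM R K Q a b := by
  refine LinearMap.ext fun f => funext fun x => ?_
  simp only [Module.End.mul_apply, opM_apply, opP_apply, Function.update_self,
    Function.update_of_ne hab.symm]
  rw [Finset.sum_ite_eq' Finset.univ (x b), if_pos (Finset.mem_univ _)]
  by_cases h : x a = x b
  · rw [if_pos h, if_pos h, ← h, Function.update_eq_self]
  · rw [if_neg h, if_neg h]

variable (R K Q) in
/-- The operators of the generators. -/
def opGen : PGen m → Module.End R ((Fin m → Fin Q) → K)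
  | .ts j => opT R K Q (Equiv.swap ⟨j.1 - 1, by have := j.2; omega⟩ ⟨j.1, j.2.2⟩)
  | .p j => opP R K Q ⟨j.1 - 1, by have := j.2; omega⟩
  | .ph j => opM R K Q ⟨j.1 - 1, by have := j.2; omega⟩ ⟨j.1, j.2.2⟩

lemma lift_opGen_rel {δ : R} (hδ : ∀ k : K, δ • k = Q • k) {x y : FreeAlgebra R (PGen m)}
    (h : PARel R δ m x y) :
    FreeAlgebra.lift R (opGen R K Q) x = FreeAlgebra.lift R (opGen R K Q) y := by
  have hne : ∀ {a b : ℕ} {ha : a < m} {hb : b < m}, a ≠ b → (⟨a, ha⟩ : Fin m) ≠ ⟨b, hb⟩ :=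
    fun h e => h (congrArg Fin.val e)
  induction h with
  | coxInv i =>
    simp only [map_mul, FreeAlgebra.lift_ι_apply, opGen, map_one]
    rw [← map_mul, Equiv.swap_mul_self, map_one]
  | coxComm i j h =>
    obtain ⟨i, hi⟩ := i
    obtain ⟨j, hj⟩ := j
    simp only [map_mul, FreeAlgebra.lift_ι_apply, opGen] at h ⊢
    rw [← map_mul, ← map_mul]
    congr 1
    refine (Equiv.Perm.Disjoint.commute ?_).eq
    refine Equiv.Perm.disjoint_iff_eq_or_eq.2 fun z => ?_
    by_cases hz : z.val = i - 1 ∨ z.val = i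
    · right
      exact Equiv.swap_apply_of_ne_of_ne
        (fun e => by have e' : z.val = j - 1 := congrArg Fin.val e; omega)
        (fun e => by have e' : z.val = j := congrArg Fin.val e; omega)
    · left
      exact Equiv.swap_apply_of_ne_of_ne
        (fun e => by have e' : z.val = i - 1 := congrArg Fin.val e; omega)
        (fun e => by have e' : z.val = i := congrArg Fin.val e; omega)
  | coxBraid i j h =>
    obtain ⟨i, hi⟩ := i
    obtain ⟨j, hj⟩ := j
    simp only [map_mul, FreeAlgebra.lift_ι_apply, opGen] at h ⊢
    subst h
    rw [← map_mul, ← map_mul, ← map_mul, ← map_mul]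
    simp only [Nat.add_sub_cancel]
    have e := Equiv.swap_mul_swap_mul_swap (x := (⟨i + 1, hj.2⟩ : Fin m)) (y := ⟨i, hi.2⟩)
      (z := ⟨i - 1, by omega⟩) (hne (by omega)) (hne (by omega))
    rw [Equiv.swap_comm (⟨i, hi.2⟩ : Fin m) ⟨i - 1, by omega⟩,
      Equiv.swap_comm (⟨i + 1, hj.2⟩ : Fin m) ⟨i, hi.2⟩] at e
    rw [e, Equiv.swap_mul_swap_mul_swap (hne (by omega)) (hne (by omega)), Equiv.swap_comm]
  | pIdem i =>
    simp only [map_mul, FreeAlgebra.lift_ι_apply, opGen, AlgHom.commutes]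
    rw [opP_sq hδ, Algebra.smul_def]
  | phIdem i =>
    simp only [map_mul, FreeAlgebra.lift_ι_apply, opGen]
    exact opM_idem _ _
  | tsPhL i j h =>
    obtain ⟨i, hi⟩ := i
    obtain ⟨j, hj⟩ := j
    simp only [map_mul, FreeAlgebra.lift_ι_apply, opGen] at h ⊢
    subst h
    exact opT_swap_opM _ _
  | tsPhR i j h =>
    obtain ⟨i, hi⟩ := i
    obtain ⟨j, hj⟩ := j
    simp only [map_mul, FreeAlgebra.lift_ι_apply, opGen] at h ⊢
    subst h
    exact opM_opT_swap _ _
  | tsPPL i j k h =>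
    obtain ⟨i, hi⟩ := i
    obtain ⟨j, hj⟩ := j
    obtain ⟨k, hk⟩ := k
    simp only [map_mul, FreeAlgebra.lift_ι_apply, opGen] at h ⊢
    obtain ⟨rfl, rfl⟩ := h
    exact opT_swap_opP (hne (by omega))
  | tsPPR i j k h =>
    obtain ⟨i, hi⟩ := i
    obtain ⟨j, hj⟩ := j
    obtain ⟨k, hk⟩ := k
    simp only [map_mul, FreeAlgebra.lift_ι_apply, opGen] at h ⊢
    obtain ⟨rfl, rfl⟩ := h
    exact opP_opT_swap (hne (by omega))
  | ppComm i j =>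
    simp only [map_mul, FreeAlgebra.lift_ι_apply, opGen]
    exact opP_comm _ _
  | phphComm i j =>
    simp only [map_mul, FreeAlgebra.lift_ι_apply, opGen]
    exact opM_comm _ _ _ _
  | pPhComm i j h =>
    obtain ⟨i, hi⟩ := i
    obtain ⟨j, hj⟩ := j
    simp only [map_mul, FreeAlgebra.lift_ι_apply, opGen] at h ⊢
    exact opP_opM (hne (by omega)) (hne (by omega))
  | tsPComm i j h =>
    obtain ⟨i, hi⟩ := i
    obtain ⟨j, hj⟩ := j
    simp only [map_mul, FreeAlgebra.lift_ι_apply, opGen] at h ⊢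
    rw [opT_opP, Equiv.swap_apply_of_ne_of_ne (hne (by omega)) (hne (by omega))]
  | tsPhComm i j h =>
    obtain ⟨i, hi⟩ := i
    obtain ⟨j, hj⟩ := j
    simp only [map_mul, FreeAlgebra.lift_ι_apply, opGen] at h ⊢
    by_cases hij : i = j
    · subst hij
      rw [opT_swap_opM, opM_opT_swap]
    · rw [opT_opM, Equiv.swap_apply_of_ne_of_ne (hne (by omega)) (hne (by omega)),
        Equiv.swap_apply_of_ne_of_ne (hne (by omega)) (hne (by omega))]
  | tsPTs i j k h =>
    obtain ⟨i, hi⟩ := i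
    obtain ⟨j, hj⟩ := j
    obtain ⟨k, hk⟩ := k
    simp only [map_mul, FreeAlgebra.lift_ι_apply, opGen] at h ⊢
    obtain ⟨rfl, rfl⟩ := h
    rw [opT_opP, mul_assoc, ← map_mul, Equiv.swap_mul_self, map_one, mul_one,
      Equiv.swap_apply_left]
    rfl
  | tsPhTs i i' j j' h =>
    obtain ⟨i, hi⟩ := i
    obtain ⟨i', hi'⟩ := i'
    obtain ⟨j, hj⟩ := j
    obtain ⟨j', hj'⟩ := j'
    simp only [map_mul, FreeAlgebra.lift_ι_apply, opGen] at h ⊢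
    obtain ⟨rfl, h, rfl⟩ := h
    obtain rfl : j = i' := by omega
    simp only [Nat.add_sub_cancel]
    rw [opT_opM, mul_assoc, ← map_mul, Equiv.swap_mul_self, map_one, mul_one, opT_opM, mul_assoc,
      ← map_mul, Equiv.swap_mul_self, map_one, mul_one, Equiv.swap_apply_left,
      Equiv.swap_apply_right, Equiv.swap_apply_of_ne_of_ne (hne (by omega)) (hne (by omega)),
      Equiv.swap_apply_of_ne_of_ne (hne (by omega)) (hne (by omega))]
  | phPPh i j h =>
    obtain ⟨i, hi⟩ := i
    obtain ⟨j, hj⟩ := j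
    simp only [map_mul, FreeAlgebra.lift_ι_apply, opGen] at h ⊢
    rcases h with rfl | rfl
    · exact opM_opP_opM (hne (by omega))
    · rw [opM_symm]
      exact opM_opP_opM (hne (by omega))
  | pPhP i j h =>
    obtain ⟨i, hi⟩ := i
    obtain ⟨j, hj⟩ := j
    simp only [map_mul, FreeAlgebra.lift_ι_apply, opGen] at h ⊢
    rcases h with rfl | rfl
    · exact opP_opM_opP (hne (by omega))
    · rw [opM_symm]
      exact opP_opM_opP (hne (by omega))

/-- A homomorphism from the partition algebra given by the operators on letters. -/
structure IsAction [NeZero m] {δ : R} {T : Equiv.Perm (Fin m) →* PA R δ m}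
    (φ : PA R δ m →ₐ[R] Module.End R ((Fin m → Fin Q) → K)) : Prop where
  map_T : ∀ σ, φ (T σ) = opT R K Q σ
  map_P : ∀ a, φ (PartAlg.pP R δ a) = opP R K Q a
  map_M : ∀ a b, φ (PartAlg.pM T a b) = opM R K Q a b

open PartAlg in
lemma exists_action [NeZero m] {δ : R} (hδ : ∀ k : K, δ • k = Q • k)
    {T : Equiv.Perm (Fin m) →* PA R δ m} (hT : IsT T) :
    ∃ φ : PA R δ m →ₐ[R] Module.End R ((Fin m → Fin Q) → K), IsAction (T := T) φ := by
  let φ : PA R δ m →ₐ[R] Module.End R ((Fin m → Fin Q) → K) := RingQuot.liftAlgHom R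
    ⟨FreeAlgebra.lift R (opGen R K Q), fun _ _ => lift_opGen_rel hδ⟩
  have hφ : ∀ g, φ (RingQuot.mkAlgHom R (PARel R δ m) (FreeAlgebra.ι R g)) = opGen R K Q g :=
    fun g => by rw [RingQuot.liftAlgHom_mkAlgHom_apply, FreeAlgebra.lift_ι_apply]
  have h1 : ∀ σ, φ (T σ) = opT R K Q σ := by
    let G : Submonoid (Equiv.Perm (Fin m)) :=
      { carrier := {w | φ (T w) = opT R K Q w}
        one_mem' := by
          show φ (T 1) = opT R K Q 1
          rw [map_one, map_one, map_one]
        mul_mem' := fun {v w} hv hw => by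
          show φ (T (v * w)) = opT R K Q (v * w)
          rw [map_mul, map_mul, map_mul, show φ (T v) = _ from hv, show φ (T w) = _ from hw] }
    exact mem_of_forall_swN G fun j hj1 hj2 => by
      show φ (T (swN m j)) = opT R K Q (swN m j)
      rw [hT j hj1 hj2, paT_of ⟨hj1, hj2⟩, hφ, swN_of hj1 hj2]
      rfl
  refine ⟨φ, h1, fun a => ?_, fun a b => ?_⟩
  · rw [pP, paP_of ⟨by omega, a.isLt⟩, hφ]
    rfl
  · by_cases hab : a = b
    · rw [pM, if_pos hab, map_one, hab, opM_self]
    · obtain ⟨hm, g, h0, h1', e, -⟩ := exists_conj_two hT hab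
      have e1 : φ (paPh R δ m 1) = opM R K Q (pt m 0) (pt m 1) := by
        rw [paPh_of ⟨le_rfl, hm⟩, hφ]
        refine congrArg₂ (opM R K Q) (Fin.ext ?_) (Fin.ext ?_)
        · rw [pt_val (by omega)]
          rfl
        · rw [pt_val (by omega)]
      rw [e]
      show φ (T g * paPh R δ m 1 * T g⁻¹) = _
      rw [map_mul, map_mul, h1, h1, e1, opT_opM, mul_assoc, ← map_mul, mul_inv_cancel, map_one,
        mul_one, h0, h1']

end Letters

namespace Letters

open PartAlg Classical

variable {R : Type} [CommRing R] {δ : R} {m i : ℕ} [NeZero m] {T : Equiv.Perm (Fin m) →* PA R δ m}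
  (hT : IsT T)

lemma IsAction.pData_PS_single {K : Type} [AddCommGroup K] [Module R K] {Q : ℕ}
    {φ : PA R δ m →ₐ[R] Module.End R ((Fin m → Fin Q) → K)} (hφ : IsAction (T := T) φ)
    (U : Finset (Fin m)) (y x : Fin m → Fin Q) (k : K) :
    φ ((pData hT).PS U) (Pi.single y k) x = if ∀ b, b ∉ U → x b = y b then k else 0 := by
  induction U using Finset.induction_on generalizing x with
  | empty =>
    rw [PData.PS_empty, map_one, Module.End.one_apply, Pi.single_apply]
    simp [funext_iff]
  | insert a U ha ih =>
    have hP : φ ((pData hT).P a) = opP R K Q a := hφ.map_P a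
    rw [PData.PS_insert _ ha, map_mul, Module.End.mul_apply, hP, opP_apply]
    simp only [ih]
    have key : ∀ c, (∀ b, b ∉ U → Function.update x a c b = y b) ↔
        y a = c ∧ ∀ b, b ∉ insert a U → x b = y b := by
      refine fun c => ⟨fun h => ⟨?_, fun b hb => ?_⟩, fun h b hb => ?_⟩
      · rw [← h a ha, Function.update_self]
      · rw [Finset.mem_insert, not_or] at hb
        rw [← h b hb.2, Function.update_of_ne hb.1]
      · by_cases hba : b = a
        · rw [hba, Function.update_self, h.1]
        · rw [Function.update_of_ne hba]
          exact h.2 b fun hb' => (Finset.mem_insert.1 hb').elim hba hb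
    simp only [key, ite_and]
    rw [Finset.sum_ite_eq Finset.univ (y a), if_pos (Finset.mem_univ _)]

lemma exists_restrict (hm : m ≤ (i + 1) / 2) (s : Finset (Fin m × Fin m)) :
    ∃ x ∈ (pData hT).W i, ∀ (Q : ℕ) (K : Type) [AddCommGroup K] [Module R K]
      (φ : PA R δ m →ₐ[R] Module.End R ((Fin m → Fin Q) → K)), IsAction (T := T) φ →
      ∀ f z, φ x f z = if ∀ p ∈ s, z p.1 = z p.2 then f z else 0 := by
  induction s using Finset.induction_on with
  | empty =>
    refine ⟨1, one_mem _, fun Q K _ _ φ _ f z => ?_⟩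
    rw [map_one, Module.End.one_apply, if_pos (by simp)]
  | insert p s _ ih =>
    obtain ⟨x, hx, e⟩ := ih
    have hmem : ∀ a : Fin m, a ∈ Seg m 0 ((i + 1) / 2) := fun a =>
      mem_Seg.2 ⟨Nat.zero_le _, a.isLt.trans_le hm⟩
    refine ⟨(pData hT).M p.1 p.2 * x, mul_mem ((pData hT).M_mem_Alg (hmem _) (hmem _)) hx,
      fun Q K _ _ φ hφ f z => ?_⟩
    have hM : φ ((pData hT).M p.1 p.2) = opM R K Q p.1 p.2 := hφ.map_M _ _
    rw [map_mul, Module.End.mul_apply, hM, opM_apply, e Q K φ hφ]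
    simp only [Finset.forall_mem_insert, ite_and]

/-- The element gluing the top points according to `u` and the bottom points according to `v`. -/
lemma exists_gluing (hm : m ≤ (i + 1) / 2) {Y : Type} (u v : Fin m → Y)
    (huv : ∀ c : Fin m, i / 2 ≤ c.val → u c = v c) :
    ∃ x ∈ (pData hT).W i, ∀ (Q : ℕ) (K : Type) [AddCommGroup K] [Module R K]
      (φ : PA R δ m →ₐ[R] Module.End R ((Fin m → Fin Q) → K)), IsAction (T := T) φ →
      ∀ y k z, φ x (Pi.single y k) z = if (∀ a b, u a = u b → z a = z b) ∧
        (∀ a b, v a = v b → y a = y b) ∧ (∀ a b, u a = v b → z a = y b) then k else 0 := by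
  obtain ⟨x₁, hx₁, e₁⟩ := exists_restrict hT hm (Finset.univ.filter fun p => u p.1 = u p.2)
  obtain ⟨x₂, hx₂, e₂⟩ := exists_restrict hT hm (Finset.univ.filter fun p => v p.1 = v p.2)
  simp only [Finset.mem_filter, Finset.mem_univ, true_and, Prod.forall] at e₁ e₂
  have hrep : ∀ q : {q : Y // (∃ a, u a = q) ∧ ∃ b, v b = q}, ∃ a b, u a = q.1 ∧ v b = q.1 ∧
      ∀ c : Fin m, i / 2 ≤ c.val → u c = q.1 → a = c ∧ b = c := by
    rintro ⟨q, ⟨a, ha⟩, b, hb⟩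
    by_cases h : ∃ c : Fin m, i / 2 ≤ c.val ∧ u c = q
    · obtain ⟨c, hc, hcq⟩ := h
      refine ⟨c, c, hcq, (huv c hc).symm.trans hcq, fun c' hc' _ => ?_⟩
      have : c = c' := Fin.ext (by have := c.isLt; have := c'.isLt; omega)
      exact ⟨this, this⟩
    · exact ⟨a, b, ha, hb, fun c hc hcq => (h ⟨c, hc, hcq⟩).elim⟩
  choose g f hg hf hgf using hrep
  have hginj : Function.Injective g := fun p q h => Subtype.ext (by rw [← hg p, ← hg q, h])
  have hfinj : Function.Injective f := fun p q h => Subtype.ext (by rw [← hf p, ← hf q, h])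
  have hcap : ∀ c : Fin m, i / 2 ≤ c.val → ∃ q, f q = c ∧ g q = c := fun c hc =>
    ⟨⟨u c, ⟨c, rfl⟩, c, (huv c hc).symm⟩, (hgf _ c hc rfl).2, (hgf _ c hc rfl).1⟩
  have hfin := Finite.of_injective f hfinj
  obtain ⟨σ, hσ⟩ := Equiv.Perm.exists_extending_pair f g hfinj hginj
  have hTσ : T σ ∈ (pData hT).W i := (pData hT).T_mem_W le_rfl (PData.mem_HN.2 fun a ha => by
    obtain ⟨q, h1, h2⟩ := hcap a ha
    rw [← h1, hσ, h1, h2])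
  set U : Finset (Fin m) := Finset.univ.filter fun a => a ∉ Set.range f with hU
  have hPU : (pData hT).PS U ∈ (pData hT).W i := (pData hT).PS_mem_Alg fun a ha => by
    refine mem_Seg.2 ⟨Nat.zero_le _, Nat.lt_of_not_le fun h => ?_⟩
    obtain ⟨q, h1, -⟩ := hcap a h
    exact (Finset.mem_filter.1 ha).2 ⟨q, h1⟩
  refine ⟨x₁ * (T σ * ((pData hT).PS U * x₂)), mul_mem hx₁ (mul_mem hTσ (mul_mem hPU hx₂)),
    fun Q K _ _ φ hφ y k z => ?_⟩
  have h2 : φ x₂ (Pi.single y k) =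
      Pi.single y (if ∀ a b, v a = v b → y a = y b then k else 0) := by
    funext w
    rw [e₂ Q K φ hφ, Pi.single_apply, Pi.single_apply]
    by_cases hw : w = y
    · rw [hw, if_pos rfl, if_pos rfl]
    · rw [if_neg hw, if_neg hw, ite_self]
  rw [map_mul, map_mul, map_mul, Module.End.mul_apply, Module.End.mul_apply, Module.End.mul_apply,
    h2, e₁ Q K φ hφ, hφ.map_T, opT_apply, hφ.pData_PS_single hT]
  simp only [← ite_and]
  refine if_congr ⟨fun ⟨h1, h3, h4⟩ => ⟨h1, h4, fun a b hab => ?_⟩,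
    fun ⟨h1, h3, h4⟩ => ⟨h1, fun b hb => ?_, h3⟩⟩ rfl rfl
  · let q : {q : Y // (∃ a, u a = q) ∧ ∃ b, v b = q} := ⟨u a, ⟨a, rfl⟩, b, hab.symm⟩
    have h5 := h3 (f q) fun h => (Finset.mem_filter.1 h).2 ⟨q, rfl⟩
    rw [Function.comp_apply, hσ] at h5
    rw [h1 a (g q) (hg q).symm, h5]
    exact h4 _ _ ((hf q).trans hab)
  · obtain ⟨q, rfl⟩ : b ∈ Set.range f := by
      by_contra h
      exact hb (Finset.mem_filter.2 ⟨Finset.mem_univ _, h⟩)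
    rw [Function.comp_apply, hσ]
    exact h4 _ _ ((hg q).trans (hf q).symm)

lemma exists_setoid_elements (hm : m = (i + 1) / 2) :
    ∃ (α β : Fin m → Fin i) (x : Setoid (Fin i) → PA R δ m), (∀ π, x π ∈ (pData hT).W i) ∧
      ∀ (Q : ℕ) (K : Type) [AddCommGroup K] [Module R K]
      (φ : PA R δ m →ₐ[R] Module.End R ((Fin m → Fin Q) → K)), IsAction (T := T) φ →
      ∀ π (z : Fin i → Fin Q) (k : K), φ (x π) (Pi.single (z ∘ β) k) (z ∘ α) =
        if π ≤ Setoid.ker z then k else 0 := by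
  let α : Fin m → Fin i := fun c => ⟨c.val, by have := c.isLt; omega⟩
  let β : Fin m → Fin i := fun c =>
    if h : c.val < i / 2 then ⟨m + c.val, by omega⟩ else ⟨c.val, by have := c.isLt; omega⟩
  have hsurj : ∀ p : Fin i, (∃ a, α a = p) ∨ ∃ b, β b = p := fun p => by
    by_cases hp : p.val < m
    · exact Or.inl ⟨⟨p.val, hp⟩, rfl⟩
    · have h : p.val - m < i / 2 := by have := p.isLt; omega
      refine Or.inr ⟨⟨p.val - m, by omega⟩, ?_⟩
      rw [show β ⟨p.val - m, _⟩ = ⟨m + (p.val - m), _⟩ from dif_pos h]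
      exact Fin.ext (by simp only []; omega)
  have hαβ : ∀ c : Fin m, i / 2 ≤ c.val → α c = β c := fun c hc => by
    show α c = dite _ _ _
    rw [dif_neg (Nat.not_lt.2 hc)]
  clear_value α β
  have h := fun π : Setoid (Fin i) => exists_gluing hT hm.le (fun c => (⟦α c⟧ : Quotient π))
    (fun c => ⟦β c⟧) fun c hc => congrArg _ (hαβ c hc)
  choose x hx e using h
  refine ⟨α, β, x, hx, fun Q K _ _ φ hφ π z k => ?_⟩
  rw [e π Q K φ hφ]
  have key : ((∀ a b, (⟦α a⟧ : Quotient π) = ⟦α b⟧ → (z ∘ α) a = (z ∘ α) b) ∧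
      (∀ a b, (⟦β a⟧ : Quotient π) = ⟦β b⟧ → (z ∘ β) a = (z ∘ β) b) ∧
      ∀ a b, (⟦α a⟧ : Quotient π) = ⟦β b⟧ → (z ∘ α) a = (z ∘ β) b) ↔ π ≤ Setoid.ker z := by
    simp only [Function.comp_apply, Quotient.eq]
    refine ⟨fun h => Setoid.le_def.2 fun {p q} hpq => ?_, fun h => ⟨fun a b => @h _ _, fun a b => @h _ _,
      fun a b => @h _ _⟩⟩
    obtain ⟨h1, h2, h3⟩ := h
    show z p = z q
    rcases hsurj p with ⟨a, ha⟩ | ⟨a, ha⟩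
    · subst ha
      rcases hsurj q with ⟨b, hb⟩ | ⟨b, hb⟩
      · subst hb
        exact h1 _ _ hpq
      · subst hb
        exact h3 _ _ hpq
    · subst ha
      rcases hsurj q with ⟨b, hb⟩ | ⟨b, hb⟩
      · subst hb
        exact (h3 _ _ (π.symm hpq)).symm
      · subst hb
        exact h2 _ _ hpq
  by_cases h : π ≤ Setoid.ker z
  · rw [if_pos h, if_pos (key.2 h)]
  · rw [if_neg h, if_neg fun h' => h (key.1 h')]

lemma exists_ker_eq {Q : ℕ} (hQ : i ≤ Q) (ρ : Setoid (Fin i)) :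
    ∃ z : Fin i → Fin Q, Setoid.ker z = ρ := by
  have hcard : Fintype.card (Quotient ρ) ≤ Fintype.card (Fin Q) :=
    (Fintype.card_quotient_le ρ).trans (by simpa using hQ)
  obtain ⟨f⟩ := Function.Embedding.nonempty_of_card_le hcard
  refine ⟨fun p => f ⟦p⟧, Setoid.ext fun p q => ?_⟩
  show f ⟦p⟧ = f ⟦q⟧ ↔ _
  rw [f.injective.eq_iff, Quotient.eq]

/-- Setoids index linearly independent elements of the partition algebra over `ℤ[X]`. -/
lemma exists_linearIndependent_setoid {m : ℕ} [NeZero m]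
    {T : Equiv.Perm (Fin m) →* PA (Polynomial ℤ) Polynomial.X m} (hT : IsT T)
    (hm : m = (i + 1) / 2) :
    ∃ x : Setoid (Fin i) → PA (Polynomial ℤ) Polynomial.X m,
      (∀ π, x π ∈ (pData hT).W i) ∧ LinearIndependent (Polynomial ℤ) x := by
  obtain ⟨α, β, x, hx, e⟩ := exists_setoid_elements hT hm
  have := Fintype.ofFinite (Setoid (Fin i))
  refine ⟨x, hx, Fintype.linearIndependent_iff.2 fun c hc ρ => ?_⟩
  refine Polynomial.eq_zero_of_infinite_isRoot _ (Set.Infinite.mono ?_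
    ((Set.Ici_infinite i).image (Nat.cast_injective (R := ℤ)).injOn))
  rintro _ ⟨Q, hQ, rfl⟩
  let _ : Module (Polynomial ℤ) ℤ := Module.compHom ℤ (Polynomial.evalRingHom (Q : ℤ))
  have hsmul : ∀ (p : Polynomial ℤ) (k : ℤ), p • k = p.eval (Q : ℤ) * k := fun _ _ => rfl
  obtain ⟨φ, hφ⟩ := exists_action (K := ℤ) (Q := Q)
    (fun k => by rw [hsmul, Polynomial.eval_X, nsmul_eq_mul]) hT
  show (c ρ).eval (Q : ℤ) = 0
  induction ρ using WellFoundedLT.induction with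
  | _ ρ ih =>
    obtain ⟨z, hz⟩ := exists_ker_eq hQ ρ
    have h0 : ∑ π, c π • φ (x π) (Pi.single (z ∘ β) 1) (z ∘ α) = 0 := by
      have := congrFun (LinearMap.congr_fun (congrArg φ hc) (Pi.single (z ∘ β) 1)) (z ∘ α)
      simpa only [map_sum, map_smul, LinearMap.sum_apply, LinearMap.smul_apply, Finset.sum_apply,
        Pi.smul_apply, map_zero, LinearMap.zero_apply, Pi.zero_apply] using this
    simp only [e Q ℤ φ hφ, hz, hsmul] at h0
    rw [Finset.sum_eq_single ρ, if_pos le_rfl, mul_one] at h0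
    · exact h0
    · intro π _ hne
      by_cases hle : π ≤ ρ
      · rw [ih π (lt_of_le_of_ne hle hne), zero_mul]
      · rw [if_neg hle, mul_zero]
    · exact fun h => (h (Finset.mem_univ _)).elim

end Letters

/-- A spanning family that is no larger than a linearly independent one is linearly
independent. -/
lemma linearIndependent_of_card_le {S A I J : Type} [CommRing S] [IsDomain S] [AddCommGroup A]
    [Module S A] [Finite I] [Finite J] {f : I → A} {g : J → A} (hg : LinearIndependent S g)
    (hgf : ∀ j, g j ∈ Submodule.span S (Set.range f)) (hcard : Nat.card I ≤ Nat.card J) :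
    LinearIndependent S f := by
  rw [LinearIndependent, ← LinearMap.ker_eq_bot]
  have hrange : ∀ j, g j ∈ LinearMap.range (Finsupp.linearCombination S f) := fun j => by
    rw [Finsupp.range_linearCombination]
    exact hgf j
  let g' : J → LinearMap.range (Finsupp.linearCombination S f) := fun j => ⟨g j, hrange j⟩
  have hg' : LinearIndependent S g' :=
    LinearIndependent.of_comp (LinearMap.range (Finsupp.linearCombination S f)).subtype hg
  have h1 := hg'.cardinal_le_rank
  have h2 := LinearMap.rank_range_add_rank_ker (Finsupp.linearCombination S f)
  rw [rank_finsupp_self'] at h2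
  refine (Submodule.rank_eq_zero (R := S)).1 ?_
  rw [← Nat.cast_card (α := I)] at h2
  rw [← Nat.cast_card (α := J)] at h1
  have h3 : (Nat.card I : Cardinal) ≤ Nat.card J := by exact_mod_cast hcard
  have h4 : Module.rank S (LinearMap.range (Finsupp.linearCombination S f)) = Nat.card I :=
    le_antisymm (h2 ▸ self_le_add_right _ _) (h3.trans h1)
  rw [h4] at h2
  exact Cardinal.eq_of_add_eq_add_left (h2.trans (add_zero _).symm) Cardinal.natCast_lt_aleph0

/-- **Statement 18** (Murphy-type cellular basis of the partition algebras).
Let `R = ℤ[δ]` (`δ` an indeterminate), and for `i ≥ 0` let `A_{2k} = 𝒜_k(R; δ)` and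
`A_{2k+1} = 𝒜_{k+1/2}(R; δ)` be the partition algebras, with `e_{2k-1} = p_k` and
`e_{2k} = p_{k+1/2}`, with involution `*` fixing the generators and with `t_v`
(`v ∈ S_m`) determined by reduced expressions.  Then for each `i ≥ 1` the set
`𝒜_i = {d_s* c_{(λ,l)} d_t : (λ,l) ∈ Â_i, s,t ∈ Â_i^{(λ,l)}, 0 ≤ l ≤ ⌊i/2⌋}` is an
`R`-basis of `A_i`, and `(A_i, *, Â_i, ⊵, 𝒜_i)` is a cell datum for `A_i`. -/
theorem partition_algebra_cellular_basis
    (i : ℕ) (hi : 1 ≤ i)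
    -- the involution of the ambient partition algebra, fixing the generators
    (st : PA (Polynomial ℤ) Polynomial.X ((i + 1) / 2) →ₗ[Polynomial ℤ]
      PA (Polynomial ℤ) Polynomial.X ((i + 1) / 2))
    (hst_mul : ∀ x y, st (x * y) = st y * st x)
    (hst_st : ∀ x, st (st x) = x)
    (hst_t : ∀ j : ℕ, st (paT (Polynomial ℤ) Polynomial.X ((i + 1) / 2) j)
      = paT (Polynomial ℤ) Polynomial.X ((i + 1) / 2) j)
    (hst_p : ∀ j : ℕ, st (paP (Polynomial ℤ) Polynomial.X ((i + 1) / 2) j)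
      = paP (Polynomial ℤ) Polynomial.X ((i + 1) / 2) j)
    (hst_ph : ∀ j : ℕ, st (paPh (Polynomial ℤ) Polynomial.X ((i + 1) / 2) j)
      = paPh (Polynomial ℤ) Polynomial.X ((i + 1) / 2) j)
    -- the elements t_v, characterized by reduced expressions
    (tw : Equiv.Perm (Fin ((i + 1) / 2)) → PA (Polynomial ℤ) Polynomial.X ((i + 1) / 2))
    (htw1 : tw 1 = 1)
    (htwmul : ∀ (v : Equiv.Perm (Fin ((i + 1) / 2))) (j : ℕ),
      1 ≤ j → j < (i + 1) / 2 →
      invCount (swN ((i + 1) / 2) j * v) = invCount v + 1 →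
        tw (swN ((i + 1) / 2) j * v)
          = tw v * paT (Polynomial ℤ) Polynomial.X ((i + 1) / 2) j) :
    -- the set 𝒜_i is an R-basis of A_i ...
    (LinearIndependent (Polynomial ℤ)
      (fun p : (x : PLam i) × (PPath i x.1 × PPath i x.1) =>
        st (dPathPA (Polynomial ℤ) Polynomial.X ((i + 1) / 2) i p.2.1) *
          cPA (Polynomial ℤ) Polynomial.X ((i + 1) / 2) tw i p.1.1.1 p.1.1.2 *
          dPathPA (Polynomial ℤ) Polynomial.X ((i + 1) / 2) i p.2.2) ∧
    Submodule.span (Polynomial ℤ) (Set.range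
      (fun p : (x : PLam i) × (PPath i x.1 × PPath i x.1) =>
        st (dPathPA (Polynomial ℤ) Polynomial.X ((i + 1) / 2) i p.2.1) *
          cPA (Polynomial ℤ) Polynomial.X ((i + 1) / 2) tw i p.1.1.1 p.1.1.2 *
          dPathPA (Polynomial ℤ) Polynomial.X ((i + 1) / 2) i p.2.2))
      = Subalgebra.toSubmodule (ASub (Polynomial ℤ) Polynomial.X i)) ∧
    -- ... the poset and index sets are finite ...
    (Finite (PLam i) ∧ ∀ x : PLam i, Finite (PPath i x.1)) ∧
    -- ... the cellular multiplication axiom holds (for `a ∈ A_i`) ...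
    (∀ (x : PLam i) (t : PPath i x.1),
      ∀ a ∈ ASub (Polynomial ℤ) Polynomial.X i,
      ∃ r : PPath i x.1 →₀ Polynomial ℤ, ∀ s : PPath i x.1,
        (st (dPathPA (Polynomial ℤ) Polynomial.X ((i + 1) / 2) i s) *
            cPA (Polynomial ℤ) Polynomial.X ((i + 1) / 2) tw i x.1.1 x.1.2 *
            dPathPA (Polynomial ℤ) Polynomial.X ((i + 1) / 2) i t) * a
          - r.sum (fun v rv => rv •
              (st (dPathPA (Polynomial ℤ) Polynomial.X ((i + 1) / 2) i s) *
                cPA (Polynomial ℤ) Polynomial.X ((i + 1) / 2) tw i x.1.1 x.1.2 *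
                dPathPA (Polynomial ℤ) Polynomial.X ((i + 1) / 2) i v)) ∈
        Submodule.span (Polynomial ℤ)
          {y | ∃ (mm : PLam i) (u w : PPath i mm.1), wGT mm.1 x.1 ∧
            y = st (dPathPA (Polynomial ℤ) Polynomial.X ((i + 1) / 2) i u) *
              cPA (Polynomial ℤ) Polynomial.X ((i + 1) / 2) tw i mm.1.1 mm.1.2 *
              dPathPA (Polynomial ℤ) Polynomial.X ((i + 1) / 2) i w}) ∧
    -- ... and the cellular star axiom holds.
    (∀ (x : PLam i) (s t : PPath i x.1),
      st (st (dPathPA (Polynomial ℤ) Polynomial.X ((i + 1) / 2) i s) *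
          cPA (Polynomial ℤ) Polynomial.X ((i + 1) / 2) tw i x.1.1 x.1.2 *
          dPathPA (Polynomial ℤ) Polynomial.X ((i + 1) / 2) i t)
        - (st (dPathPA (Polynomial ℤ) Polynomial.X ((i + 1) / 2) i t) *
            cPA (Polynomial ℤ) Polynomial.X ((i + 1) / 2) tw i x.1.1 x.1.2 *
            dPathPA (Polynomial ℤ) Polynomial.X ((i + 1) / 2) i s) ∈
        Submodule.span (Polynomial ℤ)
          {y | ∃ (mm : PLam i) (u w : PPath i mm.1), wGT mm.1 x.1 ∧
            y = st (dPathPA (Polynomial ℤ) Polynomial.X ((i + 1) / 2) i u) *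
              cPA (Polynomial ℤ) Polynomial.X ((i + 1) / 2) tw i mm.1.1 mm.1.2 *
              dPathPA (Polynomial ℤ) Polynomial.X ((i + 1) / 2) i w}) := by
  have : NeZero ((i + 1) / 2) := ⟨by omega⟩
  obtain ⟨hanti, hgen⟩ := map_mul_of_reduced (fun j _ _ => PartAlg.paT_sq j) htw1 htwmul
  let T : Equiv.Perm (Fin ((i + 1) / 2)) →*
      PA (Polynomial ℤ) Polynomial.X ((i + 1) / 2) :=
    { toFun := fun σ => tw σ⁻¹
      map_one' := by rw [inv_one, htw1]
      map_mul' := fun σ τ => by rw [mul_inv_rev, hanti] }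
  have hT : PartAlg.IsT T := fun j h1 h2 => by
    show tw (swN _ j)⁻¹ = _
    rw [inv_eq_of_mul_eq_one_left (swN_mul_self j), hgen j h1 h2]
  have hc : ∀ x : PLam i, cPA (Polynomial ℤ) Polynomial.X ((i + 1) / 2) tw i x.1.1 x.1.2 =
      (PartAlg.pData hT).cE i x.1.1 := fun x =>
    PartAlg.cPA_eq hT (fun v => congrArg tw (inv_inv v).symm) x.2.1 x.2.2 le_rfl
  have hs := PartAlg.isStar hT hst_mul hst_st hst_t hst_p hst_ph
  have hd : ∀ (x : PLam i) (d), (PartAlg.pData hT).DElt i x.1.1 d ↔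
      ∃ t : PPath i x.1, dPathPA (Polynomial ℤ) Polynomial.X ((i + 1) / 2) i t = d :=
    PartAlg.dElt_iff hT le_rfl
  have hcard : ∀ x : PLam i, x.1.1.card ≤ i / 2 := fun x => by
    have := x.2
    omega
  have hvert : ∀ mu : YoungDiagram, mu.card ≤ i / 2 → ∃ x : PLam i, x.1.1 = mu := fun mu hmu =>
    ⟨⟨(mu, i / 2 - mu.card), by simp only []; omega⟩, rfl⟩
  have habove : ∀ x y : PLam i, wGT x.1 y.1 ↔ Tab.Above x.1.1 y.1.1 := fun x y =>
    PartAlg.wGT_iff_above (PartAlg.isVertex_iff.2 x.2) (PartAlg.isVertex_iff.2 y.2)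
  have hspan := hs.span_eq_W (i := i) le_rfl
  simp only [hc, PartAlg.ASub_eq_W hT]
  have hfam : Set.range (fun p : (x : PLam i) × (PPath i x.1 × PPath i x.1) =>
      st (dPathPA (Polynomial ℤ) Polynomial.X ((i + 1) / 2) i p.2.1) *
        (PartAlg.pData hT).cE i p.1.1.1 *
        dPathPA (Polynomial ℤ) Polynomial.X ((i + 1) / 2) i p.2.2) =
      {x | ∃ mu : YoungDiagram, mu.card ≤ i / 2 ∧ ∃ s t, (PartAlg.pData hT).DElt i mu s ∧
        (PartAlg.pData hT).DElt i mu t ∧ x = st s * (PartAlg.pData hT).cE i mu * t} := by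
    ext y
    constructor
    · rintro ⟨⟨x, s, t⟩, rfl⟩
      exact ⟨x.1.1, hcard x, _, _, (hd x _).2 ⟨s, rfl⟩, (hd x _).2 ⟨t, rfl⟩, rfl⟩
    · rintro ⟨mu, hmu, s, t, hs', ht, rfl⟩
      obtain ⟨x, rfl⟩ := hvert mu hmu
      obtain ⟨s, rfl⟩ := (hd x _).1 hs'
      obtain ⟨t, rfl⟩ := (hd x _).1 ht
      exact ⟨⟨x, s, t⟩, rfl⟩
  have hJJ : ∀ x : PLam i, (PartAlg.pData hT).JJ i x.1.1 ≤ Submodule.span (Polynomial ℤ)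
      {y | ∃ (mm : PLam i) (u w : PPath i mm.1), wGT mm.1 x.1 ∧
        y = st (dPathPA (Polynomial ℤ) Polynomial.X ((i + 1) / 2) i u) *
          (PartAlg.pData hT).cE i mm.1.1 *
          dPathPA (Polynomial ℤ) Polynomial.X ((i + 1) / 2) i w} := fun x => by
    refine (hs.JJ_le_span le_rfl (hcard x)).trans (Submodule.span_mono ?_)
    rintro _ ⟨mu, hmu, s, t, hs', ht, rfl⟩
    obtain ⟨y, rfl⟩ := hvert mu (hmu.card_le.trans (hcard x))
    obtain ⟨s, rfl⟩ := (hd y _).1 hs'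
    obtain ⟨t, rfl⟩ := (hd y _).1 ht
    exact ⟨y, s, t, (habove y x).2 hmu, rfl⟩
  have hdW : ∀ (x : PLam i) (t : PPath i x.1),
      dPathPA (Polynomial ℤ) Polynomial.X ((i + 1) / 2) i t ∈ (PartAlg.pData hT).W i :=
    fun x t => PData.DElt_mem_W le_rfl ((hd x _).2 ⟨t, rfl⟩)
  refine ⟨⟨?_, by rw [hfam, hspan]⟩, ⟨inferInstance, fun x => inferInstance⟩,
    fun x t a ha => ?_, fun x s t => ?_⟩
  · obtain ⟨g, hg, hli⟩ := Letters.exists_linearIndependent_setoid hT rfl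
    refine linearIndependent_of_card_le hli (fun π => ?_) (PartAlg.card_path_pairs_le i)
    rw [hfam, hspan]
    exact hg π
  · have h := PData.cE_mul_mem le_rfl (hcard x) (mul_mem (hdW x t) ha)
    obtain ⟨y, hy, z, hz, hyz⟩ := Submodule.mem_sup.1 h
    have hy' : y ∈ Submodule.span (Polynomial ℤ) (Set.range fun v : PPath i x.1 =>
        (PartAlg.pData hT).cE i x.1.1 *
          dPathPA (Polynomial ℤ) Polynomial.X ((i + 1) / 2) i v) := by
      refine Submodule.span_mono ?_ hy
      rintro _ ⟨d, hd', rfl⟩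
      obtain ⟨v, rfl⟩ := (hd x _).1 hd'
      exact ⟨v, rfl⟩
    obtain ⟨r, hr⟩ := Finsupp.mem_span_range_iff_exists_finsupp.1 hy'
    refine ⟨r, fun s => hJJ x ?_⟩
    have hz' := PData.mul_JJ_mul (hs.mem_W (hdW x s)) hz (one_mem _)
    convert hz' using 1
    rw [mul_one, sub_eq_iff_eq_add', mul_assoc, mul_assoc, ← hyz, mul_add, ← hr, Finsupp.sum,
      Finsupp.sum, Finset.mul_sum]
    simp only [mul_smul_comm, mul_assoc]
  · rw [hst_mul, hst_mul, hst_st, hs.cE le_rfl (hcard x), ← mul_assoc, sub_self]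
    exact zero_mem _
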